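/- arXiv:1212.3090 — 5 statements merged into one kernel-verified Lean document; each statement's English description precedes it below -/
import Mathlib

section
/- Let B_1, ..., B_m be Laurent difference monomials over ℚ and let C_1, ..., C_m be obtained from them by a sequence of elementary transformations corresponding to row/column operations on the symbolic support matrix (interchanging two monomials, relabeling variables, or replacing B_j by (∏_{k=0}^d (σ^k B_i)^{a_k})·B_j for rational numbers a_k, interpreted via rational powers). Then dtrdeg ℚ⟨B_1, ..., B_m⟩/ℚ = dtrdeg ℚ⟨C_1, ..., C_m⟩/ℚ. -/
/-- A family `a : ι → K` in a difference field `(K, σ)` is transformally independent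
over `ℚ` if the family of all transforms `σ^k (a i)` is algebraically independent over `ℚ`. -/
def TransformallyIndependent {K : Type*} [Field K] [Algebra ℚ K]
    (σ : K →+* K) {ι : Type*} (a : ι → K) : Prop :=
  AlgebraicIndependent ℚ (fun p : ι × ℕ => (σ ^ p.2) (a p.1))

/-- The difference transcendence degree over `ℚ` of the difference field generated by the
finite family `a`: the maximal cardinality of a transformally independent subfamily. -/
noncomputable def dtrdeg {K : Type*} [Field K] [Algebra ℚ K]
    (σ : K →+* K) {m : ℕ} (a : Fin m → K) : ℕ :=
  sSup {k : ℕ | ∃ S : Finset (Fin m), S.card = k ∧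
    TransformallyIndependent σ (fun i : {x // x ∈ S} => a i)}

/-- One elementary transformation (over `ℚ[x]`) on symbolic support matrices:
Type 1: interchange two rows (interchange two monomials); Type 2: add an
`f(x)`-multiple of one row to another (multiply a monomial by a rational power product of
transforms of another); Type 3: interchange two columns (relabel the variables). -/
def ElemStep {m n : ℕ} (M N : Matrix (Fin m) (Fin n) (Polynomial ℚ)) : Prop :=
  (∃ i j : Fin m, N = M.submatrix (Equiv.swap i j) id) ∨
  (∃ i j : Fin m, ∃ f : Polynomial ℚ, i ≠ j ∧ N = M.updateRow i (M i + f • M j)) ∨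
  (∃ i j : Fin n, N = M.submatrix id (Equiv.swap i j))

theorem algInd_iff_LI {K ι : Type*} [Field K] [Algebra ℚ K] (z : ι → K) :
    AlgebraicIndependent ℚ z ↔
      LinearIndependent ℚ (fun u : ι →₀ ℕ => u.prod (fun p e => z p ^ e)) := by
  have h : (fun u : ι →₀ ℕ => u.prod (fun p e => z p ^ e)) =
      (MvPolynomial.aeval (R := ℚ) z).toLinearMap ∘ (MvPolynomial.basisMonomials ι ℚ) := by
    funext u
    simp [MvPolynomial.aeval_monomial]
  rw [h]
  constructor
  · intro hz
    exact (MvPolynomial.basisMonomials ι ℚ).linearIndependent.map'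
      _ (LinearMap.ker_eq_bot.2 hz)
  · intro hl
    have key : ∀ P, MvPolynomial.aeval (R := ℚ) z P = Finsupp.linearCombination ℚ
        ((MvPolynomial.aeval (R := ℚ) z).toLinearMap ∘ (MvPolynomial.basisMonomials ι ℚ))
        ((MvPolynomial.basisMonomials ι ℚ).repr P) := by
      intro P
      rw [← Finsupp.apply_linearCombination, Module.Basis.linearCombination_repr]
      rfl
    intro P Q hPQ
    rw [key, key] at hPQ
    exact (MvPolynomial.basisMonomials ι ℚ).repr.injective (hl hPQ)

theorem laurent_add {K ι : Type*} [Field K] (z : ι → K) (hz : ∀ i, z i ≠ 0) (a b : ι →₀ ℤ) :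
    (a + b).prod (fun p e => z p ^ e) =
      a.prod (fun p e => z p ^ e) * b.prod (fun p e => z p ^ e) :=
  Finsupp.prod_add_index' (by simp) (fun i m n => zpow_add₀ (hz i) m n)

theorem laurent_ne {K ι : Type*} [Field K] (z : ι → K) (hz : ∀ i, z i ≠ 0) (a : ι →₀ ℤ) :
    a.prod (fun p e => z p ^ e) ≠ 0 :=
  Finset.prod_ne_zero_iff.2 (fun i _ => zpow_ne_zero _ (hz i))

theorem laurent_nat {K ι : Type*} [Field K] (z : ι → K) (u : ι →₀ ℕ) :
    (u.mapRange (Nat.cast : ℕ → ℤ) rfl).prod (fun p e => z p ^ e) =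
      u.prod (fun p e => z p ^ e) := by
  rw [Finsupp.prod_mapRange_index (by simp)]
  simp

theorem laurent_LI {K ι : Type*} [Field K] [Algebra ℚ K] (z : ι → K)
    (hz : AlgebraicIndependent ℚ z) :
    LinearIndependent ℚ (fun w : ι →₀ ℤ => w.prod (fun p e => z p ^ e)) := by
  classical
  have hz0 : ∀ i, z i ≠ 0 := fun i => hz.ne_zero i
  rw [linearIndependent_iff_finset_linearIndependent]
  intro s
  let N : ι →₀ ℕ := ∑ w ∈ s, w.mapRange Int.natAbs rfl
  have hN : ∀ w ∈ s, ∀ i, 0 ≤ w i + (N i : ℤ) := by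
    intro w hw i
    have : (w.mapRange Int.natAbs rfl) i ≤ N i := by
      simp only [N, Finsupp.finsetSum_apply]
      exact Finset.single_le_sum (f := fun w : ι →₀ ℤ => (w.mapRange Int.natAbs rfl) i)
        (fun _ _ => Nat.zero_le _) hw
    simp only [Finsupp.mapRange_apply] at this
    omega
  let N' : ι →₀ ℤ := N.mapRange (Nat.cast : ℕ → ℤ) rfl
  let u : s → (ι →₀ ℕ) := fun w => ((w : ι →₀ ℤ) + N').mapRange Int.toNat rfl
  have hu : ∀ w, (u w).mapRange (Nat.cast : ℕ → ℤ) rfl = (w : ι →₀ ℤ) + N' := by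
    intro w
    ext i
    have := hN w w.2 i
    simp only [u, N', Finsupp.mapRange_apply, Finsupp.add_apply]
    omega
  have hui : Function.Injective u := by
    intro a b hab
    have h1 := hu a
    rw [hab, hu b] at h1
    exact Subtype.ext (add_right_cancel h1).symm
  have h2 := ((algInd_iff_LI z).1 hz).comp u hui
  apply LinearIndependent.of_comp (LinearMap.mulRight ℚ (N'.prod (fun p e => z p ^ e)))
  have h3 : (LinearMap.mulRight ℚ (N'.prod (fun p e => z p ^ e))) ∘
      (fun w : ι →₀ ℤ => w.prod (fun p e => z p ^ e)) ∘ Subtype.val =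
      (fun u : ι →₀ ℕ => u.prod (fun p e => z p ^ e)) ∘ u := by
    funext w
    simp only [Function.comp, LinearMap.mulRight_apply]
    rw [← laurent_nat, hu, laurent_add z hz0]
  rw [h3]
  exact h2

theorem algInd_iff_zLI {K ι T : Type*} [Field K] [Algebra ℚ K] (z : ι → K)
    (hz : AlgebraicIndependent ℚ z) (v : T → (ι →₀ ℤ)) :
    AlgebraicIndependent ℚ (fun t => (v t).prod (fun p e => z p ^ e)) ↔
      LinearIndependent ℤ v := by
  have hz0 : ∀ i, z i ≠ 0 := fun i => hz.ne_zero i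
  have key : ∀ a : T →₀ ℤ, a.prod (fun t e => ((v t).prod (fun p e => z p ^ e)) ^ e) =
      (Finsupp.linearCombination ℤ v a).prod (fun p e => z p ^ e) := by
    intro a
    induction a using Finsupp.induction_linear with
    | zero => simp
    | add f g hf hg =>
      rw [laurent_add _ (fun t => laurent_ne z hz0 (v t)), hf, hg, map_add, laurent_add z hz0]
    | single t c =>
      rw [Finsupp.prod_single_index (by simp), Finsupp.linearCombination_single]
      have : (c • v t) = (v t).mapRange (fun e => c * e) (by simp) := by
        ext i; simp
      rw [this, Finsupp.prod_mapRange_index (by simp)]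
      simp only [Finsupp.prod, ← Finset.prod_zpow]
      refine Finset.prod_congr rfl (fun i _ => ?_)
      rw [← zpow_mul, mul_comm]
  constructor
  · intro hx
    have hi := (laurent_LI _ hx).injective
    intro a b hab
    apply hi
    simp only [key, hab]
  · intro hv
    rw [algInd_iff_LI]
    have h3 := ((laurent_LI z hz).comp _ hv).comp
      (fun u : T →₀ ℕ => u.mapRange (Nat.cast : ℕ → ℤ) rfl)
      (Finsupp.mapRange_injective _ rfl Nat.cast_injective)
    convert h3 using 1
    funext u
    simp only [Function.comp]
    rw [← key, laurent_nat]

theorem tower_LI {V I : Type*} [AddCommGroup V] [Module ℚ V] [Module (Polynomial ℚ) V]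
    [IsScalarTower ℚ (Polynomial ℚ) V] (M : I → V) :
    LinearIndependent ℚ (fun p : I × ℕ => (Polynomial.X ^ p.2 : Polynomial ℚ) • M p.1) ↔
      LinearIndependent (Polynomial ℚ) M := by
  classical
  constructor
  · intro h
    rw [linearIndependent_iff'] at h ⊢
    intro s g hg i hi
    let D := s.sup (fun i => (g i).natDegree)
    have hD : ∀ i ∈ s, (g i).natDegree < D + 1 := fun i hi =>
      Nat.lt_succ_of_le (Finset.le_sup (f := fun i => (g i).natDegree) hi)
    have := h (s ×ˢ Finset.range (D + 1)) (fun p => (g p.1).coeff p.2) (by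
      rw [Finset.sum_product, ← hg]
      refine Finset.sum_congr rfl (fun i hi => ?_)
      conv_rhs => rw [(g i).as_sum_range' (D + 1) (hD i hi), Finset.sum_smul]
      refine Finset.sum_congr rfl (fun k _ => ?_)
      simp only
      rw [← smul_assoc, Polynomial.smul_X_eq_monomial])
    ext k
    by_cases hk : k < D + 1
    · simpa using this (i, k) (by simp [hi]; omega)
    · rw [Polynomial.coeff_eq_zero_of_natDegree_lt (by have := hD i hi; omega)]; simp
  · intro h
    have := linearIndependent_smul (Polynomial.basisMonomials ℚ).linearIndependent h
    have h2 := this.comp (Prod.swap) Prod.swap_injective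
    convert h2 using 1
    funext p
    simp [Polynomial.X_pow_eq_monomial]

theorem z_of_q {V I : Type*} [AddCommGroup V] [Module ℚ V] (M : I → V)
    (h : LinearIndependent ℚ M) : LinearIndependent ℤ M :=
  (LinearIndependent.iff_fractionRing ℤ ℚ).2 h

theorem exps_inj (n : ℕ) : LinearIndependent ℤ
    (fun p : Fin n × ℕ => (Polynomial.X ^ p.2 : Polynomial ℚ) •
      (Pi.single p.1 1 : Fin n → Polynomial ℚ)) := by
  have h0 : LinearIndependent (Polynomial ℚ)
      (fun i => (Pi.single i 1 : Fin n → Polynomial ℚ)) := by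
    have h1 : (fun i => (Pi.single i 1 : Fin n → Polynomial ℚ)) =
        Pi.basisFun (Polynomial ℚ) (Fin n) := by
      funext j
      simp
    rw [h1]
    exact (Pi.basisFun (Polynomial ℚ) (Fin n)).linearIndependent
  have h1 := (tower_LI _).2 h0
  exact z_of_q _ h1

theorem ti_iff {K : Type*} [Field K] [Algebra ℚ K] (σ : K →+* K)
    (n m s : ℕ) (y : Fin n → K)
    (hy : TransformallyIndependent σ y)
    (d : Fin m → Fin n → ℕ → ℤ) (B : Fin m → K)
    (hB : ∀ i, B i = ∏ j : Fin n, ∏ k ∈ Finset.range (s + 1), ((σ ^ k) (y j)) ^ (d i j k))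
    (MB : Matrix (Fin m) (Fin n) (Polynomial ℚ))
    (hMB : ∀ i j, MB i j = ∑ k ∈ Finset.range (s + 1),
      Polynomial.C ((d i j k : ℚ)) * Polynomial.X ^ k) (S : Finset (Fin m)) :
    TransformallyIndependent σ (fun i : {x // x ∈ S} => B i) ↔
      LinearIndependent (Polynomial ℚ) (fun i : {x // x ∈ S} => MB i) := by
  classical
  unfold TransformallyIndependent at hy
  have hz0 := fun i => hy.ne_zero i
  let v : {x // x ∈ S} × ℕ → (Fin n × ℕ →₀ ℤ) := fun p =>
    ∑ j : Fin n, ∑ k ∈ Finset.range (s + 1), Finsupp.single (j, p.2 + k) (d p.1 j k)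
  have hsum : ∀ {A : Type} (t : Finset A) (f : A → (Fin n × ℕ →₀ ℤ)),
      (∑ a ∈ t, f a).prod (fun p e => ((σ ^ p.2) (y p.1)) ^ e) =
      ∏ a ∈ t, (f a).prod (fun p e => ((σ ^ p.2) (y p.1)) ^ e) := by
    intro A t f
    induction t using Finset.induction_on with
    | empty => simp
    | insert a t ha ih =>
      rw [Finset.sum_insert ha, Finset.prod_insert ha, laurent_add _ hz0, ih]
  have hv : (fun p : {x // x ∈ S} × ℕ => (σ ^ p.2) (B p.1)) =
      fun t => (v t).prod (fun p e => ((σ ^ p.2) (y p.1)) ^ e) := by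
    funext p
    simp only [v]
    rw [hsum, hB, map_prod]
    refine Finset.prod_congr rfl (fun j _ => ?_)
    rw [hsum, map_prod]
    refine Finset.prod_congr rfl (fun k _ => ?_)
    rw [Finsupp.prod_single_index (by simp), map_zpow₀, pow_add]
    rfl
  unfold TransformallyIndependent
  rw [hv, algInd_iff_zLI _ hy, ← tower_LI, ← LinearIndependent.iff_fractionRing ℤ ℚ,
    ← LinearMap.linearIndependent_iff _ (LinearMap.ker_eq_bot.2 (exps_inj n))]
  apply iff_of_eq
  congr 1
  funext p
  simp only [Function.comp, v, map_sum, Finsupp.linearCombination_single]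
  funext j'
  simp only [Finset.sum_apply, Pi.smul_apply, hMB]
  rw [Finset.sum_eq_single j']
  · rw [Finset.smul_sum]
    refine Finset.sum_congr rfl (fun k _ => ?_)
    simp [pow_add]
    ring
  · intro b _ hb
    simp [Pi.single_eq_of_ne hb.symm]
  · simp

theorem sSup_eq_rank {n m : ℕ} (M : Matrix (Fin m) (Fin n) (Polynomial ℚ)) :
    sSup {k : ℕ | ∃ S : Finset (Fin m), S.card = k ∧
      LinearIndependent (Polynomial ℚ) (fun i : {x // x ∈ S} => M i)} =
    (M.map (algebraMap (Polynomial ℚ) (RatFunc ℚ))).rank := by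
  classical
  have hli : ∀ S : Finset (Fin m),
      LinearIndependent (Polynomial ℚ) (fun i : {x // x ∈ S} => M i) ↔
      LinearIndependent (RatFunc ℚ) (fun i : {x // x ∈ S} =>
        (M.map (algebraMap (Polynomial ℚ) (RatFunc ℚ))) i) := by
    intro S
    rw [← LinearIndependent.iff_fractionRing (Polynomial ℚ) (RatFunc ℚ)]
    let φ : (Fin n → Polynomial ℚ) →ₗ[Polynomial ℚ] (Fin n → RatFunc ℚ) :=
      (Algebra.linearMap (Polynomial ℚ) (RatFunc ℚ)).compLeft (Fin n)
    have hφ : LinearMap.ker φ = ⊥ := by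
      rw [LinearMap.ker_eq_bot]
      intro a b hab
      funext j
      exact IsFractionRing.injective (Polynomial ℚ) (RatFunc ℚ) (congrFun hab j)
    rw [← LinearMap.linearIndependent_iff φ hφ]
    rfl
  simp only [hli]
  generalize M.map (algebraMap (Polynomial ℚ) (RatFunc ℚ)) = A
  rw [Matrix.rank_eq_finrank_span_row]
  apply le_antisymm
  · apply csSup_le'
    rintro k ⟨S, rfl, hS⟩
    have h1 := finrank_span_eq_card hS
    rw [Fintype.card_coe] at h1
    rw [← h1]
    apply Submodule.finrank_mono
    apply Submodule.span_mono
    rintro _ ⟨i, rfl⟩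
    exact ⟨i, rfl⟩
  · apply le_csSup
    · refine ⟨m, ?_⟩
      rintro k ⟨S, rfl, -⟩
      simpa using S.card_le_univ
    · obtain ⟨κ, a, ha, hsp, hl⟩ := exists_linearIndependent' (RatFunc ℚ) A
      have : Fintype κ := Fintype.ofInjective a ha
      refine ⟨Finset.univ.image a, ?_, ?_⟩
      · rw [Finset.card_image_of_injective _ ha, Finset.card_univ, ← finrank_span_eq_card hl, hsp]
        rfl
      · let g : {x // x ∈ Finset.univ.image a} → κ := fun x =>
          (Finset.mem_image.1 x.2).choose
        have hg : ∀ x, a (g x) = x := fun x => (Finset.mem_image.1 x.2).choose_spec.2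
        have := hl.comp g (fun x x' h => by
          apply Subtype.ext; rw [← hg, h, hg])
        have h5 : (fun i : {x // x ∈ Finset.univ.image a} => A i) = (A ∘ a) ∘ g := by
          funext x
          simp only [Function.comp, hg]
        rw [h5]
        exact this

theorem rank_step {n m : ℕ} (M N : Matrix (Fin m) (Fin n) (Polynomial ℚ)) (h : ElemStep M N) :
    (M.map (algebraMap (Polynomial ℚ) (RatFunc ℚ))).rank =
    (N.map (algebraMap (Polynomial ℚ) (RatFunc ℚ))).rank := by
  rcases h with ⟨i, j, rfl⟩ | ⟨i, j, f, hij, rfl⟩ | ⟨i, j, rfl⟩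
  · exact (Matrix.rank_submatrix (M.map _) (Equiv.swap i j) (Equiv.refl _)).symm
  · have : M.updateRow i (M i + f • M j) = Matrix.transvection i j f * M := by
      ext a b
      rcases eq_or_ne a i with rfl | ha
      · simp
      · simp [ha]
    rw [this, Matrix.map_mul, Matrix.rank_mul_eq_right_of_isUnit_det]
    rw [← RingHom.mapMatrix_apply, ← RingHom.map_det, Matrix.det_transvection_of_ne _ _ hij]
    simp
  · exact (Matrix.rank_submatrix (M.map _) (Equiv.refl _) (Equiv.swap i j)).symm

/-- if the Laurent difference monomials `C₁,…,C_m` are obtained from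
`B₁,…,B_m` by a sequence of elementary transformations of their symbolic support matrices,
then `dtrdeg ℚ⟨B₁,…,B_m⟩/ℚ = dtrdeg ℚ⟨C₁,…,C_m⟩/ℚ`. -/
theorem stmt_4 {K : Type*} [Field K] [Algebra ℚ K] (σ : K →+* K)
    (hσ : Function.Injective σ)
    (n m s : ℕ) (y : Fin n → K)
    (hy : TransformallyIndependent σ y)
    (d e : Fin m → Fin n → ℕ → ℤ)
    (B C : Fin m → K)
    (hB : ∀ i, B i = ∏ j : Fin n, ∏ k ∈ Finset.range (s + 1), ((σ ^ k) (y j)) ^ (d i j k))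
    (hC : ∀ i, C i = ∏ j : Fin n, ∏ k ∈ Finset.range (s + 1), ((σ ^ k) (y j)) ^ (e i j k))
    (MB MC : Matrix (Fin m) (Fin n) (Polynomial ℚ))
    (hMB : ∀ i j, MB i j = ∑ k ∈ Finset.range (s + 1),
      Polynomial.C ((d i j k : ℚ)) * Polynomial.X ^ k)
    (hMC : ∀ i j, MC i j = ∑ k ∈ Finset.range (s + 1),
      Polynomial.C ((e i j k : ℚ)) * Polynomial.X ^ k)
    (htrans : Relation.ReflTransGen ElemStep MB MC) :
    dtrdeg σ B = dtrdeg σ C := by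
  have h1 : dtrdeg σ B = (MB.map (algebraMap (Polynomial ℚ) (RatFunc ℚ))).rank := by
    rw [← sSup_eq_rank]
    simp only [dtrdeg, ti_iff σ n m s y hy d B hB MB hMB]
  have h2 : dtrdeg σ C = (MC.map (algebraMap (Polynomial ℚ) (RatFunc ℚ))).rank := by
    rw [← sSup_eq_rank]
    simp only [dtrdeg, ti_iff σ n m s y hy e C hC MC hMC]
  rw [h1, h2]
  clear h1 h2 hMB hMC
  induction htrans with
  | refl => rfl
  | tail _ h ih => exact ih.trans (rank_step _ _ h)
end

section
/- Let B be a regular chain in F[x_1,...,x_n] and let √asat(B) = ⋂_{i=1}^m P_i be an irredundant prime decomposition of the radical of its algebraic saturation ideal. Then a polynomial f is invertible with respect to asat(B) (that is, (f, asat(B)) ∩ F[U] ≠ {0}, where U is the parameter set of B) if and only if f ∉ P_i for all i = 1, ..., m. -/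
open MvPolynomial

variable {F : Type*} [Field F] {U : Type*} {m : ℕ}

namespace RegChain

/-- Degree bound for substitutions into a univariate polynomial ring. -/
lemma natDegree_aeval_le {K σ T : Type*} [Field K] [CommRing T] [Algebra K T]
    (v : σ → Polynomial T) (k : σ) (hk : (v k).natDegree ≤ 1)
    (hv : ∀ i, i ≠ k → (v i).natDegree = 0) (p : MvPolynomial σ K) :
    (MvPolynomial.aeval v p).natDegree ≤ p.degreeOf k := by
  classical
  rw [MvPolynomial.aeval_def, MvPolynomial.eval₂_eq]
  refine Polynomial.natDegree_sum_le_of_forall_le _ _ ?_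
  intro s hs
  refine le_trans ?_ (MvPolynomial.monomial_le_degreeOf k hs)
  rw [Polynomial.algebraMap_apply]
  refine (Polynomial.natDegree_C_mul_le _ _).trans ?_
  refine (Polynomial.natDegree_prod_le _ _).trans ?_
  have h1 : ∀ i ∈ s.support, (v i ^ s i).natDegree ≤ if i = k then s k else 0 := by
    intro i _
    refine Polynomial.natDegree_pow_le.trans ?_
    split_ifs with h
    · subst h
      calc _ ≤ s i * 1 := Nat.mul_le_mul_left _ hk
        _ = _ := mul_one _
    · simp [hv i h]
  refine (Finset.sum_le_sum h1).trans ?_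
  rw [Finset.sum_ite_eq']
  split_ifs <;> simp

lemma notMem_vars {K σ : Type*} [Field K] {k : σ} {p : MvPolynomial σ K}
    (h : p.degreeOf k = 0) : k ∉ p.vars := by
  classical
  rw [MvPolynomial.degreeOf_def, Multiset.count_eq_zero] at h
  rwa [MvPolynomial.vars_def, Multiset.mem_toFinset]

open Polynomial in
/-- Nonzerodivisors stay nonzerodivisors modulo a polynomial with regular leading coefficient. -/
lemma poly_step {T : Type*} [CommRing T] (a q : T) (ha : ∀ x, a * x = 0 → x = 0)
    (hq : ∀ x, q * x = 0 → x = 0) (d : ℕ) (t : T[X]) (ht : t.natDegree < d) :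
    ∀ (n : ℕ) (p c : T[X]), p.natDegree ≤ n →
      Polynomial.C q * p = c * (Polynomial.C a * Polynomial.X ^ d + t) →
      ∃ (e : ℕ) (c' : T[X]), Polynomial.C a ^ e * p =
        c' * (Polynomial.C a * Polynomial.X ^ d + t) := by
  intro n
  set b := Polynomial.C a * Polynomial.X ^ d + t with hb
  have hCq : ∀ p : T[X], Polynomial.C q * p = 0 → p = 0 := by
    intro p hp
    ext i
    apply hq
    rw [← Polynomial.coeff_C_mul, hp]; simp
  have hbc : b.coeff d = a := by
    rw [hb]; simp [Polynomial.coeff_eq_zero_of_natDegree_lt ht]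
  have hbd : b.natDegree ≤ d := by
    rw [hb]
    refine (Polynomial.natDegree_add_le _ _).trans (max_le ?_ ht.le)
    exact Polynomial.natDegree_C_mul_X_pow_le _ _
  induction n using Nat.strong_induction_on with
  | _ n ih =>
  intro p c hpn h
  by_cases hc : c = 0
  · subst hc
    refine ⟨0, 0, ?_⟩
    rw [zero_mul] at h
    simp [hCq p h]
  have htop : (c * b).coeff (c.natDegree + d) = c.leadingCoeff * a := by
    rw [Polynomial.coeff_mul_add_eq_of_natDegree_le le_rfl hbd, hbc]; rfl
  have hne : c.leadingCoeff * a ≠ 0 := by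
    intro h0
    rw [mul_comm] at h0
    exact hc (Polynomial.leadingCoeff_eq_zero.mp (ha _ h0))
  have hle : c.natDegree + d ≤ p.natDegree := by
    by_contra hlt
    push Not at hlt
    apply hne
    rw [← htop, ← h, Polynomial.coeff_C_mul, Polynomial.coeff_eq_zero_of_natDegree_lt hlt, mul_zero]
  have hdp : d ≤ p.natDegree := le_trans (Nat.le_add_left _ _) hle
  set N := p.natDegree with hN
  set p' := Polynomial.C a * p - Polynomial.C p.leadingCoeff * Polynomial.X ^ (N - d) * b with hp'
  have hp'd : p'.natDegree < N := by
    have hNpos : 0 < N := lt_of_lt_of_le (lt_of_le_of_lt (Nat.zero_le _) ht) hdp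
    have hle' : p'.natDegree ≤ N := by
      rw [hp']
      refine (Polynomial.natDegree_sub_le _ _).trans (max_le ?_ ?_)
      · exact Polynomial.natDegree_C_mul_le _ _
      · refine Polynomial.natDegree_mul_le.trans ?_
        have := Polynomial.natDegree_C_mul_X_pow_le p.leadingCoeff (N - d)
        omega
    have hz : p'.coeff N = 0 := by
      rw [hp', Polynomial.coeff_sub, Polynomial.coeff_C_mul]
      have hs : N = (N - d) + d := by omega
      have : (Polynomial.C p.leadingCoeff * Polynomial.X ^ (N - d) * b).coeff N
          = p.leadingCoeff * a := by
        conv_lhs => rw [hs]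
        rw [show N - d + d - d = N - d by omega]
        rw [Polynomial.coeff_mul_add_eq_of_natDegree_le
          (Polynomial.natDegree_C_mul_X_pow_le _ _) hbd, hbc]
        simp
      rw [this, hN]
      change a * p.leadingCoeff - _ = 0
      ring
    rcases hle'.lt_or_eq with h1 | h1
    · exact h1
    · exfalso
      rw [← h1] at hz
      have : p' = 0 := Polynomial.leadingCoeff_eq_zero.mp hz
      rw [this] at h1
      simp at h1
      omega
  obtain ⟨e, c', hc'⟩ := ih p'.natDegree (lt_of_lt_of_le hp'd hpn) p'
    (Polynomial.C a * c - Polynomial.C q * (Polynomial.C p.leadingCoeff * Polynomial.X ^ (N - d)))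
    le_rfl (by rw [hp']; linear_combination Polynomial.C a * h)
  refine ⟨e + 1, c' + Polynomial.C a ^ e * (Polynomial.C p.leadingCoeff * Polynomial.X ^ (N - d)), ?_⟩
  rw [hp'] at hc'
  linear_combination hc'

/-- The same, transported along a "view as univariate polynomial" map. -/
lemma ring_step {R : Type*} [CommRing R] (φ : R →+* Polynomial R) (y : R)
    (hφ : ∀ p, (φ p).eval y = p) (J : Ideal R) (hJ : ∀ p ∈ J, φ p ∈ J.map Polynomial.C)
    (a q : R) (haJ : ∀ x, a * x ∈ J → x ∈ J) (hqJ : ∀ x, q * x ∈ J → x ∈ J)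
    (hφq : φ q = Polynomial.C q) (d : ℕ) (b : R) (t : Polynomial R)
    (ht : t.natDegree < d) (hb : φ b = Polynomial.C a * Polynomial.X ^ d + t)
    (p c : R) (h : q * p - c * b ∈ J) :
    ∃ (e : ℕ) (c' : R), a ^ e * p - c' * b ∈ J := by
  have key : ∀ f : Polynomial R, Polynomial.map (Ideal.Quotient.mk J) f = 0 → f.eval y ∈ J := by
    intro f hf
    rw [Polynomial.eval_eq_sum]
    refine J.sum_mem fun i _ => J.mul_mem_right _ ?_
    rw [← Ideal.Quotient.eq_zero_iff_mem, ← Polynomial.coeff_map, hf, Polynomial.coeff_zero]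
  have key2 : ∀ f ∈ J.map (Polynomial.C : R →+* Polynomial R),
      Polynomial.map (Ideal.Quotient.mk J) f = 0 := by
    intro f hf
    ext i
    rw [Polynomial.coeff_map, Polynomial.coeff_zero, Ideal.Quotient.eq_zero_iff_mem]
    exact Ideal.mem_map_C_iff.mp hf i
  have nz : ∀ z : R, (∀ x, z * x ∈ J → x ∈ J) →
      ∀ x, Ideal.Quotient.mk J z * x = 0 → x = 0 := by
    intro z hz x hx
    obtain ⟨x, rfl⟩ := Ideal.Quotient.mk_surjective x
    rw [← map_mul, Ideal.Quotient.eq_zero_iff_mem] at hx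
    exact Ideal.Quotient.eq_zero_iff_mem.mpr (hz x hx)
  have h1 := key2 _ (hJ _ h)
  simp only [map_sub, map_mul, hφq, hb, Polynomial.map_sub, Polynomial.map_mul, Polynomial.map_add,
    Polynomial.map_C, Polynomial.map_pow, Polynomial.map_X, sub_eq_zero] at h1
  obtain ⟨e, c', hc'⟩ := poly_step _ _ (nz a haJ) (nz q hqJ) d
    (t.map (Ideal.Quotient.mk J)) (lt_of_le_of_lt Polynomial.natDegree_map_le ht) _ _ _ le_rfl h1
  obtain ⟨c', rfl⟩ := Polynomial.map_surjective _ Ideal.Quotient.mk_surjective c'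
  refine ⟨e, c'.eval y, ?_⟩
  have h2 := key (Polynomial.C a ^ e * φ p - c' * φ b) (by
    rw [hb]
    simpa [sub_eq_zero] using hc')
  simpa [hφ] using h2

/-- Saturation of an ideal by a multiplicative set. -/
def sat {R : Type*} [CommRing R] (I : Ideal R) (S : Submonoid R) : Ideal R where
  carrier := {p | ∃ h ∈ S, h * p ∈ I}
  add_mem' := by
    rintro p p' ⟨h, hh, hp⟩ ⟨h', hh', hp'⟩
    refine ⟨h * h', S.mul_mem hh hh', ?_⟩
    have : h * h' * (p + p') = h' * (h * p) + h * (h' * p') := by ring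
    rw [this]
    exact I.add_mem (I.mul_mem_left _ hp) (I.mul_mem_left _ hp')
  zero_mem' := ⟨1, S.one_mem, by simp⟩
  smul_mem' := by
    rintro c p ⟨h, hh, hp⟩
    refine ⟨h, hh, ?_⟩
    have : h * (c • p) = c * (h * p) := by simp only [smul_eq_mul]; ring
    rw [this]
    exact I.mul_mem_left _ hp

lemma mem_sat {R : Type*} [CommRing R] {I : Ideal R} {S : Submonoid R} {p : R} :
    p ∈ sat I S ↔ ∃ h ∈ S, h * p ∈ I := Iff.rfl

/-- View a polynomial as univariate in the variable `k`. -/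
noncomputable def phi (K : Type*) [Field K] {σ : Type*} (k : σ) :
    MvPolynomial σ K →ₐ[K] Polynomial (MvPolynomial σ K) :=
  open Classical in
  MvPolynomial.aeval (fun i => if i = k then Polynomial.X else Polynomial.C (MvPolynomial.X i))

lemma phi_X_self {K σ : Type*} [Field K] (k : σ) : phi K k (MvPolynomial.X k) = Polynomial.X := by
  simp [phi]

lemma phi_eval {K σ : Type*} [Field K] (k : σ) (p : MvPolynomial σ K) :
    (phi K k p).eval (MvPolynomial.X k) = p := by
  change ((Polynomial.evalRingHom (MvPolynomial.X k)).comp (phi K k : _ →+* _)) p = RingHom.id _ p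
  congr 1
  ext i
  · simp [Polynomial.algebraMap_apply, MvPolynomial.algebraMap_eq]
  · by_cases h : i = k
    · subst h; simp [phi]
    · simp [phi, h]

lemma phi_C {K σ : Type*} [Field K] (k : σ) (p : MvPolynomial σ K) (h : p.degreeOf k = 0) :
    phi K k p = Polynomial.C p := by
  change (phi K k : _ →+* _) p = Polynomial.C p
  refine MvPolynomial.hom_congr_vars ?_ ?_ rfl
  · ext i
    simp [Polynomial.algebraMap_apply, MvPolynomial.algebraMap_eq]
  · intro i hi _
    have : i ≠ k := by rintro rfl; exact notMem_vars h hi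
    simp [phi, this]

lemma phi_natDegree {K σ : Type*} [Field K] (k : σ) (p : MvPolynomial σ K) :
    (phi K k p).natDegree ≤ p.degreeOf k := by
  refine natDegree_aeval_le _ k ?_ ?_ p
  · simp
  · intro i hi; simp [hi]

section main
variable {K : Type*} [Field K] {V : Type*} {m : ℕ}

lemma degreeOf_range (k : Fin m) (q : MvPolynomial (V ⊕ Fin m) K)
    (hq : q ∈ (MvPolynomial.rename (R := K) (Sum.inl : V → V ⊕ Fin m)).range) :
    q.degreeOf (Sum.inr k) = 0 := by
  classical
  obtain ⟨q, rfl⟩ := hq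
  have : Sum.inr k ∉ (MvPolynomial.rename (Sum.inl : V → V ⊕ Fin m) q).vars := by
    intro h
    have := MvPolynomial.vars_rename _ _ h
    simp at this
  rw [MvPolynomial.degreeOf_def, Multiset.count_eq_zero]
  rwa [MvPolynomial.vars_def, Multiset.mem_toFinset] at this

lemma sat_regular (B init tail : Fin m → MvPolynomial (V ⊕ Fin m) K) (d : Fin m → ℕ)
    (hdecomp : ∀ i, B i = init i * (X (Sum.inr i)) ^ (d i) + tail i)
    (htail : ∀ i, (tail i).degreeOf (Sum.inr i) < d i)
    (hinitvars : ∀ i j : Fin m, (i : ℕ) ≤ (j : ℕ) → (init i).degreeOf (Sum.inr j) = 0)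
    (htri : ∀ i j : Fin m, (i : ℕ) < (j : ℕ) → (B i).degreeOf (Sum.inr j) = 0)
    (q : MvPolynomial (V ⊕ Fin m) K) (hq0 : q ≠ 0)
    (hq : q ∈ (MvPolynomial.rename (R := K) (Sum.inl : V → V ⊕ Fin m)).range) :
    ∀ k : ℕ, k ≤ m → ∀ p,
      q * p ∈ sat (Ideal.span (B '' {j | (j : ℕ) < k}))
        (Submonoid.closure (init '' {j | (j : ℕ) < k})) →
      p ∈ sat (Ideal.span (B '' {j | (j : ℕ) < k}))
        (Submonoid.closure (init '' {j | (j : ℕ) < k})) := by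
  intro k
  induction k with
  | zero =>
    intro _ p hp
    simp only [Nat.not_lt_zero, Set.setOf_false, Set.image_empty, Ideal.span_empty,
      Submonoid.closure_empty, mem_sat, Submonoid.mem_bot, exists_eq_left,
      Ideal.mem_bot, one_mul] at hp ⊢
    exact (mul_eq_zero.mp hp).resolve_left hq0
  | succ k ih =>
    intro hk p hp
    have ih := ih (by omega)
    set κ : Fin m := ⟨k, hk⟩ with hκ
    set I := Ideal.span (B '' {j : Fin m | (j : ℕ) < k}) with hI
    set S := Submonoid.closure (init '' {j : Fin m | (j : ℕ) < k}) with hS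
    set S' := Submonoid.closure (init '' {j : Fin m | (j : ℕ) < k + 1}) with hS'
    have hset : {j : Fin m | (j : ℕ) < k + 1} = insert κ {j : Fin m | (j : ℕ) < k} := by
      ext j
      simp only [Set.mem_setOf_eq, Set.mem_insert_iff, hκ, Fin.ext_iff]
      omega
    have hI' : Ideal.span (B '' {j : Fin m | (j : ℕ) < k + 1}) = Ideal.span {B κ} ⊔ I := by
      rw [hset, Set.image_insert_eq, Ideal.span_insert]
    have hSS' : ∀ h ∈ S, h ∈ S' := fun h hh => by
      refine Submonoid.closure_mono (Set.image_mono ?_) hh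
      intro j (hj : (j : ℕ) < k)
      exact Nat.lt_succ_of_lt hj
    have haS' : init κ ∈ S' := Submonoid.subset_closure ⟨κ, Nat.lt_succ_self k, rfl⟩
    have hS'C : ∀ h ∈ S', phi K (Sum.inr κ) h = Polynomial.C h := by
      intro h hh
      induction hh using Submonoid.closure_induction with
      | mem x hx =>
        obtain ⟨j, hj, rfl⟩ := hx
        exact phi_C _ _ (hinitvars j κ (Nat.lt_succ_iff.mp hj))
      | one => simp
      | mul x y _ _ hx hy => simp [hx, hy]
    have hIC : ∀ p ∈ I, phi K (Sum.inr κ) p ∈ I.map Polynomial.C := by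
      have : I ≤ (I.map (Polynomial.C)).comap (phi K (Sum.inr κ)).toRingHom := by
        rw [hI, Ideal.span_le]
        rintro _ ⟨j, hj, rfl⟩
        change phi K (Sum.inr κ) (B j) ∈ I.map Polynomial.C
        rw [phi_C _ _ (htri j κ hj)]
        exact Ideal.mem_map_of_mem _ (Ideal.subset_span ⟨j, hj, rfl⟩)
      exact fun p hp => this hp
    let Φ : MvPolynomial (V ⊕ Fin m) K →+* Polynomial (MvPolynomial (V ⊕ Fin m) K) :=
      (phi K (Sum.inr κ)).toRingHom
    have hΦ : ∀ p, Φ p = phi K (Sum.inr κ) p := fun p => rfl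
    obtain ⟨h, hh, hhp⟩ := hp
    rw [hI', Ideal.mem_span_singleton_sup] at hhp
    obtain ⟨c, b, hb, hcb⟩ := hhp
    obtain ⟨e, c', h', hh', hc'⟩ := ring_step Φ (X (Sum.inr κ))
      (fun p => phi_eval (Sum.inr κ) p) (sat I S') (by
        rintro p ⟨h, hh, hp⟩
        rw [Ideal.mem_map_C_iff]
        intro n
        rw [hΦ]
        refine ⟨h, hh, ?_⟩
        have := hIC _ hp
        rw [map_mul, hS'C h hh, Ideal.mem_map_C_iff] at this
        simpa using this n)
      (init κ) q
      (by
        rintro x ⟨h, hh, hp⟩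
        exact ⟨h * init κ, S'.mul_mem hh haS', by rwa [mul_assoc]⟩)
      (by
        rintro x ⟨h, hh, hp⟩
        -- peel off: `h` only uses initials up to `k`
        obtain ⟨g, hg, hgp⟩ := ih (h * x) ⟨1, S.one_mem, by
          rw [one_mul]; convert hp using 1; ring⟩
        exact ⟨g * h, S'.mul_mem (hSS' g hg) hh, by rwa [mul_assoc]⟩)
      (phi_C _ _ (degreeOf_range κ q hq)) (d κ) (B κ) (phi K (Sum.inr κ) (tail κ))
      (lt_of_le_of_lt (phi_natDegree _ _) (htail κ))
      (by
        change phi K (Sum.inr κ) (B κ) = _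
        rw [hdecomp κ, map_add, map_mul, map_pow, phi_X_self, phi_C _ _ (hinitvars κ κ le_rfl)])
      (h * p) c (by
        refine ⟨1, S'.one_mem, ?_⟩
        convert hb using 1
        linear_combination -hcb)
    refine ⟨h' * init κ ^ e * h, S'.mul_mem (S'.mul_mem hh' (S'.pow_mem haS' e)) hh, ?_⟩
    rw [hI', Ideal.mem_span_singleton_sup]
    refine ⟨h' * c', _, hc', ?_⟩
    ring

/-- Modulo a prime containing the chain but no initial, everything is algebraic over `K[V]`. -/
lemma exists_multiple (B init tail : Fin m → MvPolynomial (V ⊕ Fin m) K) (d : Fin m → ℕ)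
    (hdecomp : ∀ i, B i = init i * (X (Sum.inr i)) ^ (d i) + tail i)
    (htail : ∀ i, (tail i).degreeOf (Sum.inr i) < d i)
    (hinitvars : ∀ i j : Fin m, (i : ℕ) ≤ (j : ℕ) → (init i).degreeOf (Sum.inr j) = 0)
    (htri : ∀ i j : Fin m, (i : ℕ) < (j : ℕ) → (B i).degreeOf (Sum.inr j) = 0)
    (P : Ideal (MvPolynomial (V ⊕ Fin m) K)) (hP : P.IsPrime)
    (hBP : ∀ i, B i ∈ P) (hiP : ∀ i, init i ∉ P)
    (hPV : ∀ q ∈ (MvPolynomial.rename (R := K) (Sum.inl : V → V ⊕ Fin m)).range, q ∈ P → q = 0)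
    (f : MvPolynomial (V ⊕ Fin m) K) (hf : f ∉ P) :
    ∃ q, q ≠ 0 ∧ q ∈ (MvPolynomial.rename (R := K) (Sum.inl : V → V ⊕ Fin m)).range ∧
      ∃ g, q - g * f ∈ P := by
  classical
  let D := MvPolynomial (V ⊕ Fin m) K ⧸ P
  let π : MvPolynomial (V ⊕ Fin m) K →ₐ[K] D := Ideal.Quotient.mkₐ K P
  have hπ : ∀ x, π x = 0 ↔ x ∈ P := fun x => Ideal.Quotient.eq_zero_iff_mem
  let ι : MvPolynomial V K →ₐ[K] D := π.comp (MvPolynomial.rename Sum.inl)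
  letI : Algebra (MvPolynomial V K) D := ι.toRingHom.toAlgebra
  haveI : IsScalarTower K (MvPolynomial V K) D := IsScalarTower.of_algHom ι
  have hinj : Function.Injective (algebraMap (MvPolynomial V K) D) := by
    rw [injective_iff_map_eq_zero]
    intro x hx
    have := hPV _ ⟨x, rfl⟩ ((hπ _).mp hx)
    exact (map_eq_zero_iff _ (MvPolynomial.rename_injective _ Sum.inl_injective)).mp this
  haveI : IsDomain D := Ideal.Quotient.isDomain P
  let L := Subalgebra.algebraicClosure (MvPolynomial V K) D
  have hinl : ∀ u, π (X (Sum.inl u)) ∈ L := by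
    intro u
    have : π (X (Sum.inl u)) = algebraMap (MvPolynomial V K) D (X u) := by
      change _ = π (MvPolynomial.rename Sum.inl (X u))
      rw [MvPolynomial.rename_X]
    rw [this]
    exact L.algebraMap_mem _
  have hinr : ∀ n : ℕ, ∀ i : Fin m, (i : ℕ) = n → π (X (Sum.inr i)) ∈ L := by
    intro n
    induction n using Nat.strong_induction_on with
    | _ n ih =>
    intro i hin
    let v : V ⊕ Fin m → Polynomial L := fun s =>
      if s = Sum.inr i then Polynomial.X else
        if h : π (X s) ∈ L then Polynomial.C ⟨π (X s), h⟩ else 0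
    have hvd := natDegree_aeval_le (K := K) (T := L) v (Sum.inr i) (by simp [v]) (by
      intro s hs
      simp only [v, hs, if_false]
      split_ifs <;> simp)
    have hev : ∀ p : MvPolynomial (V ⊕ Fin m) K,
        (∀ j : Fin m, (i : ℕ) < j → p.degreeOf (Sum.inr j) = 0) →
        Polynomial.aeval (π (X (Sum.inr i))) (MvPolynomial.aeval v p) = π p := by
      intro p hp
      change (((Polynomial.aeval (R := L) (π (X (Sum.inr i)))) : Polynomial L →+* D).comp
        ((MvPolynomial.aeval v : _ →ₐ[K] _) : _ →+* Polynomial L)) p = (π : _ →+* D) p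
      refine MvPolynomial.hom_congr_vars ?_ ?_ rfl
      · ext x
        simp only [RingHom.comp_apply, RingHom.coe_coe, MvPolynomial.aeval_C]
        rw [Polynomial.algebraMap_apply, Polynomial.aeval_C, ← MvPolynomial.algebraMap_eq,
          AlgHom.commutes, ← IsScalarTower.algebraMap_apply]
      · intro s hs _
        simp only [RingHom.comp_apply, RingHom.coe_coe, MvPolynomial.aeval_X]
        by_cases hsi : s = Sum.inr i
        · subst hsi; simp [v]
        · have hmem : π (X s) ∈ L := by
            rcases s with u | j
            · exact hinl u
            · have hji : ¬ (i : ℕ) < j := fun hlt => notMem_vars (hp j hlt) hs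
              have hne : (j : ℕ) ≠ i := fun h => hsi (by rw [Fin.ext h])
              exact ih j (by omega) j rfl
          simp only [v, hsi, if_false, hmem, dif_pos, Polynomial.aeval_C]
          rfl
    have halg : IsAlgebraic L (π (X (Sum.inr i))) := by
      refine ⟨MvPolynomial.aeval v (B i), ?_, ?_⟩
      · intro h0
        have h1 := congrArg (fun p => Polynomial.coeff p (d i)) h0
        have hi0 := hvd (init i)
        rw [hinitvars i i le_rfl] at hi0
        have hC := Polynomial.eq_C_of_natDegree_le_zero hi0
        have hXX : v (Sum.inr i) = Polynomial.X := by simp [v]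
        simp only [hdecomp i, map_add, map_mul, map_pow, MvPolynomial.aeval_X, hXX,
          Polynomial.coeff_add, Polynomial.coeff_zero] at h1
        rw [Polynomial.coeff_eq_zero_of_natDegree_lt (lt_of_le_of_lt (hvd (tail i)) (htail i)),
          add_zero, hC, Polynomial.coeff_C_mul, Polynomial.coeff_X_pow_self, mul_one] at h1
        rw [h1, Polynomial.C_0] at hC
        have h2 := hev (init i) (fun j hj => hinitvars i j hj.le)
        rw [hC, map_zero] at h2
        exact hiP i ((hπ _).mp h2.symm)
      · rw [hev _ (fun j hj => htri i j hj)]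
        exact (hπ _).mpr (hBP i)
    exact halg.restrictScalars (MvPolynomial V K)
  have hall : ∀ p, π p ∈ L := by
    intro p
    induction p using MvPolynomial.induction_on with
    | C a =>
      rw [← MvPolynomial.algebraMap_eq, AlgHom.commutes,
        IsScalarTower.algebraMap_apply K (MvPolynomial V K) D]
      exact L.algebraMap_mem _
    | add p q hp hq => rw [map_add]; exact L.add_mem hp hq
    | mul_X p s hp =>
      rw [map_mul]
      refine L.mul_mem hp ?_
      rcases s with u | j
      · exact hinl u
      · exact hinr _ j rfl
  have hfa : IsAlgebraic (MvPolynomial V K) (π f) := hall f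
  obtain ⟨r, hr, g, hg⟩ := hfa.exists_nonzero_dvd
    (mem_nonZeroDivisors_of_ne_zero (fun h => hf ((hπ _).mp h)))
  obtain ⟨g, rfl⟩ := Ideal.Quotient.mk_surjective g
  refine ⟨MvPolynomial.rename Sum.inl r, ?_, ⟨r, rfl⟩, g, ?_⟩
  · intro h
    exact hr ((map_eq_zero_iff _ (MvPolynomial.rename_injective _ Sum.inl_injective)).mp h)
  · rw [← hπ, map_sub, map_mul, sub_eq_zero, mul_comm]
    exact hg

end main

end RegChain

/-- Let `B` be a regular chain in `F[U, Y]` with algebraic saturation ideal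
`A = asat(B) = (B) : init_B^∞`, and let `√A = ⋂ᵢ Pᵢ` be an irredundant prime decomposition.
Then `f` is invertible w.r.t. `asat(B)` (i.e. `(f, asat(B)) ∩ F[U] ≠ {0}`) iff `f ∉ Pᵢ`
for all `i`. -/
theorem stmt_9 (B init tail : Fin m → MvPolynomial (U ⊕ Fin m) F) (d : Fin m → ℕ)
    (hdecomp : ∀ i, B i = init i * (X (Sum.inr i)) ^ (d i) + tail i)
    (hdpos : ∀ i, 0 < d i)
    (htail : ∀ i, (tail i).degreeOf (Sum.inr i) < d i)
    (hinitvars : ∀ i j : Fin m, (i : ℕ) ≤ (j : ℕ) → (init i).degreeOf (Sum.inr j) = 0)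
    (htri : ∀ i j : Fin m, (i : ℕ) < (j : ℕ) → (B i).degreeOf (Sum.inr j) = 0)
    (hreg : ∀ i : Fin m, 0 < (i : ℕ) →
      ∃ q : MvPolynomial (U ⊕ Fin m) F, q ≠ 0 ∧
        q ∈ (MvPolynomial.rename (Sum.inl : U → U ⊕ Fin m)).range ∧
        q ∈ Ideal.span (insert (init i) {p | ∃ j : Fin m, (j : ℕ) < (i : ℕ) ∧ p = B j}))
    -- `A` is the algebraic saturation ideal `asat(B)`:
    (A : Ideal (MvPolynomial (U ⊕ Fin m) F))
    (hA : ∀ p, p ∈ A ↔ ∃ h ∈ Submonoid.closure (Set.range init),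
      h * p ∈ Ideal.span (Set.range B))
    -- irredundant prime decomposition of `√A`:
    (N : ℕ) (P : Fin N → Ideal (MvPolynomial (U ⊕ Fin m) F))
    (hprime : ∀ i, (P i).IsPrime)
    (hdec : A.radical = ⨅ i, P i)
    (hirr : ∀ i j, P i ≤ P j → i = j)
    (f : MvPolynomial (U ⊕ Fin m) F) :
    (∃ q : MvPolynomial (U ⊕ Fin m) F, q ≠ 0 ∧
        q ∈ (MvPolynomial.rename (Sum.inl : U → U ⊕ Fin m)).range ∧
        q ∈ Ideal.span {f} ⊔ A) ↔
      ∀ i, f ∉ P i := by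
  have hAs : A = RegChain.sat (Ideal.span (Set.range B)) (Submonoid.closure (Set.range init)) := by
    ext p; exact hA p
  have huniv : {j : Fin m | (j : ℕ) < m} = Set.univ := by
    ext j; simp
  have hAreg : ∀ q : MvPolynomial (U ⊕ Fin m) F, q ≠ 0 →
      q ∈ (MvPolynomial.rename (R := F) (Sum.inl : U → U ⊕ Fin m)).range →
      ∀ p, q * p ∈ A → p ∈ A := by
    intro q hq0 hq p hp
    have := RegChain.sat_regular B init tail d hdecomp htail hinitvars htri q hq0 hq m le_rfl p
    rw [huniv, Set.image_univ, Set.image_univ, ← hAs] at this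
    exact this hp
  have hAinit : ∀ i p, init i * p ∈ A → p ∈ A := by
    intro i p hp
    obtain ⟨h, hh, hp⟩ := (hA _).mp hp
    exact (hA p).mpr ⟨h * init i, Submonoid.mul_mem _ hh (Submonoid.subset_closure ⟨i, rfl⟩),
      by rwa [mul_assoc]⟩
  have hAB : ∀ i, B i ∈ A := fun i =>
    (hA _).mpr ⟨1, Submonoid.one_mem _, by rw [one_mul]; exact Ideal.subset_span ⟨i, rfl⟩⟩
  have hAP : ∀ i, A ≤ P i := fun i =>
    Ideal.le_radical.trans (hdec.le.trans (iInf_le _ i))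
  -- elements regular modulo `A` avoid every `P i`
  have havoid : ∀ q, (∀ p, q * p ∈ A → p ∈ A) → ∀ i, q ∉ P i := by
    intro q hq i hqi
    have hqn : ∀ n : ℕ, ∀ p, q ^ n * p ∈ A → p ∈ A := by
      intro n
      induction n with
      | zero => intro p hp; simpa using hp
      | succ n ih => intro p hp; exact hq _ (ih _ (by rwa [pow_succ, mul_assoc] at hp))
    have hex : ∀ j, j ≠ i → ∃ x ∈ P j, x ∉ P i := by
      intro j hj
      by_contra hcon
      push Not at hcon
      exact hj (hirr j i hcon)
    choose! x hx1 hx2 using hex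
    set p := ∏ j ∈ Finset.univ.erase i, x j with hp
    have hpi : p ∉ P i := by
      intro hmem
      haveI := hprime i
      obtain ⟨j, hj, hjm⟩ := Ideal.IsPrime.prod_mem_iff.mp hmem
      exact hx2 j (Finset.ne_of_mem_erase hj) hjm
    have hqp : q * p ∈ A.radical := by
      rw [hdec, Ideal.mem_iInf]
      intro j
      by_cases hj : j = i
      · subst hj; exact Ideal.mul_mem_right _ _ hqi
      · refine Ideal.mul_mem_left _ _ ?_
        exact Ideal.mem_of_dvd _ (Finset.dvd_prod_of_mem x (by simp [hj])) (hx1 j hj)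
    obtain ⟨n, hn⟩ := hqp
    rw [mul_pow] at hn
    exact hpi ((hprime i).mem_of_pow_mem n (hAP i (hqn n _ hn)))
  constructor
  · rintro ⟨q, hq0, hq, hqf⟩ i hfi
    refine havoid q (hAreg q hq0 hq) i ?_
    refine (sup_le ?_ (hAP i)) hqf
    rw [Ideal.span_le]
    simpa using hfi
  · intro hf
    have hstep : ∀ i, ∃ q : MvPolynomial (U ⊕ Fin m) F, q ≠ 0 ∧
        q ∈ (MvPolynomial.rename (R := F) (Sum.inl : U → U ⊕ Fin m)).range ∧
        ∃ g, q - g * f ∈ P i := fun i =>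
      RegChain.exists_multiple B init tail d hdecomp htail hinitvars htri (P i) (hprime i)
        (fun j => hAP i (hAB j)) (fun j => havoid _ (hAinit j) i)
        (fun q hq hqi => by
          by_contra h0
          exact havoid q (hAreg q h0 hq) i hqi) f (hf i)
    choose q hq0 hq g hg using hstep
    have hmem : ∏ i, (q i - g i * f) ∈ A.radical := by
      rw [hdec, Ideal.mem_iInf]
      intro j
      exact Ideal.mem_of_dvd _ (Finset.dvd_prod_of_mem _ (Finset.mem_univ j)) (hg j)
    obtain ⟨n, hn⟩ := hmem
    refine ⟨(∏ i, q i) ^ n, pow_ne_zero _ (Finset.prod_ne_zero_iff.mpr fun i _ => hq0 i),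
      pow_mem (prod_mem fun i _ => hq i) n, ?_⟩
    have h1 : (∏ i, (q i - g i * f)) ^ n ∈ Ideal.span {f} ⊔ A :=
      (le_sup_right : A ≤ _) hn
    rw [← Ideal.Quotient.eq_zero_iff_mem] at h1 ⊢
    have hf0 : Ideal.Quotient.mk (Ideal.span {f} ⊔ A) f = 0 :=
      Ideal.Quotient.eq_zero_iff_mem.mpr
        ((le_sup_left : Ideal.span {f} ≤ _) (Ideal.mem_span_singleton_self f))
    simpa [map_prod, hf0] using h1
end

section
/- Let I be a reflexive prime difference ideal of codimension one in F{y_1, ..., y_n}. Then the first element in any characteristic set of I with respect to any ranking, when taken irreducible, is unique up to a nonzero factor in F. -/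
open MvPolynomial

/-- The transforming operator on the difference polynomial ring `F{y₁,…,yₙ}`
(variables `(j, k) ↦ σ^k y_j`). -/
noncomputable def shiftOp (F : Type*) [Field F] (σF : F →+* F) (n : ℕ) :
    MvPolynomial (Fin n × ℕ) F →+* MvPolynomial (Fin n × ℕ) F :=
  (MvPolynomial.rename (fun p : Fin n × ℕ => (p.1, p.2 + 1))).toRingHom.comp
    (MvPolynomial.map σF)

/-- A ranking on the variables `σ^k y_j`: a total strict order compatible with the
transforming operator. -/
structure DiffRanking (n : ℕ) where
  lt : Fin n × ℕ → Fin n × ℕ → Prop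
  trans : ∀ a b c, lt a b → lt b c → lt a c
  irrefl : ∀ a, ¬ lt a a
  total : ∀ a b, a = b ∨ lt a b ∨ lt b a
  shift_gt : ∀ v : Fin n × ℕ, lt v (v.1, v.2 + 1)
  shift_mono : ∀ v w, lt v w → lt (v.1, v.2 + 1) (w.1, w.2 + 1)

variable {F : Type*} [Field F] {n : ℕ}

/-- `v` is the leader of `f`: the greatest variable appearing effectively in `f`. -/
def IsLeader (rk : DiffRanking n) (f : MvPolynomial (Fin n × ℕ) F) (v : Fin n × ℕ) : Prop :=
  v ∈ f.vars ∧ ∀ w ∈ f.vars, w ≠ v → rk.lt w v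

/-- `q` is reduced with respect to `p` (whose leader is `σ^k y_j` of degree `d`):
`deg(q, σ^(k+l) y_j) < d` for all `l ≥ 0`. -/
def reducedWrt (rk : DiffRanking n) (q p : MvPolynomial (Fin n × ℕ) F) : Prop :=
  ∀ v : Fin n × ℕ, IsLeader rk p v → ∀ l : ℕ, q.degreeOf (v.1, v.2 + l) < p.degreeOf v

/-- `q` is of higher rank than `p`. -/
def higherRank (rk : DiffRanking n) (q p : MvPolynomial (Fin n × ℕ) F) : Prop :=
  ∃ v w, IsLeader rk p v ∧ IsLeader rk q w ∧
    (rk.lt v w ∨ (v = w ∧ p.degreeOf v < q.degreeOf w))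

/-- An ascending chain of nonzero difference polynomials. -/
def IsDiffChain (rk : DiffRanking n) (A : List (MvPolynomial (Fin n × ℕ) F)) : Prop :=
  (∀ p ∈ A, p ≠ (0 : MvPolynomial (Fin n × ℕ) F)) ∧
    A.Pairwise (fun p q => higherRank rk q p ∧ reducedWrt rk q p)

/-- `A` is a characteristic set of the set `I` w.r.t. the ranking `rk`. -/
def IsCharSet (rk : DiffRanking n) (I : Set (MvPolynomial (Fin n × ℕ) F))
    (A : List (MvPolynomial (Fin n × ℕ) F)) : Prop :=
  IsDiffChain rk A ∧ (∀ p ∈ A, p ∈ I) ∧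
    ∀ f ∈ I, f ≠ (0 : MvPolynomial (Fin n × ℕ) F) →
      ¬ ∀ p ∈ A, reducedWrt rk f p

def VIndep (I : Ideal (MvPolynomial (Fin n × ℕ) F)) (V : Set (Fin n × ℕ)) : Prop :=
  ∀ f ∈ I, (↑f.vars : Set (Fin n × ℕ)) ⊆ V → f = 0

theorem exists_matroid (I : Ideal (MvPolynomial (Fin n × ℕ) F)) (hI : I.IsPrime) :
    ∃ N : Matroid (Fin n × ℕ), N.E = Set.univ ∧ ∀ V, N.Indep V ↔ VIndep I V := by
  have : IsDomain (MvPolynomial (Fin n × ℕ) F ⧸ I) := Ideal.Quotient.isDomain I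
  have : FaithfulSMul F (MvPolynomial (Fin n × ℕ) F ⧸ I) := inferInstance
  let x : Fin n × ℕ → MvPolynomial (Fin n × ℕ) F ⧸ I := fun v => Ideal.Quotient.mk I (X v)
  refine ⟨(AlgebraicIndependent.matroid F (MvPolynomial (Fin n × ℕ) F ⧸ I)).comap x, by simp, ?_⟩
  intro V
  have key : ∀ p : MvPolynomial V F, aeval (fun v : V => x v) p =
      Ideal.Quotient.mk I (rename (fun v : V => (v : Fin n × ℕ)) p) := by
    intro p
    have : (aeval (fun v : V => x v) : MvPolynomial V F →ₐ[F] _) =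
      (Ideal.Quotient.mkₐ F I).comp (rename (fun v : V => (v : Fin n × ℕ))) := by
      ext v
      simp [x]
    rw [this]; rfl
  have h1 : VIndep I V ↔ AlgebraicIndependent F (fun v : V => x v) := by
    rw [algebraicIndependent_iff]
    constructor
    · intro h p hp
      rw [key, Ideal.Quotient.eq_zero_iff_mem] at hp
      have := h _ hp (by
        classical
        intro w hw
        have := vars_rename _ _ hw
        simp only [Finset.mem_image] at this
        obtain ⟨a, -, rfl⟩ := this
        exact a.2)
      exact rename_injective _ Subtype.val_injective (by simpa using this)
    · intro h f hf hV
      obtain ⟨q, rfl⟩ := exists_rename_eq_of_vars_subset_range f (fun v : V => (v : Fin n × ℕ))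
        Subtype.val_injective (by simpa using hV)
      have := h q (by rw [key, Ideal.Quotient.eq_zero_iff_mem]; exact hf)
      simp [this]
  rw [h1, Matroid.comap_indep_iff, AlgebraicIndependent.matroid_indep_iff]
  constructor
  · rintro ⟨h, hi⟩
    exact (algebraicIndependent_image hi).2 h
  · intro h
    have hi : Set.InjOn x V := by
      have := h.injective
      exact Set.injOn_iff_injective.2 this
    exact ⟨(algebraicIndependent_image hi).1 h, hi⟩

theorem poly_elim {R : Type*} [CommRing R] [IsDomain R] [UniqueFactorizationMonoid R]
    (A f : Polynomial R) (hA : Irreducible A) (hd : A.natDegree ≠ 0) (hf : ¬ A ∣ f) :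
    ∃ (a b : Polynomial R) (g : R), g ≠ 0 ∧ Polynomial.C g = a * A + b * f := by
  classical
  let _ : NormalizedGCDMonoid R := Classical.choice inferInstance
  let K := FractionRing R
  have hinj : Function.Injective (algebraMap R K) := IsFractionRing.injective R K
  have hAK : Irreducible (A.map (algebraMap R K)) :=
    (Polynomial.IsPrimitive.irreducible_iff_irreducible_map_fraction_map
      (hA.isPrimitive hd)).1 hA
  have hdv : ¬ A.map (algebraMap R K) ∣ f.map (algebraMap R K) := by
    rintro ⟨q, hq⟩
    obtain ⟨b, hb⟩ := IsLocalization.integerNormalization_map_to_map (nonZeroDivisors R) q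
    set q' := IsLocalization.integerNormalization (nonZeroDivisors R) q
    have h1 : Polynomial.C (b : R) * f = A * q' := by
      apply Polynomial.map_injective _ hinj
      rw [Polynomial.map_mul, Polynomial.map_mul, hb, hq, Polynomial.map_C, Algebra.smul_def]
      simp [Polynomial.algebraMap_def]
      ring
    have hp : Prime A := hA.prime
    rcases hp.dvd_or_dvd (Dvd.intro _ h1.symm) with h | h
    · have hb0 : (b : R) ≠ 0 := nonZeroDivisors.ne_zero b.2
      have := Polynomial.natDegree_le_of_dvd h (by simpa using hb0)
      simp at this
      exact hd this
    · exact hf h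
  obtain ⟨u, w, huw⟩ := (hAK.coprime_iff_not_dvd.2 hdv)
  obtain ⟨b, hb⟩ := IsLocalization.integerNormalization_map_to_map (nonZeroDivisors R) u
  obtain ⟨c, hc⟩ := IsLocalization.integerNormalization_map_to_map (nonZeroDivisors R) w
  set u' := IsLocalization.integerNormalization (nonZeroDivisors R) u
  set w' := IsLocalization.integerNormalization (nonZeroDivisors R) w
  refine ⟨Polynomial.C (c : R) * u', Polynomial.C (b : R) * w', b * c,
    mul_ne_zero (nonZeroDivisors.ne_zero b.2) (nonZeroDivisors.ne_zero c.2), ?_⟩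
  apply Polynomial.map_injective _ hinj
  simp only [Polynomial.map_mul, Polynomial.map_add, hb, hc, Polynomial.map_C, Algebra.smul_def,
    map_mul, Polynomial.algebraMap_apply]
  linear_combination (-(Polynomial.C (algebraMap R K b)) * Polynomial.C (algebraMap R K c)) * huw

theorem mv_elim {τ : Type*} (V : Set τ) (v : τ) (hv : v ∉ V) (A f : MvPolynomial τ F)
    (hA : Irreducible A) (hvA : v ∈ A.vars) (hAV : (↑A.vars : Set τ) ⊆ insert v V)
    (hfV : (↑f.vars : Set τ) ⊆ insert v V) (hf : ¬ A ∣ f) :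
    ∃ a b g : MvPolynomial τ F, g ≠ 0 ∧ g = a * A + b * f ∧ (↑g.vars : Set τ) ⊆ V := by
  classical
  let e : Option V → τ := fun o => o.elim v (fun w => w)
  have he : Function.Injective e := by
    rintro (_ | a) (_ | b) h
    · rfl
    · exact absurd b.2 (by simp only [e, Option.elim] at h; rwa [← h])
    · exact absurd a.2 (by simp only [e, Option.elim] at h; rwa [h])
    · simp only [e, Option.elim] at h
      rw [Subtype.ext h]
  have hr : insert v V ⊆ Set.range e := by
    rintro w (rfl | hw)
    · exact ⟨none, rfl⟩
    · exact ⟨some ⟨w, hw⟩, rfl⟩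
  obtain ⟨A', rfl⟩ := exists_rename_eq_of_vars_subset_range A e he (hAV.trans hr)
  obtain ⟨f', rfl⟩ := exists_rename_eq_of_vars_subset_range f e he (hfV.trans hr)
  have hunit : ∀ b : MvPolynomial (Option V) F, IsUnit (rename e b) → IsUnit b := by
    intro b hb
    have := hb.map (killCompl he)
    rwa [killCompl_rename_app] at this
  have hA' : Irreducible A' := by
    refine ⟨fun h => hA.not_isUnit (h.map (rename e)), fun a b hab => ?_⟩
    have := hA.isUnit_or_isUnit (a := rename e a) (b := rename e b) (by rw [hab, map_mul])
    exact this.imp (hunit _) (hunit _)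
  let φ := optionEquivLeft F V
  have hsymm : ∀ r : MvPolynomial V F, rename e (φ.symm (Polynomial.C r)) =
      rename (fun w : V => (w : τ)) r := by
    intro r
    induction r using MvPolynomial.induction_on with
    | C a => simp [φ]
    | add p q hp hq => simp only [map_add, hp, hq]
    | mul_X p i hp =>
      simp only [map_mul, hp, φ, optionEquivLeft_symm_C_X, rename_X]
      rfl
  have hvars : ∀ r : MvPolynomial V F,
      (↑(rename e (φ.symm (Polynomial.C r))).vars : Set τ) ⊆ V := by
    intro r w hw
    rw [hsymm] at hw
    have := vars_rename _ _ hw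
    simp only [Finset.mem_image] at this
    obtain ⟨a, -, rfl⟩ := this
    exact a.2
  obtain ⟨a, b, g, hg, hab⟩ := poly_elim (φ A') (φ f')
    ((MulEquiv.irreducible_iff φ).2 hA') (by
      intro h
      have h2 := Polynomial.eq_C_of_natDegree_eq_zero h
      have h3 : A' = φ.symm (Polynomial.C ((φ A').coeff 0)) := by
        rw [← h2]; simp
      rw [h3] at hvA
      exact hv (hvars _ hvA)) (by
      intro h
      apply hf
      have := map_dvd φ.symm h
      simp only [AlgEquiv.symm_apply_apply] at this
      exact map_dvd (rename e) this)
  refine ⟨rename e (φ.symm a), rename e (φ.symm b), rename e (φ.symm (Polynomial.C g)), ?_, ?_,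
    hvars g⟩
  · rw [hsymm]
    intro h
    exact hg (rename_injective _ Subtype.val_injective (by simpa using h))
  · rw [hab]; simp

theorem exists_weights (i j : Fin n) (α β : ℕ) (VP VQ : Finset (Fin n × ℕ))
    (hPQ : ∀ k l, (j, k) ∈ VP → (i, l) ∈ VQ → k + l < α + β) :
    ∃ wi wj : ℕ, (∀ k, (j, k) ∈ VP → 2 * k + wj < 2 * α + wi) ∧
      (∀ l, (i, l) ∈ VQ → 2 * l + wi < 2 * β + wj) := by
  classical
  by_cases h : ∃ k, (j, k) ∈ VP
  · have hne : (VP.filter (fun v => v.1 = j)).Nonempty := by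
      obtain ⟨k, hk⟩ := h
      exact ⟨(j, k), by simp [hk]⟩
    obtain ⟨v, hv, hmax⟩ := Finset.exists_max_image _ (fun v : Fin n × ℕ => v.2) hne
    obtain ⟨v1, a⟩ := v
    simp only [Finset.mem_filter] at hv hmax
    obtain ⟨hv, rfl⟩ := hv
    refine ⟨2 * a + 1, 2 * α, fun k hk => ?_, fun l hl => ?_⟩
    · have := hmax (v1, k) ⟨hk, rfl⟩
      simp only at this
      omega
    · have := hPQ a l hv hl
      omega
  · push Not at h
    refine ⟨0, 2 * (VQ.sup (fun v => v.2)) + 1, fun k hk => absurd hk (h k), fun l hl => ?_⟩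
    have := Finset.le_sup (f := fun v : Fin n × ℕ => v.2) hl
    simp only at this
    omega

theorem counting (N : Matroid (Fin n × ℕ)) (hE : N.E = Set.univ) (S : Finset (Fin n))
    (hS : S.card = n - 1) (hSi : N.Indep {v | v.1 ∈ S}) (i j : Fin n) (hij : i ≠ j) (α β : ℕ)
    (VP VQ : Finset (Fin n × ℕ))
    (hP : ∀ l, (i, α + l) ∈ N.closure ((fun v : Fin n × ℕ => (v.1, v.2 + l)) '' (VP : Set _)))
    (hQ : ∀ l, (j, β + l) ∈ N.closure ((fun v : Fin n × ℕ => (v.1, v.2 + l)) '' (VQ : Set _)))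
    (hPi : ∀ k, (i, k) ∈ VP → k < α) (hQj : ∀ k, (j, k) ∈ VQ → k < β)
    (hPQ : ∀ k l, (j, k) ∈ VP → (i, l) ∈ VQ → k + l < α + β) : False := by
  classical
  obtain ⟨wi, wj, hwP, hwQ⟩ := exists_weights i j α β VP VQ hPQ
  obtain ⟨D, hDP, hDQ⟩ : ∃ D : ℕ, (∀ v ∈ VP, v.2 ≤ D) ∧ (∀ v ∈ VQ, v.2 ≤ D) := by
    refine ⟨VP.sup (fun v => v.2) + VQ.sup (fun v => v.2), fun v hv => ?_, fun v hv => ?_⟩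
    · have := Finset.le_sup (f := fun v : Fin n × ℕ => v.2) hv
      omega
    · have := Finset.le_sup (f := fun v : Fin n × ℕ => v.2) hv
      omega
  let M := (n - 2) * (wi + wj + D + 1) + α + β
  let O : Finset (Fin n) := (Finset.univ.erase i).erase j
  have hO : O.card = n - 2 := by
    simp only [O]
    rw [Finset.card_erase_of_mem (by simp [hij.symm]), Finset.card_erase_of_mem (by simp)]
    simp
    omega
  have hn2 : 2 ≤ n := by
    have h1 := i.2
    have h2 := j.2
    have h3 : (i : ℕ) ≠ j := fun h => hij (Fin.ext h)
    omega
  let Y : Finset (Fin n × ℕ) := O ×ˢ Finset.range (M + (wi + wj + D + 1)) ∪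
    ({i} ×ˢ Finset.range α ∪ {j} ×ˢ Finset.range β)
  have hYE : (Y : Set (Fin n × ℕ)) ⊆ N.E := by rw [hE]; exact Set.subset_univ _
  have hYcl : ∀ v ∈ Y, v ∈ N.closure Y := fun v hv => N.subset_closure Y hYE hv
  have main : ∀ t, t ≤ 2 * M + wi + wj →
      (∀ m, 2 * m + wi = t → (i, m) ∈ N.closure Y) ∧
      (∀ m, 2 * m + wj = t → (j, m) ∈ N.closure Y) := by
    intro t
    induction t using Nat.strong_induction_on with
    | _ t ih =>
      intro ht
      constructor
      · intro m hm
        by_cases hma : m < α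
        · exact hYcl _ (by simp [Y, hma])
        · obtain ⟨l, rfl⟩ := Nat.exists_eq_add_of_le (not_lt.1 hma)
          refine N.closure_subset_closure_of_subset_closure ?_ (hP l)
          rintro _ ⟨⟨c, k⟩, hk, rfl⟩
          simp only [Finset.mem_coe] at hk
          have hkD := hDP _ hk
          simp only at hkD ⊢
          by_cases hci : c = i
          · subst hci
            have := hPi k hk
            exact (ih (2 * (k + l) + wi) (by omega) (by omega)).1 _ rfl
          · by_cases hcj : c = j
            · subst hcj
              have := hwP k hk
              exact (ih (2 * (k + l) + wj) (by omega) (by omega)).2 _ rfl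
            · apply hYcl
              simp only [Y, O, Finset.mem_union, Finset.mem_product, Finset.mem_erase,
                Finset.mem_range]
              left
              exact ⟨⟨hcj, hci, Finset.mem_univ _⟩, by omega⟩
      · intro m hm
        by_cases hma : m < β
        · exact hYcl _ (by simp [Y, hma])
        · obtain ⟨l, rfl⟩ := Nat.exists_eq_add_of_le (not_lt.1 hma)
          refine N.closure_subset_closure_of_subset_closure ?_ (hQ l)
          rintro _ ⟨⟨c, k⟩, hk, rfl⟩
          simp only [Finset.mem_coe] at hk
          have hkD := hDQ _ hk
          simp only at hkD ⊢
          by_cases hci : c = i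
          · subst hci
            have := hwQ k hk
            exact (ih (2 * (k + l) + wi) (by omega) (by omega)).1 _ rfl
          · by_cases hcj : c = j
            · subst hcj
              have := hQj k hk
              exact (ih (2 * (k + l) + wj) (by omega) (by omega)).2 _ rfl
            · apply hYcl
              simp only [Y, O, Finset.mem_union, Finset.mem_product, Finset.mem_erase,
                Finset.mem_range]
              left
              exact ⟨⟨hcj, hci, Finset.mem_univ _⟩, by omega⟩
  let Z : Finset (Fin n × ℕ) := S ×ˢ Finset.range (M + 1)
  have hZ : N.Indep (Z : Set (Fin n × ℕ)) := by
    refine hSi.subset ?_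
    intro v hv
    simp only [Z, Finset.mem_coe, Finset.mem_product] at hv
    exact hv.1
  have hZY : (Z : Set (Fin n × ℕ)) ⊆ N.closure Y := by
    rintro ⟨c, m⟩ hv
    simp only [Z, Finset.mem_coe, Finset.mem_product, Finset.mem_range] at hv
    by_cases hci : c = i
    · subst hci
      exact (main (2 * m + wi) (by omega)).1 _ rfl
    · by_cases hcj : c = j
      · subst hcj
        exact (main (2 * m + wj) (by omega)).2 _ rfl
      · apply hYcl
        simp only [Y, O, Finset.mem_union, Finset.mem_product, Finset.mem_erase, Finset.mem_range]
        left
        exact ⟨⟨hcj, hci, Finset.mem_univ _⟩, by omega⟩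
  have hcard : Z.card ≤ Y.card := by
    have h1 := N.eRk_mono hZY
    rw [hZ.eRk_eq_encard, N.eRk_closure_eq] at h1
    have h2 := h1.trans (N.eRk_le_encard _)
    simpa [Set.encard_coe_eq_coe_finsetCard] using h2
  have hY : Y.card ≤ (n - 2) * (M + (wi + wj + D + 1)) + (α + β) := by
    refine (Finset.card_union_le _ _).trans ?_
    refine add_le_add (by simp [hO]) ((Finset.card_union_le _ _).trans (by simp))
  have hZc : Z.card = (n - 1) * (M + 1) := by simp [Z, hS]
  have hn1 : n - 1 = (n - 2) + 1 := by omega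
  rw [hZc, hn1] at hcard
  have hMdef : M = (n - 2) * (wi + wj + D + 1) + α + β := rfl
  have := hcard.trans hY
  rw [mul_add (n - 2) M, add_mul, mul_add (n - 2) M 1] at this
  omega

theorem VIndep.mono {I : Ideal (MvPolynomial (Fin n × ℕ) F)} {V W : Set (Fin n × ℕ)}
    (h : VIndep I W) (hVW : V ⊆ W) : VIndep I V := fun f hf hv => h f hf (hv.trans hVW)

theorem VIndep.shift {σF : F →+* F} (hinv : Function.Surjective σF)
    {I : Ideal (MvPolynomial (Fin n × ℕ) F)} (hdiff : ∀ p, p ∈ I ↔ shiftOp F σF n p ∈ I)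
    {V : Set (Fin n × ℕ)} (h : VIndep I V) :
    VIndep I ((fun v : Fin n × ℕ => (v.1, v.2 + 1)) '' V) := by
  classical
  intro f hf hfV
  have hinj : Function.Injective
      (fun w : V => ((w : Fin n × ℕ).1, (w : Fin n × ℕ).2 + 1)) := by
    rintro ⟨⟨a, b⟩, h1⟩ ⟨⟨c, d⟩, h2⟩ h
    simpa using h
  obtain ⟨q, rfl⟩ := exists_rename_eq_of_vars_subset_range f
    (fun w : V => ((w : Fin n × ℕ).1, (w : Fin n × ℕ).2 + 1)) hinj (by
      intro w hw
      obtain ⟨x, hx, rfl⟩ := hfV hw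
      exact ⟨⟨x, hx⟩, rfl⟩)
  obtain ⟨q, rfl⟩ := MvPolynomial.map_surjective σF hinv q
  have key : rename (fun w : V => ((w : Fin n × ℕ).1, (w : Fin n × ℕ).2 + 1)) (map σF q) =
      shiftOp F σF n (rename (fun w : V => (w : Fin n × ℕ)) q) := by
    simp only [shiftOp, RingHom.comp_apply, map_rename]
    change _ = rename _ _
    rw [rename_rename]
    rfl
  rw [key] at hf ⊢
  rw [h _ ((hdiff _).2 hf) (by
    intro w hw
    have := vars_rename _ _ hw
    simp only [Finset.mem_image] at this
    obtain ⟨a, -, rfl⟩ := this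
    exact a.2), map_zero]

theorem shiftOp_vars (σF : F →+* F) (P : MvPolynomial (Fin n × ℕ) F) :
    (↑(shiftOp F σF n P).vars : Set (Fin n × ℕ)) ⊆
      (fun v : Fin n × ℕ => (v.1, v.2 + 1)) '' (↑P.vars : Set (Fin n × ℕ)) := by
  classical
  intro w hw
  have := vars_rename _ _ hw
  simp only [Finset.mem_image] at this
  obtain ⟨a, ha, rfl⟩ := this
  exact ⟨a, vars_map _ _ ha, rfl⟩

theorem shiftOp_ne_zero {σF : F →+* F} (P : MvPolynomial (Fin n × ℕ) F) (hP : P ≠ 0) :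
    shiftOp F σF n P ≠ 0 := by
  intro h
  have h1 : rename (fun p : Fin n × ℕ => (p.1, p.2 + 1)) (map σF P) = 0 := h
  have h2 : map σF P = 0 := rename_injective (fun p : Fin n × ℕ => (p.1, p.2 + 1)) (by
    rintro ⟨a, b⟩ ⟨c, d⟩ h
    simpa using h) (by simpa using h1)
  exact hP (map_injective σF σF.injective (by simpa using h2))

theorem mem_closure_shift {σF : F →+* F} (hinv : Function.Surjective σF)
    {I : Ideal (MvPolynomial (Fin n × ℕ) F)} (hdiff : ∀ p, p ∈ I ↔ shiftOp F σF n p ∈ I)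
    (N : Matroid (Fin n × ℕ)) (hE : N.E = Set.univ) (hN : ∀ V, N.Indep V ↔ VIndep I V) (l : ℕ) :
    ∀ (P : MvPolynomial (Fin n × ℕ) F) (V : Set (Fin n × ℕ)) (v : Fin n × ℕ), P ∈ I → P ≠ 0 →
      (↑P.vars : Set (Fin n × ℕ)) ⊆ insert v V → VIndep I V →
      (v.1, v.2 + l) ∈ N.closure ((fun v : Fin n × ℕ => (v.1, v.2 + l)) '' V) := by
  induction l with
  | zero =>
    intro P V v hP hP0 hPV hV
    simp only [add_zero, Prod.mk.eta, Set.image_id']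
    rw [Matroid.Indep.mem_closure_iff' ((hN V).2 hV)]
    refine ⟨by rw [hE]; trivial, fun h => absurd ((hN _).1 h P hP hPV) hP0⟩
  | succ l ih =>
    intro P V v hP hP0 hPV hV
    have := ih (shiftOp F σF n P) _ (v.1, v.2 + 1) ((hdiff P).1 hP) (shiftOp_ne_zero P hP0)
      ((shiftOp_vars σF P).trans (by
        refine (Set.image_mono hPV).trans ?_
        rw [Set.image_insert_eq])) (hV.shift hinv hdiff)
    rw [Set.image_image] at this
    simpa only [add_assoc, add_comm 1 l] using this

theorem mem_vars_of_dvd {τ : Type*} {A f : MvPolynomial τ F} (hf : f ≠ 0) (h : A ∣ f) {v : τ}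
    (hv : v ∈ A.vars) : v ∈ f.vars := by
  classical
  obtain ⟨q, rfl⟩ := h
  have hA : A ≠ 0 := left_ne_zero_of_mul hf
  have hq : q ≠ 0 := right_ne_zero_of_mul hf
  rw [mem_vars_iff_degreeOf_ne_zero] at hv ⊢
  rw [degreeOf_mul_eq hA hq]
  omega

structure GoodElt (I : Ideal (MvPolynomial (Fin n × ℕ) F)) (A : MvPolynomial (Fin n × ℕ) F)
    (j : Fin n) (a : ℕ) : Prop where
  mem : A ∈ I
  irr : Irreducible A
  lead : (j, a) ∈ A.vars
  le : ∀ k, (j, k) ∈ A.vars → k ≤ a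
  ind : VIndep I {w | w.1 = j → w.2 < a}

theorem GoodElt.dvd {I : Ideal (MvPolynomial (Fin n × ℕ) F)} {A : MvPolynomial (Fin n × ℕ) F}
    {j : Fin n} {a : ℕ} (h : GoodElt I A j a) (f : MvPolynomial (Fin n × ℕ) F) (hf : f ∈ I)
    (hfj : ∀ k, (j, k) ∈ f.vars → k ≤ a) : A ∣ f := by
  by_contra hdv
  have aux : ∀ p : MvPolynomial (Fin n × ℕ) F, (∀ k, (j, k) ∈ p.vars → k ≤ a) →
      (↑p.vars : Set (Fin n × ℕ)) ⊆ insert (j, a) {w | w.1 = j → w.2 < a} := by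
    rintro p hp ⟨c, k⟩ hw
    by_cases hc : c = j
    · subst hc
      rcases (hp k hw).lt_or_eq with h | rfl
      · exact Or.inr fun _ => h
      · exact Or.inl rfl
    · exact Or.inr fun h => absurd h hc
  obtain ⟨u, w, g, hg, hgu, hgv⟩ := mv_elim {w : Fin n × ℕ | w.1 = j → w.2 < a} (j, a) (by simp)
    A f h.irr h.lead (aux A h.le) (aux f hfj) hdv
  refine hg (h.ind g ?_ hgv)
  rw [hgu]
  exact I.add_mem (I.mul_mem_left _ h.mem) (I.mul_mem_left _ hf)

theorem GoodElt.ind_erase {I : Ideal (MvPolynomial (Fin n × ℕ) F)}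
    {A : MvPolynomial (Fin n × ℕ) F} {j : Fin n} {a : ℕ} (h : GoodElt I A j a)
    (v : Fin n × ℕ) (hv : v ∈ A.vars) : VIndep I (↑(A.vars.erase v) : Set (Fin n × ℕ)) := by
  intro f hf hfv
  by_contra hf0
  have h1 := h.dvd f hf (fun k hk => h.le k (Finset.mem_of_mem_erase (hfv hk)))
  exact Finset.notMem_erase v _ (hfv (mem_vars_of_dvd hf0 h1 hv))

theorem unit_of_dvd {A B : MvPolynomial (Fin n × ℕ) F} (hA : Irreducible A) (hB : Irreducible B)
    (h : A ∣ B) : ∃ c : F, c ≠ 0 ∧ B = C c * A := by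
  obtain ⟨u, hu⟩ := hA.associated_of_dvd hB h
  obtain ⟨c, hc, hcu⟩ := MvPolynomial.isUnit_iff_eq_C_of_isReduced.1 u.isUnit
  exact ⟨c, hc.ne_zero, by rw [← hu, hcu, mul_comm]⟩

theorem exists_top {A : MvPolynomial (Fin n × ℕ) F} {i : Fin n} {b : ℕ}
    (h : ¬ ∀ k, (i, k) ∈ A.vars → k ≤ b) :
    ∃ α, b < α ∧ (i, α) ∈ A.vars ∧ ∀ k, (i, k) ∈ A.vars → k ≤ α := by
  classical
  push Not at h
  obtain ⟨k, hk, hbk⟩ := h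
  obtain ⟨⟨v1, α⟩, hv, hmax⟩ := Finset.exists_max_image (A.vars.filter (fun v => v.1 = i))
    (fun v : Fin n × ℕ => v.2) ⟨(i, k), by simp [hk]⟩
  simp only [Finset.mem_filter] at hv hmax
  obtain ⟨hv, rfl⟩ := hv
  have hm : ∀ k, (v1, k) ∈ A.vars → k ≤ α := fun k hk => hmax (v1, k) ⟨hk, rfl⟩
  exact ⟨α, lt_of_lt_of_le hbk (hm k hk), hv, hm⟩

theorem counting' {σF : F →+* F} (hinv : Function.Surjective σF)
    {I : Ideal (MvPolynomial (Fin n × ℕ) F)} (hprime : I.IsPrime)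
    (hdiff : ∀ p, p ∈ I ↔ shiftOp F σF n p ∈ I)
    (hcodim : ∃ S : Finset (Fin n), S.card = n - 1 ∧
      ∀ p ∈ I, (∀ v ∈ p.vars, v.1 ∈ S) → p = 0)
    (P Q : MvPolynomial (Fin n × ℕ) F) (hPI : P ∈ I) (hQI : Q ∈ I) (hP0 : P ≠ 0) (hQ0 : Q ≠ 0)
    (i j : Fin n) (hij : i ≠ j) (α β : ℕ)
    (hP : VIndep I (↑(P.vars.erase (i, α)) : Set (Fin n × ℕ)))
    (hQ : VIndep I (↑(Q.vars.erase (j, β)) : Set (Fin n × ℕ)))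
    (hPi : ∀ k, (i, k) ∈ P.vars → k ≤ α) (hQj : ∀ k, (j, k) ∈ Q.vars → k ≤ β)
    (hPQ : ∀ k l, (j, k) ∈ P.vars → (i, l) ∈ Q.vars → k + l < α + β) : False := by
  classical
  obtain ⟨N, hE, hN⟩ := exists_matroid I hprime
  obtain ⟨S, hS, hSI⟩ := hcodim
  have hsub : ∀ (p : MvPolynomial (Fin n × ℕ) F) v,
      (↑p.vars : Set (Fin n × ℕ)) ⊆ insert v (↑(p.vars.erase v) : Set (Fin n × ℕ)) := by
    intro p v w hw
    by_cases h : w = v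
    · exact Or.inl h
    · exact Or.inr (Finset.mem_erase.2 ⟨h, hw⟩)
  refine counting N hE S hS ((hN _).2 fun f hf hv => hSI f hf fun v h => hv h) i j hij α β
    (P.vars.erase (i, α)) (Q.vars.erase (j, β))
    (fun l => mem_closure_shift hinv hdiff N hE hN l P _ (i, α) hPI hP0 (hsub _ _) hP)
    (fun l => mem_closure_shift hinv hdiff N hE hN l Q _ (j, β) hQI hQ0 (hsub _ _) hQ)
    ?_ ?_ ?_
  · intro k hk
    rw [Finset.mem_erase] at hk
    refine lt_of_le_of_ne (hPi k hk.2) ?_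
    rintro rfl
    exact hk.1 rfl
  · intro k hk
    rw [Finset.mem_erase] at hk
    refine lt_of_le_of_ne (hQj k hk.2) ?_
    rintro rfl
    exact hk.1 rfl
  · intro k l hk hl
    exact hPQ k l (Finset.mem_of_mem_erase hk) (Finset.mem_of_mem_erase hl)

theorem good_unique {σF : F →+* F} (hinv : Function.Surjective σF)
    {I : Ideal (MvPolynomial (Fin n × ℕ) F)} (hprime : I.IsPrime)
    (hdiff : ∀ p, p ∈ I ↔ shiftOp F σF n p ∈ I)
    (hcodim : ∃ S : Finset (Fin n), S.card = n - 1 ∧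
      ∀ p ∈ I, (∀ v ∈ p.vars, v.1 ∈ S) → p = 0)
    {A B : MvPolynomial (Fin n × ℕ) F} {i j : Fin n} {a b : ℕ} (hA : GoodElt I A j a)
    (hB : GoodElt I B i b) : ∃ c : F, c ≠ 0 ∧ B = C c * A := by
  by_cases h1 : ∀ k, (j, k) ∈ B.vars → k ≤ a
  · exact unit_of_dvd hA.irr hB.irr (hA.dvd B hB.mem h1)
  by_cases h2 : ∀ k, (i, k) ∈ A.vars → k ≤ b
  · exact unit_of_dvd hA.irr hB.irr
      ((hB.irr.associated_of_dvd hA.irr (hB.dvd A hA.mem h2)).symm.dvd)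
  exfalso
  obtain ⟨β, hβ, hβB, hβm⟩ := exists_top h1
  obtain ⟨α, hα, hαA, hαm⟩ := exists_top h2
  have hij : i ≠ j := by
    rintro rfl
    have := hA.le _ hαA
    have := hB.le _ hβB
    omega
  refine counting' hinv hprime hdiff hcodim A B hA.mem hB.mem hA.irr.ne_zero hB.irr.ne_zero
    i j hij α β (hA.ind_erase _ hαA) (hB.ind_erase _ hβB) hαm hβm ?_
  intro k l hk hl
  have := hA.le _ hk
  have := hB.le _ hl
  omega

/-! ### Rankings -/

theorem DiffRanking.shift_mono_n (rk : DiffRanking n) (l : ℕ) {v w : Fin n × ℕ}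
    (h : rk.lt v w) : rk.lt (v.1, v.2 + l) (w.1, w.2 + l) := by
  induction l with
  | zero => exact h
  | succ l ih => exact rk.shift_mono _ _ ih

theorem DiffRanking.lt_of_lt (rk : DiffRanking n) (j : Fin n) {a b : ℕ} (h : a < b) :
    rk.lt (j, a) (j, b) := by
  induction b, h using Nat.le_induction with
  | base => exact rk.shift_gt (j, a)
  | succ b _ ih => exact rk.trans _ _ _ ih (rk.shift_gt (j, b))

theorem DiffRanking.lt_iff (rk : DiffRanking n) (j : Fin n) {a b : ℕ} :
    rk.lt (j, a) (j, b) ↔ a < b := by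
  refine ⟨fun h => ?_, rk.lt_of_lt j⟩
  by_contra hab
  rcases (not_lt.1 hab).lt_or_eq with h' | rfl
  · exact rk.irrefl _ (rk.trans _ _ _ h (rk.lt_of_lt j h'))
  · exact rk.irrefl _ h

theorem DiffRanking.exists_leader (rk : DiffRanking n) (s : Finset (Fin n × ℕ))
    (hs : s.Nonempty) : ∃ v ∈ s, ∀ w ∈ s, w ≠ v → rk.lt w v := by
  classical
  induction hs using Finset.Nonempty.cons_induction with
  | singleton a => exact ⟨a, by simp, by simp⟩
  | cons a s ha hs ih =>
    obtain ⟨v, hv, hmax⟩ := ih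
    rcases rk.total a v with rfl | h | h
    · exact absurd hv ha
    · refine ⟨v, by simp [hv], fun w hw hne => ?_⟩
      rcases Finset.mem_cons.1 hw with rfl | hw
      · exact h
      · exact hmax w hw hne
    · refine ⟨a, by simp, fun w hw hne => ?_⟩
      rcases Finset.mem_cons.1 hw with rfl | hw
      · exact absurd rfl hne
      · by_cases hwv : w = v
        · rw [hwv]; exact h
        · exact rk.trans _ _ _ (hmax w hw hwv) h

theorem IsLeader.unique {rk : DiffRanking n} {f : MvPolynomial (Fin n × ℕ) F} {v w : Fin n × ℕ}
    (hv : IsLeader rk f v) (hw : IsLeader rk f w) : v = w := by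
  by_contra h
  exact rk.irrefl _ (rk.trans _ _ _ (hv.2 w hw.1 (Ne.symm h)) (hw.2 v hv.1 h))

theorem IsCharSet.lower {rk : DiffRanking n} {I : Ideal (MvPolynomial (Fin n × ℕ) F)}
    {A : MvPolynomial (Fin n × ℕ) F} {Ar : List (MvPolynomial (Fin n × ℕ) F)}
    (hA : IsCharSet rk (I : Set (MvPolynomial (Fin n × ℕ) F)) (A :: Ar)) {v : Fin n × ℕ}
    (hv : IsLeader rk A v) (f : MvPolynomial (Fin n × ℕ) F) (hf : f ∈ I)
    (hlt : ∀ w ∈ f.vars, rk.lt w v) : f = 0 := by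
  by_contra hf0
  refine hA.2.2 f hf hf0 ?_
  intro p hp u hu l
  have hvu : v = u ∨ rk.lt v u := by
    rcases List.mem_cons.1 hp with rfl | hp
    · exact Or.inl (hv.unique hu)
    · obtain ⟨⟨v', w', h1, h2, h3⟩, -⟩ := (List.pairwise_cons.1 hA.1.2).1 p hp
      rw [← hv.unique h1, ← hu.unique h2] at h3
      rcases h3 with h | h
      · exact Or.inr h
      · exact Or.inl h.1
  have hul : u = (u.1, u.2 + l) ∨ rk.lt u (u.1, u.2 + l) := by
    rcases Nat.eq_zero_or_pos l with rfl | h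
    · exact Or.inl rfl
    · exact Or.inr (rk.lt_of_lt u.1 (Nat.lt_add_of_pos_right h))
  have hnot : (u.1, u.2 + l) ∉ f.vars := by
    intro hmem
    have h1 := hlt _ hmem
    have h2 : rk.lt u v := by
      rcases hul with h | h
      · rwa [← h] at h1
      · exact rk.trans _ _ _ h h1
    rcases hvu with rfl | h
    · exact rk.irrefl _ h2
    · exact rk.irrefl _ (rk.trans _ _ _ h h2)
  have h0 : f.degreeOf (u.1, u.2 + l) = 0 := by
    by_contra h
    exact hnot (mem_vars_iff_degreeOf_ne_zero.2 h)
  have h1 := mem_vars_iff_degreeOf_ne_zero.1 hu.1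
  omega

theorem IsCharSet.good {σF : F →+* F} (hinv : Function.Surjective σF)
    {I : Ideal (MvPolynomial (Fin n × ℕ) F)} (hprime : I.IsPrime)
    (hdiff : ∀ p, p ∈ I ↔ shiftOp F σF n p ∈ I)
    (hcodim : ∃ S : Finset (Fin n), S.card = n - 1 ∧
      ∀ p ∈ I, (∀ v ∈ p.vars, v.1 ∈ S) → p = 0)
    {rk : DiffRanking n}
    {A : MvPolynomial (Fin n × ℕ) F} {Ar : List (MvPolynomial (Fin n × ℕ) F)}
    (hA : IsCharSet rk (I : Set (MvPolynomial (Fin n × ℕ) F)) (A :: Ar))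
    (hirr : Irreducible A) : ∃ j a, GoodElt I A j a := by
  classical
  have hAI : A ∈ I := hA.2.1 A (by simp)
  have hne : A.vars.Nonempty := by
    rw [Finset.nonempty_iff_ne_empty]
    intro h
    rw [vars_eq_empty_iff_eq_C] at h
    refine hirr.not_isUnit ?_
    rw [h]
    refine IsUnit.map C (IsUnit.mk0 _ ?_)
    intro h0
    rw [h0, C_0] at h
    exact hirr.ne_zero h
  obtain ⟨⟨j, a⟩, hv⟩ := rk.exists_leader A.vars hne
  have hv : IsLeader rk A (j, a) := hv
  have hlow := hA.lower hv
  have hle : ∀ k, (j, k) ∈ A.vars → k ≤ a := by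
    intro k hk
    by_cases h : (j, k) = (j, a)
    · simp only [Prod.mk.injEq, true_and] at h
      exact h.le
    · exact ((rk.lt_iff j).1 (hv.2 _ hk h)).le
  refine ⟨j, a, hAI, hirr, hv.1, hle, ?_⟩
  intro f hf hfv
  by_contra hf0
  -- choose an element with the fewest variables
  have hex : ∃ m : ℕ, ∃ g ∈ I, g ≠ 0 ∧
      (↑g.vars : Set (Fin n × ℕ)) ⊆ {w | w.1 = j → w.2 < a} ∧ g.vars.card = m :=
    ⟨_, f, hf, hf0, hfv, rfl⟩
  obtain ⟨g, hg, hg0, hgv, hgc⟩ := Nat.find_spec hex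
  have hmin := fun m (hm : m < Nat.find hex) => Nat.find_min hex hm
  rw [← hgc] at hmin
  have hgne : g.vars.Nonempty := by
    rw [Finset.nonempty_iff_ne_empty]
    intro h
    exact hg0 (hlow g hg (by simp [h]))
  obtain ⟨⟨i, b⟩, hib, hmax⟩ := rk.exists_leader g.vars hgne
  have hij : j ≠ i := by
    rintro rfl
    refine hg0 (hlow g hg fun w hw => ?_)
    have hba : rk.lt (j, b) (j, a) := rk.lt_of_lt j (hgv hib rfl)
    by_cases h : w = (j, b)
    · rw [h]; exact hba
    · exact rk.trans _ _ _ (hmax w hw h) hba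
  refine counting' hinv hprime hdiff hcodim A g hAI hg hirr.ne_zero hg0 j i hij a b ?_ ?_ hle ?_ ?_
  · intro h hI hsub
    exact hlow h hI fun w hw => hv.2 w (Finset.mem_of_mem_erase (hsub hw))
      (Finset.ne_of_mem_erase (hsub hw))
  · intro h hI hsub
    by_contra h0
    have hss : h.vars ⊆ g.vars.erase (i, b) := fun w hw => hsub hw
    refine hmin h.vars.card (lt_of_le_of_lt (Finset.card_le_card hss)
      (Finset.card_erase_lt_of_mem hib)) ⟨h, hI, h0, ?_, rfl⟩
    intro w hw
    exact hgv (Finset.mem_of_mem_erase (hsub hw))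
  · intro k hk
    by_cases h : (i, k) = (i, b)
    · simp only [Prod.mk.injEq, true_and] at h
      exact h.le
    · exact ((rk.lt_iff i).1 (hmax _ hk h)).le
  · intro k l hk hl
    have h1 : rk.lt (i, k) (j, a) := hv.2 _ hk (by simp [hij.symm])
    have h2 : rk.lt (j, l) (i, b) := hmax _ hl (by simp [hij])
    have h3 := rk.shift_mono_n b h1
    have h4 := rk.shift_mono_n k h2
    simp only at h3 h4
    rw [add_comm b k] at h4
    have := (rk.lt_iff j).1 (rk.trans _ _ _ h4 h3)
    omega

/-- for a reflexive prime difference ideal `I` of codimension one in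
`F{y₁,…,yₙ}`, the first element of any characteristic set of `I` w.r.t. any ranking,
when taken irreducible, is unique up to a nonzero factor in `F`. -/
theorem stmt_10 (σF : F →+* F)
    (hinj : Function.Injective σF) (hinv : Function.Surjective σF)
    (hn : 1 ≤ n) (I : Ideal (MvPolynomial (Fin n × ℕ) F))
    (hprime : I.IsPrime)
    (hdiff : ∀ p, p ∈ I ↔ shiftOp F σF n p ∈ I)
    (hne : I ≠ ⊥)
    -- codimension one: there is a parametric set of `n − 1` of the difference
    -- indeterminates for `I`:
    (hcodim : ∃ S : Finset (Fin n), S.card = n - 1 ∧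
      ∀ p ∈ I, (∀ v ∈ p.vars, v.1 ∈ S) → p = 0)
    (rk₁ rk₂ : DiffRanking n)
    (A₁ : MvPolynomial (Fin n × ℕ) F) (Ar : List (MvPolynomial (Fin n × ℕ) F))
    (B₁ : MvPolynomial (Fin n × ℕ) F) (Br : List (MvPolynomial (Fin n × ℕ) F))
    (hA : IsCharSet rk₁ (I : Set (MvPolynomial (Fin n × ℕ) F)) (A₁ :: Ar))
    (hAirr : Irreducible A₁)
    (hB : IsCharSet rk₂ (I : Set (MvPolynomial (Fin n × ℕ) F)) (B₁ :: Br))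
    (hBirr : Irreducible B₁) :
    ∃ c : F, c ≠ 0 ∧ B₁ = C c * A₁ := by
  obtain ⟨j, a, hgA⟩ := hA.good hinv hprime hdiff hcodim hAirr
  obtain ⟨i, b, hgB⟩ := hB.good hinv hprime hdiff hcodim hBirr
  exact good_unique hinv hprime hdiff hcodim hgA hgB
end

section
/- Let P_0, ..., P_n be generic Laurent difference polynomials P_i = Σ_{k=0}^{l_i} u_{ik} M_{ik} with transformally independent coefficients u_{ik}, where the M_{ik} are Laurent difference monomials in y_1,...,y_n. Then the ideal I_{Y,u} = ([N(P_0),...,N(P_n)] : 𝕞) (saturation of the difference ideal generated by the norm forms by the set 𝕞 of all difference monomials in Y) is a reflexive prime difference ideal in ℚ{Y, u_0, ..., u_n}, and the elimination ideal I_u = I_{Y,u} ∩ ℚ{u_0,...,u_n} has codimension one if and only if there exist indices k_i ∈ {1,...,l_i} such that dtrdeg ℚ⟨M_{0k_0}/M_{00}, ..., M_{nk_n}/M_{n0}⟩/ℚ = n. -/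
open MvPolynomial

/-- Index set for the generic coefficients `u_{ik}`, `0 ≤ i ≤ n`, `0 ≤ k ≤ l i`. -/
abbrev UIdx (n : ℕ) (l : Fin (n + 1) → ℕ) := Σ i : Fin (n + 1), Fin (l i + 1)

/-- Variables of the difference polynomial ring `ℚ{Y, u₀, …, uₙ}`:
`Sum.inl (j, t) = σ^t y_j` and `Sum.inr (c, t) = σ^t u_c`. -/
abbrev DVar (n : ℕ) (l : Fin (n + 1) → ℕ) := (Fin n × ℕ) ⊕ (UIdx n l × ℕ)

/-- The transforming operator on `ℚ{Y, u₀, …, uₙ}`. -/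
noncomputable def tau (n : ℕ) (l : Fin (n + 1) → ℕ) :
    MvPolynomial (DVar n l) ℚ →+* MvPolynomial (DVar n l) ℚ :=
  (MvPolynomial.rename
    (Sum.elim (fun p : Fin n × ℕ => Sum.inl (p.1, p.2 + 1))
      (fun q : UIdx n l × ℕ => Sum.inr (q.1, q.2 + 1)))).toRingHom

/-- The difference transcendence degree over `ℚ` of a family indexed by `Fin (n+1)`,
given together with all its transforms (second index). -/
noncomputable def dtrdegFam {KY : Type*} [Field KY] [Algebra ℚ KY] {n : ℕ}
    (Q : Fin (n + 1) × ℕ → KY) : ℕ :=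
  sSup {c : ℕ | ∃ T : Finset (Fin (n + 1)), T.card = c ∧
    AlgebraicIndependent ℚ (fun p : {x // x ∈ T} × ℕ => Q (p.1, p.2))}


/-- Transport of algebraicity along an injective ring homomorphism. -/
lemma sd_alg_map {R1 R2 A B : Type*} [CommRing R1] [CommRing R2] [CommRing A] [CommRing B]
    [Algebra R1 A] [Algebra R2 B] (S1 : Subalgebra R1 A) (S2 : Subalgebra R2 B)
    (g : A →+* B) (hg : Function.Injective g) (h : ∀ x ∈ S1, g x ∈ S2) {a : A}
    (ha : IsAlgebraic S1 a) : IsAlgebraic S2 (g a) := by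
  let f : S1 →+* S2 := (g.comp S1.val.toRingHom).codRestrict S2 (fun x => h x x.2)
  refine ha.ringHom_of_comp_eq f g ?_ ?_
  · intro x y hxy
    have : g x = g y := congrArg Subtype.val hxy
    exact Subtype.ext (hg this)
  · ext x; rfl

/-- elements of `adjoin` are mapped to a subalgebra as soon as the generators are. -/
lemma sd_adjoin_map {R1 R2 A B : Type*} [CommRing R1] [CommRing R2] [CommRing A] [CommRing B]
    [Algebra R1 A] [Algebra R2 B] (s : Set A) (S2 : Subalgebra R2 B)
    (g : A →+* B) (h0 : ∀ r : R1, g (algebraMap R1 A r) ∈ S2) (h : ∀ x ∈ s, g x ∈ S2) :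
    ∀ x ∈ Algebra.adjoin R1 s, g x ∈ S2 := by
  intro x hx
  induction hx using Algebra.adjoin_induction with
  | mem x hx => exact h x hx
  | algebraMap r => exact h0 r
  | add x y _ _ hx hy => rw [map_add]; exact add_mem hx hy
  | mul x y _ _ hx hy => rw [map_mul]; exact mul_mem hx hy

set_option linter.unusedSectionVars false

section abstract_theory

variable {A : Type*} [CommRing A] [IsDomain A] [Algebra ℚ A]

/-- The orbit of a set under `σ`. -/
def sdOrb (σ : A →+* A) (s : Set A) : Set A := {x | ∃ t : ℕ, ∃ a ∈ s, x = σ^[t] a}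

lemma sdOrb_mono (σ : A →+* A) {s s' : Set A} (h : s ⊆ s') : sdOrb σ s ⊆ sdOrb σ s' := by
  rintro x ⟨t, a, ha, rfl⟩; exact ⟨t, a, h ha, rfl⟩

lemma sdOrb_self (σ : A →+* A) {s : Set A} {a : A} (h : a ∈ s) : a ∈ sdOrb σ s :=
  ⟨0, a, h, rfl⟩

lemma sdOrb_sigma (σ : A →+* A) {s : Set A} {a : A} (h : a ∈ sdOrb σ s) : σ a ∈ sdOrb σ s := by
  obtain ⟨t, a, ha, rfl⟩ := h
  exact ⟨t + 1, a, ha, (Function.iterate_succ_apply' _ _ _).symm⟩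

instance sd_faithful (D : Subalgebra ℚ A) : FaithfulSMul D A :=
  (faithfulSMul_iff_algebraMap_injective D A).2 Subtype.val_injective

/-- Difference-algebraic over `D`. -/
def SDalg (σ : A →+* A) (D : Subalgebra ℚ A) (a : A) : Prop :=
  ¬ AlgebraicIndependent D (fun t : ℕ => σ^[t] a)

lemma sd_iter_alg (σ : A →+* A) (hσ : Function.Injective σ) (D : Subalgebra ℚ A)
    (hD : ∀ x ∈ D, σ x ∈ D) {s s' : Set A} (hs : ∀ x ∈ s, σ x ∈ Algebra.adjoin D s') {a : A}
    (ha : IsAlgebraic (Algebra.adjoin D s) a) :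
    IsAlgebraic (Algebra.adjoin D s') (σ a) := by
  refine sd_alg_map _ _ σ hσ ?_ ha
  exact sd_adjoin_map _ _ _
    (fun r => Subalgebra.algebraMap_mem _ (⟨σ r, hD _ r.2⟩ : D)) hs

lemma SDalg.exists_bound {σ : A →+* A} (hσ : Function.Injective σ) {D : Subalgebra ℚ A}
    (hD : ∀ x ∈ D, σ x ∈ D) {a : A} (ha : SDalg σ D a) :
    ∃ N : ℕ, ∀ t : ℕ, IsAlgebraic (Algebra.adjoin D ((fun t => σ^[t] a) '' Set.Iio N))
      (σ^[t] a) := by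
  have h1 : ∃ N : ℕ, IsAlgebraic (Algebra.adjoin D ((fun t => σ^[t] a) '' Set.Iio N))
      (σ^[N] a) := by
    by_contra hcon
    push Not at hcon
    apply ha
    have hN : ∀ N : ℕ, AlgebraicIndepOn D (fun t : ℕ => σ^[t] a) (Set.Iio N) := by
      intro N
      induction N with
      | zero =>
        have : IsEmpty (Set.Iio (0:ℕ)) := by simp
        exact algebraicIndependent_empty_type_iff.2 Subtype.val_injective
      | succ N ih =>
        have := ih.insert (hcon N)
        have e : Set.Iio (N + 1) = insert N (Set.Iio N) := by
          ext x; simp only [Set.mem_Iio, Set.mem_insert_iff]; omega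
        rw [e]; exact this
    refine algebraicIndependent_of_finite_type fun t ht => ?_
    obtain ⟨N, hN'⟩ := ht.bddAbove
    exact (hN (N+1)).mono (fun x hx => by have := hN' hx; simp; omega)
  obtain ⟨N, hN⟩ := h1
  refine ⟨N, ?_⟩
  have key : ∀ r : ℕ, IsAlgebraic (Algebra.adjoin D ((fun t => σ^[t] a) '' Set.Iio (N + r)))
      (σ^[N + r] a) := by
    intro r
    induction r with
    | zero => exact hN
    | succ r ih =>
      have := sd_iter_alg σ hσ D hD (s' := (fun t => σ^[t] a) '' Set.Iio (N + (r+1))) ?_ ih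
      · rwa [← Function.iterate_succ_apply' σ] at this
      · rintro x ⟨t, ht, rfl⟩
        apply Algebra.subset_adjoin
        refine ⟨t + 1, by simp at ht ⊢; omega, Function.iterate_succ_apply' σ t a⟩
  intro t
  induction t using Nat.strong_induction_on with
  | _ t ih =>
    by_cases ht : t < N
    · exact isAlgebraic_algebraMap (⟨_, Algebra.subset_adjoin ⟨t, ht, rfl⟩⟩ :
        Algebra.adjoin D ((fun t => σ^[t] a) '' Set.Iio N))
    · obtain ⟨r, rfl⟩ := Nat.exists_eq_add_of_le (not_lt.1 ht)
      have hk := key r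
      have hk' : σ^[N + r] a ∈ (AlgebraicIndependent.matroid D A).closure
          ((fun t => σ^[t] a) '' Set.Iio (N + r)) := by
        rw [AlgebraicIndependent.matroid_closure_eq]; exact hk
      have hsub : ((fun t => σ^[t] a) '' Set.Iio (N + r)) ⊆
          (AlgebraicIndependent.matroid D A).closure ((fun t => σ^[t] a) '' Set.Iio N) := by
        rintro x ⟨t, ht, rfl⟩
        rw [AlgebraicIndependent.matroid_closure_eq]; exact ih t ht
      have := Matroid.closure_subset_closure_of_subset_closure hsub hk'
      rw [AlgebraicIndependent.matroid_closure_eq] at this; exact this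

lemma SDalg.of_closure {σ : A →+* A} (hσ : Function.Injective σ) {D : Subalgebra ℚ A}
    (hD : ∀ x ∈ D, σ x ∈ D) {X : Set A} (hX : X.Finite) (h : ∀ x ∈ X, SDalg σ D x) {z : A}
    (hz : IsAlgebraic (Algebra.adjoin D (sdOrb σ X)) z) : SDalg σ D z := by
  classical
  have h' : ∀ x : A, ∃ N : ℕ, x ∈ X → ∀ t : ℕ,
      IsAlgebraic (Algebra.adjoin D ((fun t => σ^[t] x) '' Set.Iio N)) (σ^[t] x) := by
    intro x
    by_cases hx : x ∈ X
    · obtain ⟨N, hN⟩ := (h x hx).exists_bound hσ hD; exact ⟨N, fun _ => hN⟩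
    · exact ⟨0, fun h => absurd h hx⟩
  choose N hN using h'
  set F : Set A := ⋃ x ∈ X, (fun t => σ^[t] x) '' Set.Iio (N x) with hF
  have hFfin : F.Finite := hX.biUnion fun x _ => (Set.finite_Iio _).image _
  have hsub : sdOrb σ X ⊆ (AlgebraicIndependent.matroid D A).closure F := by
    rintro _ ⟨t, x, hx, rfl⟩
    have h1 : σ^[t] x ∈ (AlgebraicIndependent.matroid D A).closure
        ((fun t => σ^[t] x) '' Set.Iio (N x)) := by
      rw [AlgebraicIndependent.matroid_closure_eq]; exact hN x hx t
    exact (AlgebraicIndependent.matroid D A).closure_subset_closure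
      (Set.subset_biUnion_of_mem (u := fun x => (fun t => σ^[t] x) '' Set.Iio (N x)) hx) h1
  have hzt : ∀ t : ℕ, IsAlgebraic (Algebra.adjoin D (sdOrb σ X)) (σ^[t] z) := by
    intro t
    induction t with
    | zero => exact hz
    | succ t ih =>
      rw [Function.iterate_succ_apply']
      exact sd_iter_alg σ hσ D hD (fun x hx => Algebra.subset_adjoin (sdOrb_sigma σ hx)) ih
  intro hind
  have hr : Set.range (fun t : ℕ => σ^[t] z) ⊆ (AlgebraicIndependent.matroid D A).closure F := by
    rintro _ ⟨t, rfl⟩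
    apply Matroid.closure_subset_closure_of_subset_closure hsub
    rw [AlgebraicIndependent.matroid_closure_eq]; exact hzt t
  have hI : (AlgebraicIndependent.matroid D A).Indep (Set.range (fun t : ℕ => σ^[t] z)) :=
    AlgebraicIndependent.coe_range hind
  have h1 := (AlgebraicIndependent.matroid D A).eRk_mono hr
  rw [Matroid.eRk_closure_eq, hI.eRk_eq_encard] at h1
  have h2 := h1.trans ((AlgebraicIndependent.matroid D A).eRk_le_encard F)
  have h3 : (Set.range (fun t : ℕ => σ^[t] z)).Infinite :=
    Set.infinite_range_of_injective hind.injective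
  rw [h3.encard_eq] at h2
  exact absurd (top_le_iff.1 h2) hFfin.encard_lt_top.ne

lemma SDalg.map {σ θ : A →+* A} (hθ : Function.Injective θ) (hc : ∀ x, θ (σ x) = σ (θ x))
    {D : Subalgebra ℚ A}
    (hD : ∀ x ∈ D, θ x ∈ D) {a : A} (ha : SDalg σ D a) : SDalg σ D (θ a) := by
  intro H
  apply ha
  let f : D →+* D := (θ.comp D.val.toRingHom).codRestrict D (fun x => hD x x.2)
  refine AlgebraicIndependent.of_ringHom_of_comp_eq f θ (S := D) ?_ ?_ ?_
  · convert H using 1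
    funext t
    have : Function.Semiconj θ σ σ := hc
    exact this.iterate_right t a
  · intro x y hxy
    have : θ x = θ y := congrArg Subtype.val hxy
    exact Subtype.ext (hθ this)
  · ext x; rfl

/-- Difference independence over `ℚ` of a family. -/
def SDind {J : Type*} (σ : A →+* A) (w : J → A) : Prop :=
  AlgebraicIndependent ℚ (fun p : J × ℕ => σ^[p.2] (w p.1))

lemma SDind.comp {J J' : Type*} {σ : A →+* A} {w : J → A} (h : SDind σ w) (f : J' → J)
    (hf : Function.Injective f) : SDind σ (w ∘ f) :=
  AlgebraicIndependent.comp (x := fun p : J × ℕ => σ^[p.2] (w p.1)) h (Prod.map f id)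
    (hf.prodMap Function.injective_id)

/-- the `σ`-stable subalgebra generated by the other members. -/
def sdD {J : Type*} (σ : A →+* A) (w : J → A) (i : J) : Subalgebra ℚ A :=
  Algebra.adjoin ℚ (sdOrb σ (w '' {i}ᶜ))

lemma sdD_stable {J : Type*} (σ : A →+* A) (w : J → A) (i : J) : ∀ x ∈ sdD σ w i,
    σ x ∈ sdD σ w i :=
  sd_adjoin_map _ _ _ (fun r => by
    have : σ (algebraMap ℚ A r) = algebraMap ℚ A r := by simp
    rw [this]; exact Subalgebra.algebraMap_mem _ _)
    (fun x hx => Algebra.subset_adjoin (sdOrb_sigma σ hx))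

lemma sdind_iff {J : Type*} (σ : A →+* A) (w : J → A) (i : J) :
    SDind σ w ↔ SDind σ (fun j : {j // j ≠ i} => w j) ∧ ¬ SDalg σ (sdD σ w i) (w i) := by
  unfold SDind SDalg
  rw [not_not, AlgebraicIndependent.iff_adjoin_image_compl {p : J × ℕ | p.1 = i}]
  have e1 : (fun p : J × ℕ => σ^[p.2] (w p.1)) '' {p : J × ℕ | p.1 = i}ᶜ
      = sdOrb σ (w '' {i}ᶜ) := by
    ext x
    constructor
    · rintro ⟨⟨j, t⟩, hj, rfl⟩
      exact ⟨t, w j, ⟨j, hj, rfl⟩, rfl⟩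
    · rintro ⟨t, _, ⟨j, hj, rfl⟩, rfl⟩
      exact ⟨(j, t), hj, rfl⟩
  rw [e1]
  refine and_congr ?_ ?_
  · let e : {j // j ≠ i} × ℕ ≃ ↥({p : J × ℕ | p.1 = i}ᶜ) :=
      { toFun := fun p => ⟨(p.1, p.2), p.1.2⟩
        invFun := fun p => (⟨p.1.1, p.2⟩, p.1.2)
        left_inv := fun p => rfl
        right_inv := fun p => rfl }
    exact (algebraicIndependent_equiv' e rfl).symm
  · let e : ℕ ≃ ↥({p : J × ℕ | p.1 = i}) :=
      { toFun := fun t => ⟨(i, t), rfl⟩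
        invFun := fun p => p.1.2
        left_inv := fun p => rfl
        right_inv := fun p => by
          obtain ⟨⟨j, t⟩, h⟩ := p
          have : j = i := h
          subst this; rfl }
    exact (algebraicIndependent_equiv' e rfl).symm

/-- replacing one member. -/
lemma sdind_update_iff {J : Type*} [DecidableEq J] (σ : A →+* A) (w : J → A) (i : J) (z : A) :
    SDind σ (Function.update w i z) ↔
      SDind σ (fun j : {j // j ≠ i} => w j) ∧ ¬ SDalg σ (sdD σ w i) z := by
  rw [sdind_iff σ _ i, Function.update_self]
  have e1 : (fun j : {j // j ≠ i} => Function.update w i z j) = fun j : {j // j ≠ i} => w j := by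
    funext j; exact Function.update_of_ne j.2 _ _
  have e2 : sdD σ (Function.update w i z) i = sdD σ w i := by
    unfold sdD
    congr 2
    exact Set.image_congr fun j hj => Function.update_of_ne hj _ _
  rw [e1, e2]

/-- the exchange lemma -/
lemma SDind.exchange {J : Type*} [DecidableEq J] {σ : A →+* A} (hσ : Function.Injective σ)
    {w : J → A} (hw : SDind σ w) (i : J) {X : Set A} (hX : X.Finite)
    (h : IsAlgebraic (Algebra.adjoin ℚ (sdOrb σ (w '' {i}ᶜ ∪ X))) (w i)) :
    ∃ z ∈ X, SDind σ (Function.update w i z) := by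
  by_contra hcon
  push Not at hcon
  have hw' := (sdind_iff σ w i).1 hw
  refine hw'.2 (SDalg.of_closure hσ (sdD_stable σ w i) hX ?_ ?_)
  · intro x hx
    have := hcon x hx
    rw [sdind_update_iff] at this
    by_contra hx'
    exact this ⟨hw'.1, hx'⟩
  · refine sd_alg_map _ _ (RingHom.id A) Function.injective_id ?_ h
    refine sd_adjoin_map _ _ _ ?_ ?_
    · intro r
      exact Subalgebra.algebraMap_mem _ (algebraMap ℚ (sdD σ w i) r)
    · rintro _ ⟨t, a, ha | ha, rfl⟩
      · exact Subalgebra.algebraMap_mem _ (⟨σ^[t] a, Algebra.subset_adjoin ⟨t, a, ha, rfl⟩⟩ :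
          sdD σ w i)
      · exact Algebra.subset_adjoin ⟨t, a, ha, rfl⟩

/-- simultaneous exchange -/
lemma SDind.exchange_all {J : Type*} [DecidableEq J] {σ : A →+* A} (hσ : Function.Injective σ)
    {w : J → A} (hw : SDind σ w) (s : Finset J) {X : J → Set A} (hX : ∀ j, (X j).Finite)
    (h : ∀ i ∈ s, IsAlgebraic (Algebra.adjoin ℚ (sdOrb σ (w '' {j | j ∉ s} ∪ X i))) (w i)) :
    ∃ z : J → A, (∀ i ∈ s, z i ∈ X i) ∧ (∀ i ∉ s, z i = w i) ∧ SDind σ z := by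
  have key : ∀ s' ⊆ s, ∃ z : J → A, (∀ i ∈ s', z i ∈ X i) ∧ (∀ i ∉ s', z i = w i) ∧
      SDind σ z := by
    intro s'
    induction s' using Finset.induction_on with
    | empty => intro _; exact ⟨w, by simp, by simp, hw⟩
    | insert i s' his ih =>
      intro hs
      obtain ⟨z, h1, h2, h3⟩ := ih fun x hx => hs (Finset.mem_insert_of_mem hx)
      have his2 : i ∈ s := hs (Finset.mem_insert_self _ _)
      obtain ⟨y, hy, hy'⟩ := h3.exchange hσ i (hX i) (by
        rw [h2 i his]
        refine sd_alg_map _ _ (RingHom.id A) Function.injective_id ?_ (h i his2)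
        refine fun x hx => Algebra.adjoin_mono (sdOrb_mono σ ?_) hx
        refine Set.union_subset_union_left _ ?_
        rintro _ ⟨j, hj, rfl⟩
        refine ⟨j, fun e => hj ?_, h2 j fun e => hj ?_⟩
        · rw [Set.mem_singleton_iff.1 e]; exact his2
        · exact hs (Finset.mem_insert_of_mem e))
      refine ⟨_, ?_, ?_, hy'⟩
      · intro j hj
        by_cases hji : j = i
        · subst hji; rwa [Function.update_self]
        · rw [Function.update_of_ne hji]
          exact h1 j ((Finset.mem_insert.1 hj).resolve_left hji)
      · intro j hj
        rw [Finset.mem_insert, not_or] at hj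
        rw [Function.update_of_ne hj.1, h2 j hj.2]
  exact key s subset_rfl

/-- the generic-translation lemma -/
lemma SDind.translate {J : Type*} [DecidableEq J] {σ θ : A →+* A} (hσ : Function.Injective σ)
    (hθ : Function.Injective θ) (hc : ∀ x, θ (σ x) = σ (θ x))
    {w : J → A} (hw : SDind σ w) (i : J) (v : A) (hv : θ v = v - w i)
    (hst : ∀ j ≠ i, θ (w j) ∈ sdD σ w i) :
    SDind σ (Function.update w i v) := by
  have hw' := (sdind_iff σ w i).1 hw
  rw [sdind_update_iff]
  refine ⟨hw'.1, fun hv' => hw'.2 ?_⟩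
  have hD : ∀ x ∈ sdD σ w i, θ x ∈ sdD σ w i := by
    refine sd_adjoin_map _ _ _ (fun r => by
      have : θ (algebraMap ℚ A r) = algebraMap ℚ A r := by simp
      rw [this]; exact Subalgebra.algebraMap_mem _ _) ?_
    rintro _ ⟨t, _, ⟨j, hj, rfl⟩, rfl⟩
    have hs : Function.Semiconj θ σ σ := hc
    rw [hs.iterate_right t (w j)]
    have := hst j hj
    clear hv
    induction t with
    | zero => exact this
    | succ t ih => rw [Function.iterate_succ_apply']; exact sdD_stable σ w i _ ih
  have hv2 : SDalg σ (sdD σ w i) (θ v) := SDalg.map hθ hc hD hv'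
  refine SDalg.of_closure hσ (sdD_stable σ w i) (X := {v, θ v}) (by simp) ?_ ?_
  · rintro x (rfl | rfl)
    · exact hv'
    · exact hv2
  · have e : w i = v - θ v := by rw [hv]; ring
    have hm : w i ∈ Algebra.adjoin (sdD σ w i) (sdOrb σ ({v, θ v} : Set A)) := by
      rw [e]
      exact sub_mem (Algebra.subset_adjoin (sdOrb_self σ (by simp)))
        (Algebra.subset_adjoin (sdOrb_self σ (by simp)))
    exact isAlgebraic_algebraMap (⟨_, hm⟩ : Algebra.adjoin (sdD σ w i) _)

end abstract_theory

/-! ### The concrete difference ring -/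

abbrev SE0 (n : ℕ) := FractionRing (MvPolynomial (Fin n × ℕ) ℚ)

abbrev SAA (n : ℕ) (l : Fin (n + 1) → ℕ) := MvPolynomial (UIdx n l × ℕ) (SE0 n)

noncomputable def sy (n : ℕ) (p : Fin n × ℕ) : SE0 n :=
  algebraMap (MvPolynomial (Fin n × ℕ) ℚ) (SE0 n) (X p)

lemma sshift_inj (α : Type*) : Function.Injective (fun p : α × ℕ => (p.1, p.2 + 1)) := by
  rintro ⟨a, b⟩ ⟨c, d⟩ h
  simp only [Prod.mk.injEq, add_left_inj] at h
  simp [h.1, h.2]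

noncomputable def sσ0 (n : ℕ) : SE0 n →+* SE0 n :=
  IsFractionRing.map (A := MvPolynomial (Fin n × ℕ) ℚ) (B := MvPolynomial (Fin n × ℕ) ℚ)
    (j := (rename (fun p : Fin n × ℕ => (p.1, p.2 + 1))).toRingHom)
    (rename_injective _ (sshift_inj _))

lemma sσ0_y (n : ℕ) (j : Fin n) (t : ℕ) : sσ0 n (sy n (j, t)) = sy n (j, t + 1) := by
  unfold sσ0 sy IsFractionRing.map
  rw [IsLocalization.map_eq]
  simp

lemma sy_ne (n : ℕ) (p : Fin n × ℕ) : sy n p ≠ 0 := by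
  unfold sy
  simp

noncomputable def sσ (n : ℕ) (l : Fin (n + 1) → ℕ) : SAA n l →+* SAA n l :=
  (rename (fun p : UIdx n l × ℕ => (p.1, p.2 + 1))).toRingHom.comp (MvPolynomial.map (sσ0 n))

lemma sσ_inj (n : ℕ) (l : Fin (n + 1) → ℕ) : Function.Injective (sσ n l) :=
  (rename_injective _ (sshift_inj _)).comp (map_injective _ (sσ0 n).injective)

lemma sσ_C (n : ℕ) (l : Fin (n + 1) → ℕ) (a : SE0 n) : sσ n l (C a) = C (sσ0 n a) := by
  simp [sσ]

lemma sσ_X (n : ℕ) (l : Fin (n + 1) → ℕ) (c : UIdx n l) (t : ℕ) :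
    sσ n l (X (c, t)) = X (c, t + 1) := by
  simp [sσ]

lemma sσ_iter_C (n : ℕ) (l : Fin (n + 1) → ℕ) (a : SE0 n) (t : ℕ) :
    (sσ n l)^[t] (C a) = C ((sσ0 n)^[t] a) := by
  induction t with
  | zero => rfl
  | succ t ih => rw [Function.iterate_succ_apply', ih, sσ_C, ← Function.iterate_succ_apply' (sσ0 n)]

lemma sσ_iter_X (n : ℕ) (l : Fin (n + 1) → ℕ) (c : UIdx n l) (t : ℕ) :
    (sσ n l)^[t] (X (c, 0)) = X (c, t) := by
  induction t with
  | zero => rfl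
  | succ t ih => rw [Function.iterate_succ_apply', ih, sσ_X]

lemma sσ0_iter_y (n : ℕ) (j : Fin n) (t : ℕ) : (sσ0 n)^[t] (sy n (j, 0)) = sy n (j, t) := by
  induction t with
  | zero => rfl
  | succ t ih => rw [Function.iterate_succ_apply', ih, sσ0_y]

/-- the generic zero -/
noncomputable def sv (n : ℕ) (l : Fin (n + 1) → ℕ) (Q : (i : Fin (n + 1)) → Fin (l i + 1) → SE0 n)
    (c : UIdx n l) : SAA n l :=
  if c.2 = 0 then - ∑ k ∈ Finset.univ.erase (0 : Fin (l c.1 + 1)),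
    X ((⟨c.1, k⟩ : UIdx n l), 0) * C (Q c.1 k)
  else X (c, 0)

lemma sv_zero (n : ℕ) (l : Fin (n + 1) → ℕ) (Q : (i : Fin (n + 1)) → Fin (l i + 1) → SE0 n)
    (i : Fin (n + 1)) : sv n l Q ⟨i, 0⟩ = - ∑ k ∈ Finset.univ.erase (0 : Fin (l i + 1)),
    X ((⟨i, k⟩ : UIdx n l), 0) * C (Q i k) := by simp [sv]

lemma sv_ne (n : ℕ) (l : Fin (n + 1) → ℕ) (Q : (i : Fin (n + 1)) → Fin (l i + 1) → SE0 n)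
    (c : UIdx n l) (h : c.2 ≠ 0) : sv n l Q c = X (c, 0) := by simp [sv, h]

noncomputable def sφ (n : ℕ) (l : Fin (n + 1) → ℕ) (Q : (i : Fin (n + 1)) → Fin (l i + 1) → SE0 n) :
    MvPolynomial (DVar n l) ℚ →ₐ[ℚ] SAA n l :=
  aeval (Sum.elim (fun p => C (sy n p)) (fun q => (sσ n l)^[q.2] (sv n l Q q.1)))

lemma sφ_inl (n : ℕ) (l : Fin (n + 1) → ℕ) (Q : (i : Fin (n + 1)) → Fin (l i + 1) → SE0 n)
    (p) : sφ n l Q (X (Sum.inl p)) = C (sy n p) := by simp [sφ]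

lemma sφ_inr (n : ℕ) (l : Fin (n + 1) → ℕ) (Q : (i : Fin (n + 1)) → Fin (l i + 1) → SE0 n)
    (q) : sφ n l Q (X (Sum.inr q)) = (sσ n l)^[q.2] (sv n l Q q.1) := by simp [sφ]

lemma tau_inl (n : ℕ) (l : Fin (n + 1) → ℕ) (j t) :
    tau n l (X (Sum.inl (j, t))) = X (Sum.inl (j, t + 1)) := by simp [tau]

lemma tau_inr (n : ℕ) (l : Fin (n + 1) → ℕ) (j t) :
    tau n l (X (Sum.inr (j, t))) = X (Sum.inr (j, t + 1)) := by simp [tau]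

lemma sφ_tau (n : ℕ) (l : Fin (n + 1) → ℕ) (Q : (i : Fin (n + 1)) → Fin (l i + 1) → SE0 n)
    (p) : sφ n l Q (tau n l p) = sσ n l (sφ n l Q p) := by
  have : (sφ n l Q).toRingHom.comp (tau n l) = (sσ n l).comp (sφ n l Q).toRingHom := by
    apply MvPolynomial.ringHom_ext
    · intro r
      exact RingHom.congr_fun (Subsingleton.elim
        (((sφ n l Q).toRingHom.comp (tau n l)).comp C)
        (((sσ n l).comp (sφ n l Q).toRingHom).comp C)) r
    · rintro (⟨j, t⟩ | ⟨c, t⟩)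
      · simp only [RingHom.comp_apply, tau_inl, AlgHom.toRingHom_eq_coe, RingHom.coe_coe, sφ_inl,
          sσ_C, sσ0_y]
      · simp only [RingHom.comp_apply, tau_inr, AlgHom.toRingHom_eq_coe, RingHom.coe_coe, sφ_inr,
          Function.iterate_succ_apply']
  exact congrArg (fun f => f p) this

lemma sφ_tau_pow (n : ℕ) (l : Fin (n + 1) → ℕ) (Q : (i : Fin (n + 1)) → Fin (l i + 1) → SE0 n)
    (t : ℕ) (p) : sφ n l Q ((tau n l ^ t) p) = (sσ n l)^[t] (sφ n l Q p) := by
  induction t with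
  | zero => rfl
  | succ t ih =>
    rw [pow_succ', RingHom.mul_def, RingHom.comp_apply, sφ_tau, ih, Function.iterate_succ_apply']

/-- generic coefficients are independent from anything in `SE0`. -/
lemma s_indep (n : ℕ) (l : Fin (n + 1) → ℕ) {ι : Type*} (q : ι → SE0 n)
    (hq : AlgebraicIndependent ℚ q) :
    AlgebraicIndependent ℚ (Sum.elim (fun p : UIdx n l × ℕ => (X p : SAA n l))
      (fun i => C (q i))) :=
  AlgebraicIndependent.sumElim_comp (S := SE0 n) hq (algebraicIndependent_X _ _)

lemma sy_indep (n : ℕ) : AlgebraicIndependent ℚ (sy n) := by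
  have h := (algebraicIndependent_X (Fin n × ℕ) ℚ).map'
    (f := IsScalarTower.toAlgHom ℚ (MvPolynomial (Fin n × ℕ) ℚ) (SE0 n))
    (IsFractionRing.injective _ _)
  exact h

/-- every element of `SE0` is algebraic over the orbit of `y`. -/
lemma s_alg_y (n : ℕ) (l : Fin (n + 1) → ℕ) (a : SE0 n) (S : Subalgebra ℚ (SAA n l))
    (hS : ∀ p, C (sy n p) ∈ S) : IsAlgebraic S (C a : SAA n l) := by
  have := IsLocalization.isAlgebraic (R := MvPolynomial (Fin n × ℕ) ℚ) (S := SE0 n)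
    (nonZeroDivisors (MvPolynomial (Fin n × ℕ) ℚ))
  have h := Algebra.IsAlgebraic.isAlgebraic (R := MvPolynomial (Fin n × ℕ) ℚ) a
  let g : MvPolynomial (Fin n × ℕ) ℚ →ₐ[ℚ] SAA n l := aeval (fun p => C (sy n p))
  have hg : ∀ p, g p ∈ S := by
    intro p
    have : Algebra.adjoin ℚ (Set.range fun p => C (sy n p)) ≤ S :=
      Algebra.adjoin_le (by rintro _ ⟨p, rfl⟩; exact hS p)
    apply this
    rw [Algebra.adjoin_range_eq_range_aeval]
    exact ⟨p, rfl⟩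
  have hgC : ∀ p, g p = C (algebraMap _ (SE0 n) p) := by
    intro p
    have : g = ((IsScalarTower.toAlgHom ℚ (SE0 n) (SAA n l)).comp
      (IsScalarTower.toAlgHom ℚ (MvPolynomial (Fin n × ℕ) ℚ) (SE0 n))) := by
      apply MvPolynomial.algHom_ext
      intro p
      simp [g, sy, MvPolynomial.algebraMap_eq]
    rw [this]; rfl
  refine h.ringHom_of_comp_eq (g.codRestrict S hg).toRingHom (C : SE0 n →+* SAA n l) ?_ ?_
  · intro p q hpq
    have : g p = g q := congrArg Subtype.val hpq
    rw [hgC, hgC] at this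
    exact IsFractionRing.injective _ _ (C_injective _ _ this)
  · exact RingHom.ext fun p => hgC p

/-- the translation automorphism. -/
noncomputable def sθ (n : ℕ) (l : Fin (n + 1) → ℕ) (c : UIdx n l) : SAA n l →ₐ[SE0 n] SAA n l :=
  aeval (fun p => if p.1 = c then X p + 1 else X p)

lemma sθ_inj (n : ℕ) (l : Fin (n + 1) → ℕ) (c : UIdx n l) : Function.Injective (sθ n l c) := by
  let g : SAA n l →ₐ[SE0 n] SAA n l := aeval (fun p => if p.1 = c then X p - 1 else X p)
  have : g.comp (sθ n l c) = AlgHom.id _ _ := by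
    apply MvPolynomial.algHom_ext
    intro p
    by_cases h : p.1 = c <;> simp [g, sθ, h]
  exact Function.LeftInverse.injective (g := g) fun x => congrArg (fun f => f x) this

lemma sθ_X (n : ℕ) (l : Fin (n + 1) → ℕ) (c : UIdx n l) (p) :
    sθ n l c (X p) = if p.1 = c then X p + 1 else X p := by simp [sθ]

lemma sθ_C (n : ℕ) (l : Fin (n + 1) → ℕ) (c : UIdx n l) (a) :
    sθ n l c (C a) = C a := (sθ n l c).commutes a

lemma sθ_σ (n : ℕ) (l : Fin (n + 1) → ℕ) (c : UIdx n l) (x) :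
    sθ n l c (sσ n l x) = sσ n l (sθ n l c x) := by
  have : (sθ n l c).toRingHom.comp (sσ n l) = (sσ n l).comp (sθ n l c).toRingHom := by
    apply MvPolynomial.ringHom_ext
    · intro r
      simp only [RingHom.comp_apply, AlgHom.toRingHom_eq_coe, RingHom.coe_coe, sσ_C, sθ_C]
    · rintro ⟨c', t⟩
      simp only [RingHom.comp_apply, AlgHom.toRingHom_eq_coe, RingHom.coe_coe, sσ_X, sθ_X]
      split_ifs <;> simp [sσ_X]
  exact congrArg (fun f => f x) this

lemma sθ_v_self (n : ℕ) (l : Fin (n + 1) → ℕ) (Q : (i : Fin (n + 1)) → Fin (l i + 1) → SE0 n)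
    (i : Fin (n + 1)) (k : Fin (l i + 1)) (hk : k ≠ 0) :
    sθ n l ⟨i, k⟩ (sv n l Q ⟨i, 0⟩) = sv n l Q ⟨i, 0⟩ - C (Q i k) := by
  rw [sv_zero, map_neg, map_sum]
  have : ∀ k' ∈ Finset.univ.erase (0 : Fin (l i + 1)),
      sθ n l ⟨i, k⟩ (X ((⟨i, k'⟩ : UIdx n l), 0) * C (Q i k')) =
      X ((⟨i, k'⟩ : UIdx n l), 0) * C (Q i k') + if k' = k then C (Q i k) else 0 := by
    intro k' _
    rw [map_mul, sθ_X, sθ_C]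
    by_cases h : k' = k
    · subst h; simp; ring
    · have : (⟨i, k'⟩ : UIdx n l) ≠ ⟨i, k⟩ := by simpa using h
      simp [h]
  rw [Finset.sum_congr rfl this, Finset.sum_add_distrib, Finset.sum_ite_eq']
  simp [hk]
  ring

lemma sθ_v_other (n : ℕ) (l : Fin (n + 1) → ℕ) (Q : (i : Fin (n + 1)) → Fin (l i + 1) → SE0 n)
    (i i' : Fin (n + 1)) (k : Fin (l i + 1)) (hi : i' ≠ i) :
    sθ n l ⟨i, k⟩ (sv n l Q ⟨i', 0⟩) = sv n l Q ⟨i', 0⟩ := by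
  rw [sv_zero, map_neg, map_sum]
  congr 1
  refine Finset.sum_congr rfl fun k' _ => ?_
  rw [map_mul, sθ_X, sθ_C, if_neg]
  intro h
  exact hi (congrArg Sigma.fst h)

/-! ### The saturated ideal is the kernel of the generic zero -/

/-- the transformed norm monomials -/
noncomputable def sM (n s : ℕ) (l : Fin (n + 1) → ℕ)
    (e : (i : Fin (n + 1)) → Fin (l i + 1) → Fin n → ℕ → ℕ) (i : Fin (n + 1)) (k : Fin (l i + 1))
    (t : ℕ) : MvPolynomial (DVar n l) ℚ :=
  ∏ j : Fin n, ∏ κ ∈ Finset.range (s + 1), X (Sum.inl (j, κ + t)) ^ (e i k j κ)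

/-- the transformed monomial quotients -/
noncomputable def sQ (n s : ℕ) (l : Fin (n + 1) → ℕ)
    (d : (i : Fin (n + 1)) → Fin (l i + 1) → Fin n → ℕ → ℤ) (i : Fin (n + 1)) (k : Fin (l i + 1))
    (t : ℕ) : SE0 n :=
  ∏ j : Fin n, ∏ κ ∈ Finset.range (s + 1), sy n (j, κ + t) ^ (d i k j κ - d i 0 j κ)

lemma sQ_iter (n s : ℕ) (l : Fin (n + 1) → ℕ)
    (d : (i : Fin (n + 1)) → Fin (l i + 1) → Fin n → ℕ → ℤ) (i : Fin (n + 1)) (k : Fin (l i + 1))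
    (t : ℕ) : (sσ0 n)^[t] (sQ n s l d i k 0) = sQ n s l d i k t := by
  induction t with
  | zero => rfl
  | succ t ih =>
    rw [Function.iterate_succ_apply', ih]
    simp only [sQ, map_prod, map_zpow₀, sσ0_y]
    rfl

lemma tau_sM (n s : ℕ) (l : Fin (n + 1) → ℕ)
    (e : (i : Fin (n + 1)) → Fin (l i + 1) → Fin n → ℕ → ℕ) (i : Fin (n + 1)) (k : Fin (l i + 1))
    (t : ℕ) : tau n l (sM n s l e i k t) = sM n s l e i k (t + 1) := by
  simp only [sM, map_prod, map_pow, tau_inl]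
  rfl

lemma tau_N (n s : ℕ) (l : Fin (n + 1) → ℕ)
    (e : (i : Fin (n + 1)) → Fin (l i + 1) → Fin n → ℕ → ℕ) (i : Fin (n + 1)) (t : ℕ) :
    (tau n l ^ t) (∑ k : Fin (l i + 1), X (Sum.inr (⟨i, k⟩, 0)) * sM n s l e i k 0) =
      ∑ k : Fin (l i + 1), X (Sum.inr (⟨i, k⟩, t)) * sM n s l e i k t := by
  induction t with
  | zero => rfl
  | succ t ih =>
    rw [pow_succ', RingHom.mul_def, RingHom.comp_apply, ih]
    simp only [map_sum, map_mul, tau_inr, tau_sM]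

lemma sM_mem (n s : ℕ) (l : Fin (n + 1) → ℕ)
    (e : (i : Fin (n + 1)) → Fin (l i + 1) → Fin n → ℕ → ℕ) (i : Fin (n + 1)) (k : Fin (l i + 1))
    (t : ℕ) : sM n s l e i k t ∈ Submonoid.closure
      (Set.range fun v : Fin n × ℕ => (X (Sum.inl v) : MvPolynomial (DVar n l) ℚ)) := by
  refine Submonoid.prod_mem _ fun j _ => Submonoid.prod_mem _ fun κ _ => Submonoid.pow_mem _ ?_ _
  exact Submonoid.subset_closure ⟨_, rfl⟩

lemma sφ_sM (n s : ℕ) (l : Fin (n + 1) → ℕ)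
    (d : (i : Fin (n + 1)) → Fin (l i + 1) → Fin n → ℕ → ℤ)
    (g : Fin (n + 1) → Fin n → ℕ → ℤ)
    (e : (i : Fin (n + 1)) → Fin (l i + 1) → Fin n → ℕ → ℕ)
    (he : ∀ i k j κ, (e i k j κ : ℤ) = d i k j κ + g i j κ)
    (Q : (i : Fin (n + 1)) → Fin (l i + 1) → SE0 n)
    (i : Fin (n + 1)) (k : Fin (l i + 1)) :
    sφ n l Q (sM n s l e i k 0) = C (sQ n s l d i k 0) * sφ n l Q (sM n s l e i 0 0) := by
  simp only [sM, sQ, map_prod, map_pow, sφ_inl, ← Finset.prod_mul_distrib]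
  refine Finset.prod_congr rfl fun j _ => Finset.prod_congr rfl fun κ _ => ?_
  rw [← map_pow, ← map_pow, ← map_mul, ← zpow_natCast, ← zpow_natCast,
    ← zpow_add₀ (sy_ne n _), he, he]
  congr 2
  ring

lemma sφ_mY_ne (n : ℕ) (l : Fin (n + 1) → ℕ) (Q : (i : Fin (n + 1)) → Fin (l i + 1) → SE0 n)
    (M : MvPolynomial (DVar n l) ℚ) (hM : M ∈ Submonoid.closure
      (Set.range fun v : Fin n × ℕ => (X (Sum.inl v) : MvPolynomial (DVar n l) ℚ))) :
    sφ n l Q M ≠ 0 := by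
  induction hM using Submonoid.closure_induction with
  | mem x hx =>
    obtain ⟨v, rfl⟩ := hx
    simp only [sφ_inl]
    intro h
    exact sy_ne n v (by simpa using h)
  | one => simp
  | mul x y _ _ hx hy => rw [map_mul]; exact mul_ne_zero hx hy

lemma sQ_zero (n s : ℕ) (l : Fin (n + 1) → ℕ)
    (d : (i : Fin (n + 1)) → Fin (l i + 1) → Fin n → ℕ → ℤ) (i : Fin (n + 1)) (t : ℕ) :
    sQ n s l d i 0 t = 1 := by
  simp [sQ]

lemma sφ_N (n s : ℕ) (l : Fin (n + 1) → ℕ)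
    (d : (i : Fin (n + 1)) → Fin (l i + 1) → Fin n → ℕ → ℤ)
    (g : Fin (n + 1) → Fin n → ℕ → ℤ)
    (e : (i : Fin (n + 1)) → Fin (l i + 1) → Fin n → ℕ → ℕ)
    (he : ∀ i k j κ, (e i k j κ : ℤ) = d i k j κ + g i j κ)
    (i : Fin (n + 1)) :
    sφ n l (fun i k => sQ n s l d i k 0)
      (∑ k : Fin (l i + 1), X (Sum.inr (⟨i, k⟩, 0)) * sM n s l e i k 0) = 0 := by
  rw [map_sum, ← Finset.add_sum_erase _ _ (Finset.mem_univ (0 : Fin (l i + 1)))]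
  simp only [map_mul, sφ_inr, Function.iterate_zero, id]
  rw [sv_zero]
  have : ∀ k ∈ Finset.univ.erase (0 : Fin (l i + 1)),
      sv n l (fun i k => sQ n s l d i k 0) ⟨i, k⟩ *
        sφ n l (fun i k => sQ n s l d i k 0) (sM n s l e i k 0) =
      (X ((⟨i, k⟩ : UIdx n l), 0) * C (sQ n s l d i k 0)) *
        sφ n l (fun i k => sQ n s l d i k 0) (sM n s l e i 0 0) := by
    intro k hk
    rw [sv_ne _ _ _ _ (Finset.ne_of_mem_erase hk), sφ_sM n s l d g e he]
    ring
  rw [Finset.sum_congr rfl this, ← Finset.sum_mul]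
  ring

/-- the variables other than the `u_{i0}`. -/
noncomputable def sSub (n : ℕ) (l : Fin (n + 1) → ℕ) : Subalgebra ℚ (MvPolynomial (DVar n l) ℚ) :=
  Algebra.adjoin ℚ {x | (∃ p, x = X (Sum.inl p)) ∨ ∃ c t, c.2 ≠ 0 ∧ x = X (Sum.inr (c, t))}

lemma sSub_inj (n : ℕ) (l : Fin (n + 1) → ℕ) (Q : (i : Fin (n + 1)) → Fin (l i + 1) → SE0 n)
    (q) (hq : q ∈ sSub n l) (h : sφ n l Q q = 0) : q = 0 := by
  let ψ : MvPolynomial (DVar n l) ℚ →ₐ[ℚ] SAA n l :=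
    aeval (Sum.elim (fun p => C (sy n p)) (fun q => X q))
  have hψ : Function.Injective ψ := by
    have := (s_indep n l _ (sy_indep n)).comp Sum.swap
      (Function.LeftInverse.injective (g := Sum.swap) Sum.swap_swap)
    have e : (Sum.elim (fun p : UIdx n l × ℕ => (X p : SAA n l))
      (fun i => C (sy n i))) ∘ Sum.swap = Sum.elim (fun p => C (sy n p)) (fun q => X q) := by
      funext x; cases x <;> rfl
    rw [e] at this
    exact this
  have heq : sSub n l ≤ AlgHom.equalizer (sφ n l Q) ψ := by
    refine Algebra.adjoin_le ?_
    rintro x (⟨p, rfl⟩ | ⟨c, t, hc, rfl⟩)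
    · simp [sφ_inl, ψ]
    · simp [sφ_inr, ψ, sv_ne n l Q c hc, sσ_iter_X]
  have h1 : sφ n l Q q = ψ q := heq hq
  apply hψ
  rw [← h1, h, map_zero]

lemma mY_sub (n : ℕ) (l : Fin (n + 1) → ℕ)
    (M : MvPolynomial (DVar n l) ℚ) (hM : M ∈ Submonoid.closure
      (Set.range fun v : Fin n × ℕ => (X (Sum.inl v) : MvPolynomial (DVar n l) ℚ))) :
    M ∈ sSub n l := by
  have : Submonoid.closure
      (Set.range fun v : Fin n × ℕ => (X (Sum.inl v) : MvPolynomial (DVar n l) ℚ)) ≤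
      (sSub n l).toSubmonoid := by
    rw [Submonoid.closure_le]
    rintro _ ⟨v, rfl⟩
    exact Algebra.subset_adjoin (Or.inl ⟨v, rfl⟩)
  exact this hM

lemma s_reduce (n s : ℕ) (l : Fin (n + 1) → ℕ)
    (e : (i : Fin (n + 1)) → Fin (l i + 1) → Fin n → ℕ → ℕ)
    (I : Ideal (MvPolynomial (DVar n l) ℚ))
    (hI : ∀ i t, ∑ k : Fin (l i + 1), X (Sum.inr (⟨i, k⟩, t)) * sM n s l e i k t ∈ I)
    (p : MvPolynomial (DVar n l) ℚ) : ∃ M ∈ Submonoid.closure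
      (Set.range fun v : Fin n × ℕ => (X (Sum.inl v) : MvPolynomial (DVar n l) ℚ)),
      ∃ q ∈ sSub n l, M * p - q ∈ I := by
  induction p using MvPolynomial.induction_on with
  | C a =>
    refine ⟨1, Submonoid.one_mem _, C a, Subalgebra.algebraMap_mem _ a, ?_⟩
    simp
  | add p p' hp hp' =>
    obtain ⟨M, hM, q, hq, h⟩ := hp
    obtain ⟨M', hM', q', hq', h'⟩ := hp'
    refine ⟨M * M', Submonoid.mul_mem _ hM hM', M' * q + M * q',
      Subalgebra.add_mem _ (Subalgebra.mul_mem _ (mY_sub _ _ _ hM') hq)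
        (Subalgebra.mul_mem _ (mY_sub _ _ _ hM) hq'), ?_⟩
    have := I.add_mem (I.mul_mem_left M' h) (I.mul_mem_left M h')
    convert this using 1
    ring
  | mul_X p v hp =>
    obtain ⟨M, hM, q, hq, h⟩ := hp
    by_cases hv : (X v : MvPolynomial (DVar n l) ℚ) ∈ sSub n l
    · refine ⟨M, hM, q * X v, Subalgebra.mul_mem _ hq hv, ?_⟩
      have := I.mul_mem_right (X v) h
      convert this using 1
      ring
    · obtain ⟨i, t, rfl⟩ : ∃ i t, v = Sum.inr (⟨i, 0⟩, t) := by
        rcases v with p | ⟨⟨i, k⟩, t⟩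
        · exact (hv (Algebra.subset_adjoin (Or.inl ⟨p, rfl⟩))).elim
        · by_cases hk : k = 0
          · subst hk; exact ⟨i, t, rfl⟩
          · exact (hv (Algebra.subset_adjoin (Or.inr ⟨⟨i, k⟩, t, hk, rfl⟩))).elim
      refine ⟨M * sM n s l e i 0 t, Submonoid.mul_mem _ hM (sM_mem _ _ _ _ _ _ _),
        -(q * ∑ k ∈ Finset.univ.erase (0 : Fin (l i + 1)),
          X (Sum.inr (⟨i, k⟩, t)) * sM n s l e i k t), ?_, ?_⟩
      · refine Subalgebra.neg_mem _ (Subalgebra.mul_mem _ hq (Subalgebra.sum_mem _ fun k hk => ?_))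
        refine Subalgebra.mul_mem _ ?_ (mY_sub _ _ _ (sM_mem _ _ _ _ _ _ _))
        exact Algebra.subset_adjoin (Or.inr ⟨⟨i, k⟩, t, Finset.ne_of_mem_erase hk, rfl⟩)
      · have h1 := I.mul_mem_right (X (Sum.inr (⟨i, 0⟩, t)) * sM n s l e i 0 t) h
        have h2 := I.mul_mem_left q (hI i t)
        rw [← Finset.add_sum_erase _ _ (Finset.mem_univ (0 : Fin (l i + 1)))] at h2
        have := I.add_mem h1 h2
        convert this using 1
        ring

lemma s_sat (n s : ℕ) (l : Fin (n + 1) → ℕ)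
    (d : (i : Fin (n + 1)) → Fin (l i + 1) → Fin n → ℕ → ℤ)
    (g : Fin (n + 1) → Fin n → ℕ → ℤ)
    (e : (i : Fin (n + 1)) → Fin (l i + 1) → Fin n → ℕ → ℕ)
    (he : ∀ i k j κ, (e i k j κ : ℤ) = d i k j κ + g i j κ)
    (N : Fin (n + 1) → MvPolynomial (DVar n l) ℚ)
    (hN : ∀ i, N i = ∑ k : Fin (l i + 1), X (Sum.inr (⟨i, k⟩, 0)) * sM n s l e i k 0)
    (p : MvPolynomial (DVar n l) ℚ) :
    (∃ M ∈ Submonoid.closure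
      (Set.range fun v : Fin n × ℕ => (X (Sum.inl v) : MvPolynomial (DVar n l) ℚ)), M * p ∈
      Ideal.span (⋃ t : ℕ, (fun q => (tau n l ^ t) q) '' Set.range N)) ↔
    sφ n l (fun i k => sQ n s l d i k 0) p = 0 := by
  have hker : Ideal.span (⋃ t : ℕ, (fun q => (tau n l ^ t) q) '' Set.range N) ≤
      RingHom.ker (sφ n l (fun i k => sQ n s l d i k 0)) := by
    rw [Ideal.span_le]
    intro x hx
    obtain ⟨t, _, ⟨i, rfl⟩, rfl⟩ := Set.mem_iUnion.1 hx
    rw [SetLike.mem_coe, RingHom.mem_ker]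
    show sφ n l _ ((tau n l ^ t) (N i)) = 0
    rw [sφ_tau_pow, hN, sφ_N n s l d g e he]
    exact iterate_map_zero (sσ n l) t
  constructor
  · rintro ⟨M, hM, h⟩
    have := hker h
    rw [RingHom.mem_ker, map_mul] at this
    exact (mul_eq_zero.1 this).resolve_left (sφ_mY_ne n l _ M hM)
  · intro h
    obtain ⟨M, hM, q, hq, hMq⟩ := s_reduce n s l e
      (Ideal.span (⋃ t : ℕ, (fun q => (tau n l ^ t) q) '' Set.range N))
      (fun i t => Ideal.subset_span (Set.mem_iUnion.2 ⟨t, N i, ⟨i, rfl⟩, by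
        show (tau n l ^ t) (N i) = _
        rw [hN, tau_N]⟩)) p
    have h1 := hker hMq
    rw [RingHom.mem_ker, map_sub, map_mul, h, mul_zero, zero_sub, neg_eq_zero] at h1
    have h2 := sSub_inj n l _ q hq h1
    rw [h2, sub_zero] at hMq
    exact ⟨M, hM, hMq⟩

/-! ### Difference independence of the generic zero -/

lemma s_conv (n : ℕ) (l : Fin (n + 1) → ℕ) (Q : (i : Fin (n + 1)) → Fin (l i + 1) → SE0 n)
    (S : Finset (UIdx n l)) :
    (∀ p, sφ n l Q p = 0 → (∀ v ∈ p.vars, ∃ c ∈ S, ∃ t, v = Sum.inr (c, t)) → p = 0) ↔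
      SDind (sσ n l) (fun c : {c // c ∈ S} => sv n l Q c) := by
  let r : {c // c ∈ S} × ℕ → DVar n l := fun p => Sum.inr (p.1, p.2)
  have hr : Function.Injective r := by
    rintro ⟨⟨a, ha⟩, t⟩ ⟨⟨b, hb⟩, u⟩ h
    simp only [r, Sum.inr.injEq, Prod.mk.injEq] at h
    obtain ⟨h1, h2⟩ := h
    subst h1; subst h2; rfl
  have hφ : ∀ p, sφ n l Q (rename r p) =
      aeval (fun p : {c // c ∈ S} × ℕ => (sσ n l)^[p.2] (sv n l Q p.1)) p := by
    intro p
    rw [sφ, aeval_rename]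
    rfl
  unfold SDind
  rw [algebraicIndependent_iff]
  constructor
  · intro h p hp
    apply rename_injective r hr
    rw [map_zero]
    apply h
    · rw [hφ, hp]
    · classical
      intro v hv
      have := vars_rename r p hv
      obtain ⟨⟨c, t⟩, _, rfl⟩ := Finset.mem_image.1 this
      exact ⟨c, c.2, t, rfl⟩
  · intro h p hp hv
    obtain ⟨q, rfl⟩ := exists_rename_eq_of_vars_subset_range p r hr (by
      intro v hv'
      obtain ⟨c, hc, t, rfl⟩ := hv v hv'
      exact ⟨(⟨c, hc⟩, t), rfl⟩)
    rw [hφ] at hp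
    rw [h q hp, map_zero]

lemma s_np (n : ℕ) (l : Fin (n + 1) → ℕ) {J : Type*} [DecidableEq J] (w : J → SAA n l)
    (s : Finset J) (f : Fin (n + 1) → J) (hf : Function.Injective f) (hfs : ∀ i, f i ∈ s)
    (h : ∀ i ∈ s, IsAlgebraic (Algebra.adjoin ℚ (sdOrb (sσ n l) (w '' {j | j ∉ s} ∪
      Set.range fun j : Fin n => (C (sy n (j, 0)) : SAA n l)))) (w i)) : ¬ SDind (sσ n l) w := by
  intro hw
  obtain ⟨z, hz, -, hz'⟩ := hw.exchange_all (sσ_inj n l) s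
    (X := fun _ => Set.range fun j : Fin n => (C (sy n (j, 0)) : SAA n l))
    (fun _ => Set.finite_range _) h
  choose m hm using fun i => hz (f i) (hfs i)
  obtain ⟨a, b, hab, hmab⟩ := Fintype.exists_ne_map_eq_of_card_lt m (by simp)
  have hzz : z (f a) = z (f b) := by rw [← hm, ← hm, hmab]
  have := AlgebraicIndependent.injective hz' (a₁ := (f a, 0)) (a₂ := (f b, 0)) hzz
  exact hab (hf (congrArg Prod.fst this))

lemma s_y_mem (n : ℕ) (l : Fin (n + 1) → ℕ) (W : Set (SAA n l)) (p : Fin n × ℕ) :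
    C (sy n p) ∈ Algebra.adjoin ℚ (sdOrb (sσ n l) (W ∪
      Set.range fun j : Fin n => (C (sy n (j, 0)) : SAA n l))) := by
  refine Algebra.subset_adjoin ⟨p.2, C (sy n (p.1, 0)), Or.inr ⟨p.1, rfl⟩, ?_⟩
  rw [sσ_iter_C, sσ0_iter_y]

lemma s_not_all (n : ℕ) (l : Fin (n + 1) → ℕ) (Q : (i : Fin (n + 1)) → Fin (l i + 1) → SE0 n) :
    ¬ SDind (sσ n l) (fun c : {c // c ∈ (Finset.univ : Finset (UIdx n l))} => sv n l Q c) := by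
  intro h
  have h' := h.comp (fun c : UIdx n l => ⟨c, Finset.mem_univ c⟩)
    (fun a b hab => congrArg Subtype.val hab)
  refine s_np n l (sv n l Q) (Finset.univ.filter fun c => c.2 = 0) (fun i => ⟨i, 0⟩)
    (fun a b hab => congrArg Sigma.fst hab) (fun i => by simp) ?_ h'
  rintro ⟨i, k⟩ hi
  have hk : k = 0 := by simpa using hi
  subst hk
  rw [sv_zero]
  refine IsAlgebraic.neg (Finset.sum_induction _ (IsAlgebraic _) (fun _ _ => IsAlgebraic.add)
    isAlgebraic_zero fun k hk => IsAlgebraic.mul ?_ ?_)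
  · refine isAlgebraic_algebraMap (A := SAA n l) (⟨X ((⟨i, k⟩ : UIdx n l), 0), ?_⟩ :
      Algebra.adjoin ℚ (sdOrb (sσ n l) (sv n l Q '' {j | j ∉ Finset.univ.filter fun c => c.2 = 0} ∪
      Set.range fun j : Fin n => (C (sy n (j, 0)) : SAA n l))))
    have hk := Finset.ne_of_mem_erase hk
    refine Algebra.subset_adjoin (sdOrb_self _ (Or.inl ⟨⟨i, k⟩, by simpa using hk, ?_⟩))
    exact sv_ne n l Q ⟨i, k⟩ hk
  · exact s_alg_y n l _ _ (s_y_mem n l _)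

lemma s_desc (n : ℕ) (l : Fin (n + 1) → ℕ) {J : Type*} (q : J → SE0 n) :
    AlgebraicIndependent ℚ (fun p : J × ℕ => (sσ0 n)^[p.2] (q p.1)) ↔
      SDind (sσ n l) (fun j => (C (q j) : SAA n l)) := by
  unfold SDind
  rw [← AlgHom.algebraicIndependent_iff (IsScalarTower.toAlgHom ℚ (SE0 n) (SAA n l))
    (C_injective _ _)]
  have : (IsScalarTower.toAlgHom ℚ (SE0 n) (SAA n l)) ∘
      (fun p : J × ℕ => (sσ0 n)^[p.2] (q p.1)) =
      fun p : J × ℕ => (sσ n l)^[p.2] (C (q p.1) : SAA n l) := by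
    funext p
    rw [sσ_iter_C]
    rfl
  rw [this]

lemma s_dtr (n : ℕ) (l : Fin (n + 1) → ℕ) (q : Fin (n + 1) → SE0 n) :
    dtrdegFam (fun p : Fin (n + 1) × ℕ => (sσ0 n)^[p.2] (q p.1)) = n ↔
      ∃ T : Finset (Fin (n + 1)), T.card = n ∧
        SDind (sσ n l) (fun i : {x // x ∈ T} => (C (q i) : SAA n l)) := by
  have hb : ∀ T : Finset (Fin (n + 1)),
      AlgebraicIndependent ℚ (fun p : {x // x ∈ T} × ℕ => (sσ0 n)^[p.2] (q p.1)) →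
      T.card ≤ n := by
    intro T hT
    by_contra hcon
    have h1 : T.card ≤ n + 1 := by simpa using Finset.card_le_univ T
    have h2 : T = Finset.univ := by
      apply (Finset.card_eq_iff_eq_univ T).1
      rw [Fintype.card_fin]; omega
    have hmem : ∀ i, i ∈ T := fun i => by simp [h2]
    refine s_np n l (fun i : {x // x ∈ T} => (C (q i) : SAA n l)) Finset.univ
      (fun i => ⟨i, hmem i⟩) (fun a b hab => congrArg Subtype.val hab)
      (fun i => Finset.mem_univ _) (fun i _ => ?_)
      ((s_desc n l (fun i : {x // x ∈ T} => q i)).1 hT)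
    exact s_alg_y n l _ _ (s_y_mem n l _)
  unfold dtrdegFam
  set Z : Set ℕ := {c : ℕ | ∃ T : Finset (Fin (n + 1)), T.card = c ∧
    AlgebraicIndependent ℚ (fun p : {x // x ∈ T} × ℕ => (sσ0 n)^[p.2] (q p.1))} with hZ
  have hbdd : BddAbove Z := ⟨n, by rintro c ⟨T, rfl, hT⟩; exact hb T hT⟩
  have hne : Z.Nonempty := by
    refine ⟨0, ∅, rfl, ?_⟩
    have : IsEmpty ({x // x ∈ (∅ : Finset (Fin (n + 1)))} × ℕ) :=
      ⟨fun p => Finset.notMem_empty _ p.1.2⟩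
    rw [algebraicIndependent_empty_type_iff]
    exact (algebraMap ℚ (SE0 n)).injective
  constructor
  · intro h
    obtain ⟨T, hT, hT'⟩ := Nat.sSup_mem hne hbdd
    refine ⟨T, hT.trans h, (s_desc n l (fun i : {x // x ∈ T} => q i)).1 hT'⟩
  · rintro ⟨T, hT, hT'⟩
    apply le_antisymm
    · exact csSup_le hne (by rintro c ⟨T, rfl, hT⟩; exact hb T hT)
    · exact le_csSup hbdd ⟨T, hT, (s_desc n l (fun i : {x // x ∈ T} => q i)).2 hT'⟩

lemma s_forward (n : ℕ) (l : Fin (n + 1) → ℕ) (hl : ∀ i, 1 ≤ l i)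
    (Q : (i : Fin (n + 1)) → Fin (l i + 1) → SE0 n)
    (S : Finset (UIdx n l)) (hS : S.card = (∑ i, (l i + 1)) - 1)
    (h : SDind (sσ n l) (fun c : {c // c ∈ S} => sv n l Q c)) :
    ∃ k : (i : Fin (n + 1)) → Fin (l i + 1), (∀ i, k i ≠ 0) ∧
      ∃ T : Finset (Fin (n + 1)), T.card = n ∧
        SDind (sσ n l) (fun i : {x // x ∈ T} => (C (Q i (k i)) : SAA n l)) := by
  classical
  have hcard : Fintype.card (UIdx n l) = ∑ i, (l i + 1) := by
    simp [Fintype.card_sigma]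
  have hpos : 1 ≤ Fintype.card (UIdx n l) := Fintype.card_pos_iff.2 ⟨⟨0, 0⟩⟩
  have hc : Sᶜ.card = 1 := by
    rw [Finset.card_compl, hS, ← hcard]; omega
  obtain ⟨c0, hc0⟩ := Finset.card_eq_one.1 hc
  have hmem : ∀ c : UIdx n l, c.1 ≠ c0.1 → c ∈ S := by
    intro c hcc
    by_contra hcs
    have : c ∈ Sᶜ := Finset.mem_compl.2 hcs
    rw [hc0, Finset.mem_singleton] at this
    exact hcc (by rw [this])
  have h1 := h.comp (fun c : {c : UIdx n l // c.1 ≠ c0.1} => ⟨c.1, hmem c.1 c.2⟩)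
    (fun a b hab => Subtype.ext (congrArg (fun x => x.1) hab))
  obtain ⟨z, hz, -, hz'⟩ := h1.exchange_all (sσ_inj n l) (Finset.univ.filter fun c => c.1.2 = 0)
    (X := fun c => (fun k => (C (Q c.1.1 k) : SAA n l)) '' {k | k ≠ 0})
    (fun _ => Set.toFinite _) (by
      rintro ⟨⟨i, k⟩, hi⟩ hk
      have hk : k = 0 := by simpa using hk
      subst hk
      have : sv n l Q ⟨i, 0⟩ ∈ Algebra.adjoin ℚ (sdOrb (sσ n l)
        (((fun c : {c // c ∈ S} => sv n l Q c) ∘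
          (fun c : {c : UIdx n l // c.1 ≠ c0.1} => ⟨c.1, hmem c.1 c.2⟩)) ''
          {j | j ∉ (Finset.univ.filter fun c : {c : UIdx n l // c.1 ≠ c0.1} => c.1.2 = 0)} ∪
          (fun k => (C (Q i k) : SAA n l)) '' {k | k ≠ 0})) := by
        rw [sv_zero]
        refine Subalgebra.neg_mem _ (Subalgebra.sum_mem _ fun k hk => ?_)
        have hk := Finset.ne_of_mem_erase hk
        refine Subalgebra.mul_mem _ ?_ ?_
        · refine Algebra.subset_adjoin (sdOrb_self _ (Or.inl ⟨⟨⟨i, k⟩, hi⟩, by simpa using hk, ?_⟩))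
          exact sv_ne n l Q ⟨i, k⟩ hk
        · exact Algebra.subset_adjoin (sdOrb_self _ (Or.inr ⟨k, hk, rfl⟩))
      exact isAlgebraic_algebraMap (A := SAA n l) (⟨_, this⟩ : Algebra.adjoin ℚ _))
  have hk : ∀ i, ∃ k : Fin (l i + 1), k ≠ 0 ∧ ∀ hi : i ≠ c0.1, z ⟨⟨i, 0⟩, hi⟩ = C (Q i k) := by
    intro i
    by_cases hi : i = c0.1
    · refine ⟨Fin.last _, ?_, fun h => absurd hi h⟩
      intro h0
      have := congrArg Fin.val h0
      have := hl i
      simp at *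
      omega
    · obtain ⟨k, hk, hk'⟩ := hz ⟨⟨i, 0⟩, hi⟩ (by simp)
      exact ⟨k, hk, fun _ => hk'.symm⟩
  choose k hk hk' using hk
  refine ⟨k, hk, Finset.univ.erase c0.1, by simp, ?_⟩
  have h2 := hz'.comp (fun i : {x // x ∈ Finset.univ.erase c0.1} =>
    ⟨⟨i.1, 0⟩, Finset.ne_of_mem_erase i.2⟩)
    (fun a b hab => Subtype.ext (congrArg (fun x => x.1.1) hab))
  convert h2 using 1
  funext i
  exact (hk' i.1 (Finset.ne_of_mem_erase i.2)).symm

lemma s_backward (n : ℕ) (l : Fin (n + 1) → ℕ)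
    (Q : (i : Fin (n + 1)) → Fin (l i + 1) → SE0 n)
    (k : (i : Fin (n + 1)) → Fin (l i + 1)) (hk : ∀ i, k i ≠ 0)
    (T : Finset (Fin (n + 1))) (hT : T.card = n)
    (h : SDind (sσ n l) (fun i : {x // x ∈ T} => (C (Q i (k i)) : SAA n l))) :
    ∃ S : Finset (UIdx n l), S.card = (∑ i, (l i + 1)) - 1 ∧
      SDind (sσ n l) (fun c : {c // c ∈ S} => sv n l Q c) := by
  classical
  have hcard : Fintype.card (UIdx n l) = ∑ i, (l i + 1) := by
    simp [Fintype.card_sigma]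
  have hc : Tᶜ.card = 1 := by
    rw [Finset.card_compl, hT, Fintype.card_fin]; omega
  obtain ⟨i0, hi0⟩ := Finset.card_eq_one.1 hc
  have hmem : ∀ i, i ≠ i0 → i ∈ T := by
    intro i hi
    by_contra hcs
    have : i ∈ Tᶜ := Finset.mem_compl.2 hcs
    rw [hi0, Finset.mem_singleton] at this
    exact hi this
  refine ⟨Finset.univ.erase ⟨i0, 0⟩, ?_, ?_⟩
  · rw [Finset.card_erase_of_mem (Finset.mem_univ _), Finset.card_univ, hcard]
  have hne : ∀ c : {c // c ∈ (Finset.univ : Finset (UIdx n l)).erase ⟨i0, 0⟩},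
      c.1.2 = 0 → c.1.1 ≠ i0 := by
    rintro ⟨⟨i, k⟩, hc⟩ h0 h1
    have h0 : k = 0 := h0
    have h1 : i = i0 := h1
    subst h1
    exact Finset.ne_of_mem_erase hc (congrArg (Sigma.mk i) h0)
  have key : ∀ A : Finset (Fin (n + 1)), SDind (sσ n l)
      (fun c : {c // c ∈ (Finset.univ : Finset (UIdx n l)).erase ⟨i0, 0⟩} =>
        if c.1.2 = 0 then (if c.1.1 ∈ A then sv n l Q ⟨c.1.1, 0⟩ else C (Q c.1.1 (k c.1.1)))
        else X (c.1, 0)) := by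
    intro A
    induction A using Finset.induction_on with
    | empty =>
      have hq := s_indep n l _ ((s_desc n l (fun i : {x // x ∈ T} => Q i (k i))).2 h)
      let G : {c // c ∈ (Finset.univ : Finset (UIdx n l)).erase ⟨i0, 0⟩} × ℕ →
          (UIdx n l × ℕ) ⊕ ({x // x ∈ T} × ℕ) := fun p =>
        if h0 : p.1.1.2 = 0 then Sum.inr (⟨p.1.1.1, hmem _ (hne p.1 h0)⟩, p.2)
        else Sum.inl (p.1.1, p.2)
      have hG : Function.Injective G := by
        rintro ⟨⟨⟨i, a⟩, ha⟩, t⟩ ⟨⟨⟨j, b⟩, hb⟩, u⟩ hab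
        by_cases h1 : a = 0 <;> by_cases h2 : b = 0
        · subst h1; subst h2
          simp only [G, dite_true, Sum.inr.injEq, Prod.mk.injEq, Subtype.mk.injEq] at hab
          obtain ⟨h3, h4⟩ := hab
          subst h3; subst h4; rfl
        · simp [G, h1, h2] at hab
        · simp [G, h1, h2] at hab
        · simp only [G, h1, h2, dite_false, Sum.inl.injEq, Prod.mk.injEq] at hab
          obtain ⟨h3, h4⟩ := hab
          subst h4
          exact Prod.ext (Subtype.ext h3) rfl
      have := hq.comp G hG
      unfold SDind
      convert this using 1
      funext ⟨⟨⟨i, a⟩, ha⟩, t⟩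
      by_cases h1 : a = 0
      · subst h1
        simp [G, sσ_iter_C]
      · simp [G, h1, sσ_iter_X]
    | insert a A ha ih =>
      by_cases hai : a = i0
      · convert ih using 1
        funext c
        by_cases h0 : c.1.2 = 0
        · have := hne c h0
          simp [h0, hai, this]
        · simp [h0]
      · have hca : (⟨a, 0⟩ : UIdx n l) ∈ (Finset.univ : Finset (UIdx n l)).erase ⟨i0, 0⟩ := by
          refine Finset.mem_erase.2 ⟨fun hh => hai (congrArg Sigma.fst hh), Finset.mem_univ _⟩
        have := ih.translate (θ := (sθ n l ⟨a, k a⟩).toRingHom) (sσ_inj n l)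
          (sθ_inj n l ⟨a, k a⟩) (sθ_σ n l ⟨a, k a⟩) ⟨⟨a, 0⟩, hca⟩ (sv n l Q ⟨a, 0⟩) (by
            simp only [if_true, ha, if_false]
            exact sθ_v_self n l Q a (k a) (hk a)) (by
            intro j hj
            have hjm := Algebra.subset_adjoin (R := ℚ) (sdOrb_self (sσ n l)
              (Set.mem_image_of_mem (fun c : {c // c ∈ (Finset.univ : Finset (UIdx n l)).erase
                ⟨i0, 0⟩} => if c.1.2 = 0 then (if c.1.1 ∈ A then sv n l Q ⟨c.1.1, 0⟩ else
                  C (Q c.1.1 (k c.1.1))) else X (c.1, 0))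
                (show j ∈ ({⟨⟨a, 0⟩, hca⟩}ᶜ : Set _) from hj)))
            unfold sdD
            obtain ⟨⟨i, b⟩, hib⟩ := j
            by_cases h0 : b = 0
            · subst h0
              have hia : i ≠ a := by
                rintro rfl; exact hj rfl
              by_cases hiA : i ∈ A
              · simp only [if_true, hiA] at hjm ⊢
                have e : (sθ n l ⟨a, k a⟩).toRingHom (sv n l Q ⟨i, 0⟩) = sv n l Q ⟨i, 0⟩ :=
                  sθ_v_other n l Q a i (k a) hia
                rw [e]
                exact hjm
              · simp only [if_true, hiA, if_false] at hjm ⊢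
                have e : (sθ n l ⟨a, k a⟩).toRingHom (C (Q i (k i))) = C (Q i (k i)) :=
                  sθ_C n l _ _
                rw [e]
                exact hjm
            · simp only [h0, if_false] at hjm ⊢
              by_cases hcc : (⟨i, b⟩ : UIdx n l) = ⟨a, k a⟩
              · have e : (sθ n l ⟨a, k a⟩).toRingHom (X ((⟨i, b⟩ : UIdx n l), 0)) =
                    X ((⟨i, b⟩ : UIdx n l), 0) + 1 := by
                  refine (sθ_X n l _ _).trans (if_pos hcc)
                rw [e]
                exact Subalgebra.add_mem _ hjm (Subalgebra.one_mem _)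
              · have e : (sθ n l ⟨a, k a⟩).toRingHom (X ((⟨i, b⟩ : UIdx n l), 0)) =
                    X ((⟨i, b⟩ : UIdx n l), 0) := by
                  refine (sθ_X n l _ _).trans (if_neg hcc)
                rw [e]
                exact hjm)
        convert this using 1
        funext c
        by_cases hcc : c = ⟨⟨a, 0⟩, hca⟩
        · subst hcc; simp
        · rw [Function.update_of_ne hcc]
          obtain ⟨⟨i, b⟩, hib⟩ := c
          by_cases h0 : b = 0
          · subst h0
            have hia : i ≠ a := by
              rintro rfl; exact hcc rfl
            simp [hia]
          · simp [h0]
  convert key Finset.univ using 1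
  funext ⟨⟨i, b⟩, hib⟩
  by_cases h0 : b = 0
  · subst h0; simp
  · simp only [h0, if_false]
    exact sv_ne n l Q ⟨i, b⟩ h0

/-- For generic Laurent difference polynomials
`P_i = Σ_k u_{ik} M_{ik}` (Laurent monomials `M_{ik}` with exponents `d i k`, norm forms
`N_i` with exponents `e i k = d i k + g i`, minimal), the saturated difference ideal
`I_{Y,u} = ([N₀,…,Nₙ] : 𝕞)` is a reflexive prime difference ideal, and
`I_u = I_{Y,u} ∩ ℚ{u}` has codimension one iff there are `k_i ∈ {1,…,l_i}` with
`dtrdeg ℚ⟨M_{0k₀}/M_{00}, …, M_{nkₙ}/M_{n0}⟩/ℚ = n`. -/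
theorem stmt_11 (n s : ℕ) (l : Fin (n + 1) → ℕ) (hl : ∀ i, 1 ≤ l i)
    -- exponents of the Laurent monomials `M_{ik}`:
    (d : (i : Fin (n + 1)) → Fin (l i + 1) → Fin n → ℕ → ℤ)
    (hds : ∀ i k j κ, s < κ → d i k j κ = 0)
    -- exponents of the norm forms `N_i = M_i · P_i`:
    (g : Fin (n + 1) → Fin n → ℕ → ℤ)
    (e : (i : Fin (n + 1)) → Fin (l i + 1) → Fin n → ℕ → ℕ)
    (he : ∀ i k j κ, (e i k j κ : ℤ) = d i k j κ + g i j κ)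
    (hmin : ∀ i j κ, κ ≤ s → ∃ k, e i k j κ = 0)
    -- the norm forms:
    (N : Fin (n + 1) → MvPolynomial (DVar n l) ℚ)
    (hN : ∀ i, N i = ∑ k : Fin (l i + 1),
      X (Sum.inr (⟨i, k⟩, 0)) *
        ∏ j : Fin n, ∏ κ ∈ Finset.range (s + 1), X (Sum.inl (j, κ)) ^ (e i k j κ))
    -- `𝕞`: the multiplicative set of all difference monomials in `Y`:
    (mY : Submonoid (MvPolynomial (DVar n l) ℚ))
    (hmY : mY = Submonoid.closure
      (Set.range fun v : Fin n × ℕ => (X (Sum.inl v) : MvPolynomial (DVar n l) ℚ)))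
    -- the saturated difference ideal `I_{Y,u} = ([N₀,…,Nₙ] : 𝕞)` as a set:
    (SatSet : Set (MvPolynomial (DVar n l) ℚ))
    (hSat : SatSet = {p | ∃ M ∈ mY, M * p ∈
      Ideal.span (⋃ t : ℕ, (fun q => (tau n l ^ t) q) '' Set.range N)}) :
    (∃ I : Ideal (MvPolynomial (DVar n l) ℚ),
        (I : Set (MvPolynomial (DVar n l) ℚ)) = SatSet ∧ I.IsPrime ∧
        (∀ a, tau n l a ∈ I ↔ a ∈ I)) ∧
    (((∃ p ∈ SatSet, p ≠ 0 ∧ ∀ v ∈ p.vars, ∃ c t, v = Sum.inr (c, t)) ∧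
      ∃ S : Finset (UIdx n l), S.card = (∑ i, (l i + 1)) - 1 ∧
        ∀ p ∈ SatSet, (∀ v ∈ p.vars, ∃ c ∈ S, ∃ t, v = Sum.inr (c, t)) → p = 0) ↔
     (∃ k : (i : Fin (n + 1)) → Fin (l i + 1), (∀ i, k i ≠ 0) ∧
        dtrdegFam (fun p : Fin (n + 1) × ℕ =>
          ∏ j : Fin n, ∏ κ ∈ Finset.range (s + 1),
            (algebraMap (MvPolynomial (Fin n × ℕ) ℚ)
              (FractionRing (MvPolynomial (Fin n × ℕ) ℚ)) (X (j, κ + p.2))) ^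
              (d p.1 (k p.1) j κ - d p.1 0 j κ)) = n)) := by
  have hN' : ∀ i, N i = ∑ k : Fin (l i + 1), X (Sum.inr (⟨i, k⟩, 0)) * sM n s l e i k 0 := hN
  have hmem : ∀ p, p ∈ SatSet ↔ sφ n l (fun i k => sQ n s l d i k 0) p = 0 := by
    intro p
    rw [hSat, hmY]
    exact s_sat n s l d g e he N hN' p
  refine ⟨⟨RingHom.ker (sφ n l (fun i k => sQ n s l d i k 0)), ?_, RingHom.ker_isPrime _, ?_⟩, ?_⟩
  · ext p
    rw [hmem, SetLike.mem_coe, RingHom.mem_ker]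
  · intro a
    rw [RingHom.mem_ker, RingHom.mem_ker, sφ_tau, map_eq_zero_iff _ (sσ_inj n l)]
  · have hdt : ∀ k : (i : Fin (n + 1)) → Fin (l i + 1),
        (fun p : Fin (n + 1) × ℕ =>
          ∏ j : Fin n, ∏ κ ∈ Finset.range (s + 1),
            (algebraMap (MvPolynomial (Fin n × ℕ) ℚ)
              (FractionRing (MvPolynomial (Fin n × ℕ) ℚ)) (X (j, κ + p.2))) ^
              (d p.1 (k p.1) j κ - d p.1 0 j κ)) =
        fun p : Fin (n + 1) × ℕ => (sσ0 n)^[p.2] (sQ n s l d p.1 (k p.1) 0) := by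
      intro k
      funext p
      rw [sQ_iter]
      rfl
    simp only [hdt]
    constructor
    · rintro ⟨-, S, hS, hS'⟩
      obtain ⟨k, hk, T, hT, hT'⟩ := s_forward n l hl (fun i k => sQ n s l d i k 0) S hS
        ((s_conv n l _ S).1 fun p hp hv => hS' p ((hmem p).2 hp) hv)
      exact ⟨k, hk, (s_dtr n l (fun i => sQ n s l d i (k i) 0)).2 ⟨T, hT, hT'⟩⟩
    · rintro ⟨k, hk, hd⟩
      obtain ⟨T, hT, hT'⟩ := (s_dtr n l (fun i => sQ n s l d i (k i) 0)).1 hd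
      obtain ⟨S, hS, hS'⟩ := s_backward n l (fun i k => sQ n s l d i k 0) k hk T hT hT'
      refine ⟨?_, S, hS, fun p hp hv => (s_conv n l _ S).2 hS' p ((hmem p).1 hp) hv⟩
      by_contra hcon
      apply s_not_all n l (fun i k => sQ n s l d i k 0)
      rw [← s_conv]
      intro p hp hv
      by_contra hp0
      refine hcon ⟨p, (hmem p).2 hp, hp0, fun v hv' => ?_⟩
      obtain ⟨c, -, t, h⟩ := hv v hv'
      exact ⟨c, t, h⟩
end

section
/- Let A = (s_{ij}) be the (n+1) × n order matrix of a Laurent transformally essential difference system P_0, ..., P_n, where s_{ij} = ord(N(P_i), y_j) ∈ ℕ ∪ {−∞}, and let J_i = Jac(A_î) be the Jacobi number of the matrix obtained by deleting row i. Let R be the sparse difference resultant. Then for each i: if J_i = −∞ then the coefficients u_i of P_i do not appear in R (ord(R, u_i) = −∞), and if J_i ≥ 0 then ord(R, u_i) ≤ J_i. -/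
open MvPolynomial

/-- The order of `p` in the difference variable `y_j` (`⊥` means `y_j` does not occur). -/
noncomputable def ordY {n : ℕ} {l : Fin (n + 1) → ℕ}
    (p : MvPolynomial (DVar n l) ℚ) (j : Fin n) : WithBot ℕ :=
  p.vars.sup (fun v => match v with
    | Sum.inl (j', t) => if j' = j then (t : WithBot ℕ) else ⊥
    | Sum.inr _ => ⊥)

/-- The order of `p` in the coefficient set `u_i` (`⊥` means `u_i` does not occur). -/
noncomputable def ordU {n : ℕ} {l : Fin (n + 1) → ℕ}
    (p : MvPolynomial (DVar n l) ℚ) (i : Fin (n + 1)) : WithBot ℕ :=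
  p.vars.sup (fun v => match v with
    | Sum.inr (⟨i', _⟩, t) => if i' = i then (t : WithBot ℕ) else ⊥
    | Sum.inl _ => ⊥)

section Helpers

theorem trdeg_adjoin_le {k L : Type} [Field k] [Field L] [Algebra k L] {κ : Type}
    (a : κ → L) : Algebra.trdeg k (Algebra.adjoin k (Set.range a)) ≤ Cardinal.mk κ := by
  have h4 : Algebra.trdeg k (Algebra.adjoin k (Set.range a)) ≤
      Algebra.trdeg k (MvPolynomial κ k) := by
    rw [Algebra.adjoin_range_eq_range_aeval]
    exact trdeg_le_of_surjective (MvPolynomial.aeval a : MvPolynomial κ k →ₐ[k] L).rangeRestrict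
      (AlgHom.rangeRestrict_surjective _)
  rw [MvPolynomial.trdeg_of_isDomain, Cardinal.lift_id] at h4
  exact h4

theorem trdeg_of_alg {k S F : Type} [Field k] [CommRing S] [Field F] [Algebra k S] [Algebra k F]
    [Algebra S F] [IsScalarTower k S F] [FaithfulSMul S F] [Nontrivial S]
    [Algebra.IsAlgebraic S F] :
    Algebra.trdeg k F = Algebra.trdeg k S := by
  rw [← trdeg_add_eq k S (A := F), trdeg_eq_zero (R := S) (A := F), add_zero]

open IntermediateField.algebraAdjoinAdjoin in
theorem trdeg_field_adjoin {k L : Type} [Field k] [Field L] [Algebra k L] (s : Set L) :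
    Algebra.trdeg k (IntermediateField.adjoin k s) = Algebra.trdeg k (Algebra.adjoin k s) :=
  trdeg_of_alg

theorem dep_of_card {k L : Type} [Field k] [Field L] [Algebra k L] {ι κ : Type} [Fintype ι] [Fintype κ]
    (a : κ → L) (x : ι → L) (hx : ∀ i, x i ∈ IntermediateField.adjoin k (Set.range a))
    (hc : Fintype.card κ < Fintype.card ι) : ¬ AlgebraicIndependent k x := by
  intro h
  have h' : AlgebraicIndependent k
      (fun i => (⟨x i, hx i⟩ : IntermediateField.adjoin k (Set.range a))) :=
    AlgebraicIndependent.of_comp (IntermediateField.adjoin k (Set.range a)).val h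
  have h1 := h'.cardinalMk_le_trdeg
  rw [trdeg_field_adjoin] at h1
  have h5 := h1.trans (trdeg_adjoin_le a)
  rw [Cardinal.mk_fintype, Cardinal.mk_fintype, Nat.cast_le] at h5
  omega

/-- Egervary duality. -/
theorem egervary {n : ℕ} (a : Fin n → Fin n → WithBot ℕ) (j0 : ℕ)
    (hJ : Finset.univ.sup (fun σ : Equiv.Perm (Fin n) => ∑ j, a (σ j) j) = (j0 : WithBot ℕ)) :
    ∃ α β : Fin n → ℤ, (∀ r j (m : ℕ), a r j = (m : WithBot ℕ) → α r + m ≤ β j) ∧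
      ∑ j, β j ≤ ∑ r, α r + j0 := by
  classical
  -- a finite perfect matching
  obtain ⟨σ0, hσ0⟩ : ∃ σ : Equiv.Perm (Fin n), ∑ j, a (σ j) j ≠ ⊥ := by
    by_contra! hcon
    have : Finset.univ.sup (fun σ : Equiv.Perm (Fin n) => ∑ j, a (σ j) j) = ⊥ := by
      rw [Finset.sup_eq_bot_iff]; intro σ _; exact hcon σ
    rw [this] at hJ
    exact absurd hJ (by simp)
  have hfin : ∀ j, ∃ m : ℕ, a (σ0 j) j = (m : WithBot ℕ) := by
    intro j
    have : a (σ0 j) j ≠ ⊥ := fun h => hσ0 (WithBot.sum_eq_bot_iff.2 ⟨j, Finset.mem_univ _, h⟩)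
    exact ⟨_, (WithBot.coe_unbot _ this).symm⟩
  let Feas : (Fin n → ℤ) × (Fin n → ℤ) → Prop := fun p =>
    ∀ r j (m : ℕ), a r j = (m : WithBot ℕ) → p.1 r + m ≤ p.2 j
  let obj : (Fin n → ℤ) × (Fin n → ℤ) → ℤ := fun p => ∑ j, p.2 j - ∑ r, p.1 r
  have hobj : ∀ p, Feas p → 0 ≤ obj p := by
    intro p hp
    have : ∑ r, p.1 r = ∑ j, p.1 (σ0 j) := (Equiv.sum_comp σ0 _).symm
    simp only [obj, this, sub_nonneg]
    apply Finset.sum_le_sum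
    intro j _
    obtain ⟨m, hm⟩ := hfin j
    have := hp _ _ _ hm
    omega
  have hex : ∃ p, Feas p := by
    refine ⟨(fun _ => 0, fun j => ∑ r, (((a r j).unbotD 0 : ℕ) : ℤ)), ?_⟩
    intro r j m hm
    have := Finset.single_le_sum (f := fun r => (((a r j).unbotD 0 : ℕ) : ℤ))
      (fun r _ => by positivity) (Finset.mem_univ r)
    simp only [hm] at this
    simpa using this
  have hne : ∃ k : ℕ, ∃ p, Feas p ∧ obj p = k := by
    obtain ⟨p, hp⟩ := hex
    exact ⟨(obj p).toNat, p, hp, (Int.toNat_of_nonneg (hobj p hp)).symm⟩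
  obtain ⟨p, hp, hpk⟩ := Nat.find_spec hne
  have hminp : ∀ q, Feas q → obj p ≤ obj q := by
    intro q hq
    rw [hpk]
    have := Nat.find_min' hne ⟨q, hq, (Int.toNat_of_nonneg (hobj q hq)).symm⟩
    have := Int.toNat_of_nonneg (hobj q hq)
    omega
  -- tight rows
  let tight : Fin n → Finset (Fin n) := fun j =>
    Finset.univ.filter fun r => ∃ m : ℕ, a r j = (m : WithBot ℕ) ∧ p.1 r + m = p.2 j
  have hall : ∀ I : Finset (Fin n), I.card ≤ (I.biUnion tight).card := by
    intro I
    let q : (Fin n → ℤ) × (Fin n → ℤ) :=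
      (fun r => p.1 r - if r ∈ I.biUnion tight then 1 else 0, fun j => p.2 j - if j ∈ I then 1 else 0)
    have hq : Feas q := by
      intro r j m hm
      have h1 := hp r j m hm
      by_cases hj : j ∈ I
      · by_cases hr : r ∈ I.biUnion tight
        · simp only [q, hj, hr, if_true]; omega
        · have : p.1 r + m ≠ p.2 j := by
            intro h
            exact hr (Finset.mem_biUnion.2 ⟨j, hj, by simp only [tight, Finset.mem_filter, Finset.mem_univ, true_and]; exact ⟨m, hm, h⟩⟩)
          simp only [q, hj, hr, if_true, if_false]; omega
      · simp only [q, hj, if_false]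
        split_ifs <;> omega
    have h2 := hminp q hq
    simp only [obj, q, Finset.sum_sub_distrib, Finset.sum_ite_mem, Finset.univ_inter, Finset.sum_const, nsmul_eq_mul, mul_one] at h2
    omega
  obtain ⟨f, hfi, hft⟩ := (Finset.all_card_le_biUnion_card_iff_exists_injective tight).1 hall
  let σ : Equiv.Perm (Fin n) := Equiv.ofBijective f (Finite.injective_iff_bijective.1 hfi)
  have hσ : ∀ j, ∃ m : ℕ, a (σ j) j = (m : WithBot ℕ) ∧ p.1 (σ j) + m = p.2 j := by
    intro j
    have := hft j
    simp only [tight, Finset.mem_filter, Finset.mem_univ, true_and] at this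
    exact this
  choose m hm1 hm2 using hσ
  refine ⟨p.1, p.2, hp, ?_⟩
  have h3 : ∑ j, a (σ j) j ≤ (j0 : WithBot ℕ) := by
    rw [← hJ]
    exact Finset.le_sup (f := fun σ : Equiv.Perm (Fin n) => ∑ j, a (σ j) j) (Finset.mem_univ σ)
  simp only [hm1] at h3
  have h4 : ∑ j, m j ≤ j0 := by exact_mod_cast h3
  have h5 : ∑ r, p.1 r = ∑ j, p.1 (σ j) := (Equiv.sum_comp σ _).symm
  rw [h5]
  simp only [← hm2, Finset.sum_add_distrib]
  have : ((∑ j, m j : ℕ) : ℤ) ≤ j0 := by exact_mod_cast h4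
  push_cast at this
  linarith

/-- Koenig-type obstruction when no finite diagonal exists. -/
theorem hall_bot {n : ℕ} (a : Fin n → Fin n → WithBot ℕ)
    (hJ : Finset.univ.sup (fun σ : Equiv.Perm (Fin n) => ∑ j, a (σ j) j) = ⊥) :
    ∃ I C : Finset (Fin n), C.card < I.card ∧ ∀ r ∈ I, ∀ j, a r j ≠ ⊥ → j ∈ C := by
  classical
  let t : Fin n → Finset (Fin n) := fun r => Finset.univ.filter fun j => a r j ≠ ⊥
  by_contra! hcon
  have hall : ∀ I : Finset (Fin n), I.card ≤ (I.biUnion t).card := by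
    intro I
    by_contra hlt
    obtain ⟨r, hr, j, hj, hj'⟩ := hcon I (I.biUnion t) (not_le.1 hlt)
    exact hj' (Finset.mem_biUnion.2 ⟨r, hr, by simp [t, hj]⟩)
  obtain ⟨f, hfi, hft⟩ := (Finset.all_card_le_biUnion_card_iff_exists_injective t).1 hall
  let σ : Equiv.Perm (Fin n) := Equiv.ofBijective f (Finite.injective_iff_bijective.1 hfi)
  have h1 := (Finset.sup_eq_bot_iff _ _).1 hJ σ.symm (Finset.mem_univ _)
  obtain ⟨j, -, hj⟩ := WithBot.sum_eq_bot_iff.1 h1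
  have h2 := hft (σ.symm j)
  simp only [t, Finset.mem_filter, Finset.mem_univ, true_and] at h2
  have h3 : f (σ.symm j) = j := σ.apply_symm_apply j
  rw [h3] at h2
  exact h2 hj

theorem tau_pow_X (n : ℕ) (l : Fin (n + 1) → ℕ) (t : ℕ) :
    (∀ j κ, (tau n l ^ t) (X (Sum.inl (j, κ))) = X (Sum.inl (j, κ + t))) ∧
    (∀ c κ, (tau n l ^ t) (X (Sum.inr (c, κ))) = X (Sum.inr (c, κ + t))) := by
  induction t with
  | zero => simp
  | succ t ih =>
    constructor
    · intro j κ
      rw [pow_succ', RingHom.mul_def, RingHom.comp_apply, ih.1]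
      simp [tau, add_assoc]
    · intro j κ
      rw [pow_succ', RingHom.mul_def, RingHom.comp_apply, ih.2]
      simp [tau, add_assoc]

/-- the shifted monomials -/
noncomputable def mono {n : ℕ} (s : ℕ) (l : Fin (n + 1) → ℕ)
    (e : (i : Fin (n + 1)) → Fin (l i + 1) → Fin n → ℕ → ℕ) (i : Fin (n + 1)) (k : Fin (l i + 1))
    (t : ℕ) : MvPolynomial (DVar n l) ℚ :=
  ∏ j : Fin n, ∏ κ ∈ Finset.range (s + 1), X (Sum.inl (j, κ + t)) ^ (e i k j κ)

theorem exists_elim (n s : ℕ) (l : Fin (n + 1) → ℕ)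
    (e : (i : Fin (n + 1)) → Fin (l i + 1) → Fin n → ℕ → ℕ)
    (N : Fin (n + 1) → MvPolynomial (DVar n l) ℚ)
    (hN : ∀ i, N i = ∑ k : Fin (l i + 1),
      X (Sum.inr (⟨i, k⟩, 0)) *
        ∏ j : Fin n, ∏ κ ∈ Finset.range (s + 1), X (Sum.inl (j, κ)) ^ (e i k j κ))
    (mY : Submonoid (MvPolynomial (DVar n l) ℚ))
    (hmY : mY = Submonoid.closure
      (Set.range fun v : Fin n × ℕ => (X (Sum.inl v) : MvPolynomial (DVar n l) ℚ)))
    (K : Fin (n + 1) → ℕ) (B : Fin n → ℕ)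
    (hKB : ∀ i k j κ, κ ≤ s → e i k j κ ≠ 0 → ∀ t, t < K i → κ + t < B j)
    (hlt : ∑ j, B j < ∑ i, K i) :
    ∃ p : MvPolynomial (DVar n l) ℚ, p ≠ 0 ∧
      (∃ M ∈ mY, M * p ∈
        Ideal.span (⋃ t : ℕ, (fun q => (tau n l ^ t) q) '' Set.range N)) ∧
      ∀ v ∈ p.vars, ∃ i k t, t < K i ∧ v = Sum.inr (⟨i, k⟩, t) := by
  classical
  have hMmem : ∀ i k t, mono s l e i k t ∈ mY := by
    intro i k t
    rw [hmY]
    refine Submonoid.prod_mem _ fun j _ => Submonoid.prod_mem _ fun κ _ => Submonoid.pow_mem _ ?_ _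
    exact Submonoid.subset_closure ⟨(j, κ + t), rfl⟩
  have hM0 : mY ≤ nonZeroDivisors (MvPolynomial (DVar n l) ℚ) := by
    rw [hmY, Submonoid.closure_le]
    rintro _ ⟨v, rfl⟩
    exact mem_nonZeroDivisors_of_ne_zero (X_ne_zero _)
  have htau : ∀ i t, (tau n l ^ t) (N i) =
      ∑ k : Fin (l i + 1), X (Sum.inr (⟨i, k⟩, t)) * mono s l e i k t := by
    intro i t
    rw [hN, map_sum]
    refine Finset.sum_congr rfl fun k _ => ?_
    simp only [map_mul, map_prod, map_pow, (tau_pow_X n l t).1, (tau_pow_X n l t).2, mono, zero_add]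
  set I := Ideal.span (⋃ t : ℕ, (fun q => (tau n l ^ t) q) '' Set.range N) with hI
  have htauI : ∀ i t, (∑ k : Fin (l i + 1), X (Sum.inr (⟨i, k⟩, t)) * mono s l e i k t) ∈ I := by
    intro i t
    rw [← htau]
    exact Ideal.subset_span (Set.mem_iUnion.2 ⟨t, N i, ⟨i, rfl⟩, rfl⟩)
  let Bl := Localization mY
  have : IsDomain Bl := IsLocalization.isDomain_localization hM0
  let L := FractionRing Bl
  have hinv : ∀ i t, ∃ c : Bl, c * algebraMap _ Bl (mono s l e i 0 t) = 1 := by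
    intro i t
    obtain ⟨u, hu⟩ := IsLocalization.map_units Bl (⟨_, hMmem i 0 t⟩ : mY)
    exact ⟨↑u⁻¹, by rw [← hu]; simp⟩
  choose c hc using hinv
  -- substitution
  let sub0 : Fin (n + 1) → ℕ → Bl := fun i t =>
    - ∑ k : Fin (l i), algebraMap (MvPolynomial (DVar n l) ℚ) Bl (X (Sum.inr (⟨i, k.succ⟩, t)) * mono s l e i k.succ t) * c i t
  let sb : DVar n l → Bl := fun v => match v with
    | Sum.inl y => algebraMap (MvPolynomial (DVar n l) ℚ) Bl (X (Sum.inl y))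
    | Sum.inr (⟨i, k⟩, t) => if k = 0 then sub0 i t else
        algebraMap (MvPolynomial (DVar n l) ℚ) Bl (X (Sum.inr (⟨i, k⟩, t)))
  let ψ : MvPolynomial (DVar n l) ℚ →ₐ[ℚ] Bl := MvPolynomial.aeval sb
  have hψ : ∀ p, ψ p = 0 → ∃ M ∈ mY, M * p ∈ I := by
    intro p hp
    rw [← IsLocalization.algebraMap_mem_map_algebraMap_iff mY Bl]
    have hcomp : (Ideal.Quotient.mkₐ ℚ (I.map (algebraMap _ Bl))).comp ψ =
        (Ideal.Quotient.mkₐ ℚ (I.map (algebraMap _ Bl))).comp (Algebra.algHom ℚ _ Bl) := by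
      apply MvPolynomial.algHom_ext
      rintro (y | ⟨⟨i, k⟩, t⟩)
      · simp only [AlgHom.comp_apply, ψ, aeval_X, sb]; rfl
      · by_cases hk : k = 0
        · subst hk
          simp only [AlgHom.comp_apply, Ideal.Quotient.mkₐ_eq_mk]
          rw [eq_comm, Ideal.Quotient.eq]
          have h1 := Ideal.mul_mem_left (I.map (algebraMap _ Bl)) (c i t)
            (Ideal.mem_map_of_mem (algebraMap _ Bl) (htauI i t))
          convert h1 using 1
          rw [Fin.sum_univ_succ]
          simp only [ψ, aeval_X, sb, if_true, sub0, map_add, map_mul, map_sum, mul_add, Finset.mul_sum]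
          rw [sub_neg_eq_add]
          congr 1
          · rw [mul_left_comm, hc, mul_one]; rfl
          · refine Finset.sum_congr rfl fun k _ => ?_
            ring
        · simp only [AlgHom.comp_apply, ψ, aeval_X, sb, hk, if_false]; rfl
    have h2 := DFunLike.congr_fun hcomp p
    simp only [AlgHom.comp_apply, hp, map_zero] at h2
    exact Ideal.Quotient.eq_zero_iff_mem.1 h2.symm
  let ι := Σ i : Fin (n + 1), Fin (l i + 1) × Fin (K i)
  let κ' := (Σ j : Fin n, Fin (B j)) ⊕ (Σ i : Fin (n + 1), Fin (l i) × Fin (K i))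
  let toVar : ι → DVar n l := fun q => Sum.inr (⟨q.1, q.2.1⟩, q.2.2)
  have htoVar : Function.Injective toVar := by
    rintro ⟨i, k, t⟩ ⟨i', k', t'⟩ h
    simp only [toVar, Sum.inr.injEq, Prod.mk.injEq, Sigma.mk.injEq] at h
    obtain ⟨⟨rfl, h1⟩, h2⟩ := h
    obtain rfl := eq_of_heq h1
    obtain rfl := Fin.ext h2
    rfl
  let am : MvPolynomial (DVar n l) ℚ →ₐ[ℚ] L := (Algebra.algHom ℚ Bl L).comp (Algebra.algHom ℚ _ Bl)
  let a : κ' → L := fun q => match q with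
    | Sum.inl ⟨j, b⟩ => am (X (Sum.inl (j, (b : ℕ))))
    | Sum.inr ⟨i, k, t⟩ => am (X (Sum.inr (⟨i, k.succ⟩, (t : ℕ))))
  let x : ι → L := fun q => algebraMap Bl L (ψ (X (toVar q)))
  let F := IntermediateField.adjoin ℚ (Set.range a)
  have haF : ∀ q, a q ∈ F := fun q => IntermediateField.subset_adjoin _ _ ⟨q, rfl⟩
  have hmonoF : ∀ i k t, t < K i → am (mono s l e i k t) ∈ F := by
    intro i k t ht
    simp only [mono, map_prod, map_pow]
    refine prod_mem fun j _ => prod_mem fun κ hκ => ?_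
    by_cases he0 : e i k j κ = 0
    · rw [he0, pow_zero]; exact one_mem _
    · refine pow_mem ?_ _
      exact haF (Sum.inl ⟨j, ⟨κ + t, hKB i k j κ (by simpa [Nat.lt_succ_iff] using hκ) he0 t ht⟩⟩)
  have hxF : ∀ q, x q ∈ F := by
    rintro ⟨i, k, t⟩
    refine Fin.cases ?_ (fun k => ?_) k
    · simp only [x, toVar, ψ, aeval_X, sb, if_true, sub0]
      rw [RingHom.map_neg, map_sum]
      simp only [map_mul]
      refine neg_mem (sum_mem fun k _ => mul_mem (mul_mem ?_ ?_) ?_)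
      · exact haF (Sum.inr ⟨i, k, t⟩)
      · exact hmonoF i k.succ t t.2
      · have h1 : algebraMap Bl L (c i t) = (am (mono s l e i 0 t))⁻¹ := by
          have := congrArg (algebraMap Bl L) (hc i t)
          rw [map_mul, map_one] at this
          exact eq_inv_of_mul_eq_one_left this
        rw [h1]
        exact inv_mem (hmonoF i 0 t t.2)
    · simp only [x, toVar, ψ, aeval_X, sb, Fin.succ_ne_zero, if_false]
      exact haF (Sum.inr ⟨i, k, t⟩)
  have hcard : Fintype.card κ' < Fintype.card ι := by
    simp only [κ', ι, Fintype.card_sum, Fintype.card_sigma, Fintype.card_prod, Fintype.card_fin,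
      add_mul, one_mul, Finset.sum_add_distrib]
    omega
  have hdep := dep_of_card a x hxF hcard
  rw [algebraicIndependent_iff] at hdep
  push Not at hdep
  obtain ⟨p, hp0, hpne⟩ := hdep
  refine ⟨rename toVar p, ?_, ?_, ?_⟩
  · intro h
    exact hpne (rename_injective _ htoVar (by rw [h, map_zero]))
  · apply hψ
    apply IsFractionRing.injective Bl L
    rw [map_zero, ← hp0]
    have : (MvPolynomial.aeval x : MvPolynomial ι ℚ →ₐ[ℚ] L) =
        ((Algebra.algHom ℚ Bl L).comp ψ).comp (rename toVar) := by
      apply MvPolynomial.algHom_ext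
      intro q
      simp only [x, AlgHom.comp_apply, aeval_X, rename_X]; rfl
    rw [this]
    rfl
  · intro v hv
    have := vars_rename toVar p hv
    obtain ⟨q, -, rfl⟩ := Finset.mem_image.1 this
    exact ⟨q.1, q.2.1, q.2.2, q.2.2.2, rfl⟩

theorem le_ordY {n s : ℕ} {l : Fin (n + 1) → ℕ}
    (e : (i : Fin (n + 1)) → Fin (l i + 1) → Fin n → ℕ → ℕ)
    (N : Fin (n + 1) → MvPolynomial (DVar n l) ℚ)
    (hN : ∀ i, N i = ∑ k : Fin (l i + 1),
      X (Sum.inr (⟨i, k⟩, 0)) *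
        ∏ j : Fin n, ∏ κ ∈ Finset.range (s + 1), X (Sum.inl (j, κ)) ^ (e i k j κ))
    (i : Fin (n + 1)) (k : Fin (l i + 1)) (j : Fin n) (κ : ℕ) (hκ : κ ≤ s) (hne : e i k j κ ≠ 0) :
    (κ : WithBot ℕ) ≤ ordY (N i) j := by
  classical
  have hmem : (Sum.inl (j, κ) : DVar n l) ∈ (N i).vars := by
    by_contra hnot
    let f : DVar n l → ℚ := fun v => match v with
      | Sum.inl _ => 1
      | Sum.inr (c, _) => if c = ⟨i, k⟩ then 1 else 0
    let f' : DVar n l → ℚ := Function.update f (Sum.inl (j, κ)) 0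
    have h1 : eval₂Hom (RingHom.id ℚ) f (N i) = eval₂Hom (RingHom.id ℚ) f' (N i) := by
      refine eval₂Hom_congr' rfl (fun v hv _ => ?_) rfl
      have : v ≠ Sum.inl (j, κ) := fun h => hnot (h ▸ hv)
      simp [f', Function.update_of_ne this]
    have h2 : eval₂Hom (RingHom.id ℚ) f (N i) = 1 := by
      rw [hN]
      simp [f]
    have h3 : eval₂Hom (RingHom.id ℚ) f' (N i) = 0 := by
      rw [hN]
      simp only [map_sum, map_mul, map_prod, map_pow, eval₂Hom_X']
      refine Finset.sum_eq_zero fun k' _ => ?_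
      by_cases hk : k' = k
      · subst hk
        apply mul_eq_zero_of_right
        apply Finset.prod_eq_zero (Finset.mem_univ j)
        apply Finset.prod_eq_zero (Finset.mem_range.2 (Nat.lt_succ_of_le hκ))
        simp [f', hne]
      · apply mul_eq_zero_of_left
        simp [f', f, hk]
    rw [h2, h3] at h1
    exact one_ne_zero h1
  have := Finset.le_sup (f := fun v : DVar n l => match v with
    | Sum.inl (j', t) => if j' = j then (t : WithBot ℕ) else ⊥
    | Sum.inr _ => ⊥) hmem
  simpa [ordY] using this

end Helpers

/-- Let `A = (s_{ij})` with `s_{ij} = ord(N(P_i), y_j)` be the order matrix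
of a Laurent transformally essential system, `J_i = Jac(A_î)` the Jacobi number of the
matrix with row `i` deleted, and `R` the sparse difference resultant.  Then for each `i`:
`J_i = −∞` implies `ord(R, u_i) = −∞`, and if `J_i ≥ 0` then `ord(R, u_i) ≤ J_i`. -/
theorem stmt_14 (n s : ℕ) (l : Fin (n + 1) → ℕ) (hl : ∀ i, 1 ≤ l i)
    (d : (i : Fin (n + 1)) → Fin (l i + 1) → Fin n → ℕ → ℤ)
    (hds : ∀ i k j κ, s < κ → d i k j κ = 0)
    (g : Fin (n + 1) → Fin n → ℕ → ℤ)
    (e : (i : Fin (n + 1)) → Fin (l i + 1) → Fin n → ℕ → ℕ)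
    (he : ∀ i k j κ, (e i k j κ : ℤ) = d i k j κ + g i j κ)
    (hmin : ∀ i j κ, κ ≤ s → ∃ k, e i k j κ = 0)
    -- the norm forms `N(P_i)`:
    (N : Fin (n + 1) → MvPolynomial (DVar n l) ℚ)
    (hN : ∀ i, N i = ∑ k : Fin (l i + 1),
      X (Sum.inr (⟨i, k⟩, 0)) *
        ∏ j : Fin n, ∏ κ ∈ Finset.range (s + 1), X (Sum.inl (j, κ)) ^ (e i k j κ))
    (mY : Submonoid (MvPolynomial (DVar n l) ℚ))
    (hmY : mY = Submonoid.closure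
      (Set.range fun v : Fin n × ℕ => (X (Sum.inl v) : MvPolynomial (DVar n l) ℚ)))
    -- the elimination setting `I_{Y,u} = ([N₀,…,Nₙ] : 𝕞)`:
    (SatSet : Set (MvPolynomial (DVar n l) ℚ))
    (hSat : SatSet = {p | ∃ M ∈ mY, M * p ∈
      Ideal.span (⋃ t : ℕ, (fun q => (tau n l ^ t) q) '' Set.range N)})
    -- the system is Laurent transformally essential (`I_u` has codimension one):
    (hEss : ∃ S : Finset (UIdx n l), S.card = (∑ i, (l i + 1)) - 1 ∧
      ∀ p ∈ SatSet, (∀ v ∈ p.vars, ∃ c ∈ S, ∃ t, v = Sum.inr (c, t)) → p = 0)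
    -- `R` is the sparse difference resultant: the irreducible element of
    -- `I_u = I_{Y,u} ∩ ℚ{u}` of minimal order in each `u_i`:
    (R : MvPolynomial (DVar n l) ℚ)
    (hRu : ∀ v ∈ R.vars, ∃ c t, v = Sum.inr (c, t))
    (hRmem : R ∈ SatSet)
    (hRirr : Irreducible R)
    (hRmin : ∀ p ∈ SatSet, (∀ v ∈ p.vars, ∃ c t, v = Sum.inr (c, t)) → p ≠ 0 →
      ∀ i, ordU R i ≤ ordU p i)
    -- the Jacobi numbers `J_i` of the order matrix with row `i` deleted:
    (J : Fin (n + 1) → WithBot ℕ)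
    (hJ : ∀ i, J i = Finset.univ.sup
      (fun σ : Equiv.Perm (Fin n) => ∑ j : Fin n, ordY (N (i.succAbove (σ j))) j)) :
    ∀ i : Fin (n + 1),
      (J i = ⊥ → ordU R i = ⊥) ∧ (J i ≠ ⊥ → ordU R i ≤ J i) := by
  intro i
  have hordU : ∀ (K : Fin (n + 1) → ℕ) (p : MvPolynomial (DVar n l) ℚ),
      (∀ v ∈ p.vars, ∃ i k t, t < K i ∧ v = Sum.inr (⟨i, k⟩, t)) →
      ∀ b : WithBot ℕ, (∀ t, t < K i → (t : WithBot ℕ) ≤ b) → ordU p i ≤ b := by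
    intro K p hp b hb
    apply Finset.sup_le
    intro v hv
    obtain ⟨i', k, t, ht, rfl⟩ := hp v hv
    by_cases h : i' = i
    · subst h; simpa using hb t ht
    · simp [h]
  have key : ∀ (K : Fin (n + 1) → ℕ) (B : Fin n → ℕ),
      (∀ i k j κ, κ ≤ s → e i k j κ ≠ 0 → ∀ t, t < K i → κ + t < B j) →
      ∑ j, B j < ∑ i, K i → ∀ b : WithBot ℕ, (∀ t, t < K i → (t : WithBot ℕ) ≤ b) →
      ordU R i ≤ b := by
    intro K B h1 h2 b hb
    obtain ⟨p, hp0, hpS, hpv⟩ := exists_elim n s l e N hN mY hmY K B h1 h2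
    refine (hRmin p (by rw [hSat]; exact hpS) ?_ hp0 i).trans (hordU K p hpv b hb)
    intro v hv
    obtain ⟨i, k, t, -, rfl⟩ := hpv v hv
    exact ⟨_, _, rfl⟩
  have hY := fun i k j κ hκ hne => le_ordY (s := s) e N hN i k j κ hκ hne
  constructor
  · intro hbot
    rw [hJ] at hbot
    obtain ⟨I, C, hIC, hcol⟩ := hall_bot (fun r j => ordY (N (i.succAbove r)) j) hbot
    let c := C.card * s
    let K : Fin (n + 1) → ℕ := i.insertNth 0 (fun r => if r ∈ I then c + 1 else 0)
    have hKi : K i = 0 := by simp [K]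
    have hKr : ∀ r, K (i.succAbove r) = if r ∈ I then c + 1 else 0 := by intro r; simp [K]
    rw [← le_bot_iff]
    refine key K (fun j => if j ∈ C then c + s + 1 else 0) ?_ ?_ ⊥ ?_
    · intro i' k j κ hκ hne t ht
      rcases Fin.eq_self_or_eq_succAbove i i' with rfl | ⟨r, rfl⟩
      · omega
      · rw [hKr] at ht
        split_ifs at ht with hr
        · have : j ∈ C := by
            apply hcol r hr j
            intro h0
            have := hY _ k j κ hκ hne
            rw [h0] at this
            simp at this
          simp only [this, if_true]
          omega
        · omega
    · rw [Fin.sum_univ_succAbove _ i, hKi]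
      simp only [hKr, Finset.sum_ite_mem, Finset.univ_inter, Finset.sum_const, smul_eq_mul]
      have : (C.card + 1) * (c + 1) ≤ I.card * (c + 1) := Nat.mul_le_mul_right _ hIC
      have h2 : C.card * s = c := rfl
      nlinarith
    · intro t ht
      omega
  · intro hne
    obtain ⟨j0, hj0⟩ : ∃ m : ℕ, J i = (m : WithBot ℕ) := ⟨_, (WithBot.coe_unbot _ hne).symm⟩
    rw [hj0]
    rw [hJ] at hj0
    obtain ⟨α, β, hαβ, hsum⟩ := egervary (fun r j => ordY (N (i.succAbove r)) j) j0 hj0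
    let c : ℤ := ∑ r, |α r| + ∑ j, |β j| + j0 + s
    have hα : ∀ r, 0 ≤ α r + c := by
      intro r
      have h1 := Finset.single_le_sum (f := fun r => |α r|) (fun r _ => abs_nonneg _) (Finset.mem_univ r)
      have h2 : 0 ≤ ∑ j, |β j| := Finset.sum_nonneg fun j _ => abs_nonneg _
      have h3 := neg_abs_le (α r)
      simp only [c] at *
      omega
    have hβ : ∀ j, (j0 : ℤ) + s ≤ β j + c := by
      intro r
      have h1 := Finset.single_le_sum (f := fun r => |β r|) (fun r _ => abs_nonneg _) (Finset.mem_univ r)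
      have h2 : 0 ≤ ∑ j, |α j| := Finset.sum_nonneg fun j _ => abs_nonneg _
      have h3 := neg_abs_le (β r)
      simp only [c] at *
      omega
    let K : Fin (n + 1) → ℕ := i.insertNth (j0 + 1) (fun r => (α r + c).toNat + 1)
    have hKi : K i = j0 + 1 := by simp [K]
    have hKr : ∀ r, K (i.succAbove r) = (α r + c).toNat + 1 := by intro r; simp [K]
    refine key K (fun j => (β j + c).toNat + 1) ?_ ?_ _ ?_
    · intro i' k j κ hκ hne t ht
      rcases Fin.eq_self_or_eq_succAbove i i' with rfl | ⟨r, rfl⟩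
      · have := hβ j
        omega
      · rw [hKr] at ht
        have h1 := hY _ k j κ hκ hne
        have h2 : ordY (N (i.succAbove r)) j ≠ ⊥ := by
          intro h0; rw [h0] at h1; simp at h1
        obtain ⟨m, hm⟩ : ∃ m : ℕ, ordY (N (i.succAbove r)) j = (m : WithBot ℕ) :=
          ⟨_, (WithBot.coe_unbot _ h2).symm⟩
        have h3 := hαβ r j m hm
        rw [hm] at h1
        have h4 : κ ≤ m := by exact_mod_cast h1
        have := hα r
        have := hβ j
        omega
    · rw [Fin.sum_univ_succAbove _ i, hKi]
      simp only [hKr]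
      zify
      have e1 : ∀ r, ((α r + c).toNat : ℤ) = α r + c := fun r => Int.toNat_of_nonneg (hα r)
      have e2 : ∀ r, ((β r + c).toNat : ℤ) = β r + c := fun r =>
        Int.toNat_of_nonneg (by have := hβ r; omega)
      simp only [e1, e2, Finset.sum_add_distrib]
      linarith
    · intro t ht
      have : t ≤ j0 := by omega
      exact_mod_cast this
end
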